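/- Let n ≥ 2 and let E = E(r_1,…,r_n) ⊂ ℝ^{2n} be the open ellipsoid with symplectic half axes 1 = r_1 ≤ … ≤ r_n = R, where at least two of the half axes are different and R < 2^{1/(2n)}. For ε ∈ (0,1) set U_ε = (1+ε)E \ closure((1−ε)E) and ε₀ = (R−1)/(R+1). Then s(U_{ε₀}) ≤ (R^{2n} − 1)^{1/n} · 4πR²/(R+1)², and for every ε ∈ (ε₀, 1) the strict inequality s(U_{ε₀}) < s(U_ε) holds. -/

import Mathlib

open Metric Set MeasureTheory Real Filter Topology Bornology
open scoped ContDiff ENNReal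

noncomputable section

/-- `ℝ^{2n}` with the Euclidean structure. -/
abbrev R2n (n : ℕ) := EuclideanSpace ℝ (Fin (2 * n))

/-- The standard symplectic form `ω_st = Σ dx_i ∧ dy_i` on `ℝ^{2n}`,
evaluated on a pair of (tangent) vectors. -/
def sympForm (n : ℕ) (v w : R2n n) : ℝ :=
  ∑ i : Fin n,
    (v ⟨2 * i.1, by have := i.isLt; omega⟩ * w ⟨2 * i.1 + 1, by have := i.isLt; omega⟩ -
      v ⟨2 * i.1 + 1, by have := i.isLt; omega⟩ * w ⟨2 * i.1, by have := i.isLt; omega⟩)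

/-- `φ` is a symplectic embedding of the open set `N ⊆ ℝ^{2n}` into `U ⊆ ℝ^{2n}`:
a smooth injective map on `N` with image in `U` whose derivative preserves `ω_st`. -/
def IsSympEmbOn (n : ℕ) (N U : Set (R2n n)) (φ : R2n n → R2n n) : Prop :=
  IsOpen N ∧ ContDiffOn ℝ ∞ φ N ∧ InjOn φ N ∧ MapsTo φ N U ∧
    ∀ p ∈ N, ∀ v w : R2n n,
      sympForm n (fderiv ℝ φ p v) (fderiv ℝ φ p w) = sympForm n v w

/-- A symplectic embedding of (a neighbourhood of) an arbitrary set `A ⊆ ℝ^{2n}` into `U`. -/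
def SympEmbNbhd (n : ℕ) (A U : Set (R2n n)) : Prop :=
  ∃ N φ, A ⊆ N ∧ IsSympEmbOn n N U φ

/-- The spherical capacity `s(U)`. -/
def sphericalCap (n : ℕ) (U : Set (R2n n)) : ℝ≥0∞ :=
  sSup {c : ℝ≥0∞ | ∃ r : ℝ, 0 < r ∧ c = ENNReal.ofReal (π * r ^ 2) ∧
    SympEmbNbhd n (sphere (0 : R2n n) r) U}

/-- The quadratic form defining the ellipsoid with symplectic half axes `a i`. -/
def ellQ (n : ℕ) (a : Fin n → ℝ) (z : R2n n) : ℝ :=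
  ∑ i : Fin n,
    ((z ⟨2 * i.1, by have := i.isLt; omega⟩) ^ 2 +
      (z ⟨2 * i.1 + 1, by have := i.isLt; omega⟩) ^ 2) / (a i) ^ 2

/-- The open ellipsoid `E(a 0, …, a (n-1)) ⊆ ℝ^{2n}`. -/
def ellipsoid (n : ℕ) (a : Fin n → ℝ) : Set (R2n n) := {z | ellQ n a z < 1}

/-- The boundary `∂E(a 0, …, a (n-1)) ⊆ ℝ^{2n}` of an ellipsoid. -/
def ellipsoidBdry (n : ℕ) (a : Fin n → ℝ) : Set (R2n n) := {z | ellQ n a z = 1}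

/-- The ellipsoidal shell `U_ε = (1+ε)E \ closure((1-ε)E)`. -/
def ellShell (n : ℕ) (a : Fin n → ℝ) (ε : ℝ) : Set (R2n n) :=
  ellipsoid n (fun i => (1 + ε) * a i) \ closure (ellipsoid n (fun i => (1 - ε) * a i))

/-- The `δ`-shell capacity `c_δ(U)`, defined via embeddings of the closed
shells `r A_δ = closure(B_r) \ B_{r(1-δ)}`. -/
def shellCap (n : ℕ) (δ : ℝ) (U : Set (R2n n)) : ℝ≥0∞ :=
  sSup {c : ℝ≥0∞ | ∃ r : ℝ, 0 < r ∧ c = ENNReal.ofReal (π * r ^ 2) ∧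
    SympEmbNbhd n (closedBall (0 : R2n n) r \ ball 0 (r * (1 - δ))) U}

/-- The ellipsoidal capacity `e(U)`: the supremum of `π r₁²` over symplectic embeddings of
boundaries of ellipsoids with half axes `r₁ ≤ … ≤ r_n` (here `r₁ = ⨅ i, a i`). -/
def ellipsoidalCap (n : ℕ) (U : Set (R2n n)) : ℝ≥0∞ :=
  sSup {c : ℝ≥0∞ | ∃ a : Fin n → ℝ, (∀ i, 0 < a i) ∧ Monotone a ∧
    c = ENNReal.ofReal (π * (⨅ i, a i) ^ 2) ∧ SympEmbNbhd n (ellipsoidBdry n a) U}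

/-- The Gromov radius `c_B(U)`. -/
def gromovRadius (n : ℕ) (U : Set (R2n n)) : ℝ≥0∞ :=
  sSup {c : ℝ≥0∞ | ∃ r : ℝ, 0 < r ∧ c = ENNReal.ofReal (π * r ^ 2) ∧
    ∃ φ, IsSympEmbOn n (ball (0 : R2n n) r) U φ}

section NoRetraction

variable {E : Type*} [NormedAddCommGroup E] [InnerProductSpace ℝ E] [FiniteDimensional ℝ E]

/-- The determinant of `1 + t A` is, as a polynomial in `t`, determined by interpolation. -/
theorem exists_interpolation_det_one_add_smul {s : Finset ℝ}
    (hs : Module.finrank ℝ E < s.card) :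
    ∃ c : ℝ → ℝ, ∑ t ∈ s, c t = 1 ∧ ∀ A : E →L[ℝ] E,
      (ContinuousLinearMap.id ℝ E + A).det =
        ∑ t ∈ s, c t * (ContinuousLinearMap.id ℝ E + t • A).det := by
  classical
  have hne : s.Nonempty := Finset.card_pos.1 (by omega)
  have hinj : Set.InjOn (id : ℝ → ℝ) s := Function.injective_id.injOn
  refine ⟨fun t => (Lagrange.basis s id t).eval 1, ?_, fun A => ?_⟩
  · have := congrArg (Polynomial.eval 1) (Lagrange.sum_basis hinj hne)
    simpa [Polynomial.eval_finsetSum] using this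
  · let b := Module.finBasis ℝ E
    let M := LinearMap.toMatrix b b (A : E →ₗ[ℝ] E)
    let p : Polynomial ℝ := Matrix.det ((Polynomial.X : Polynomial ℝ) • M.map Polynomial.C +
      (1 : Matrix _ _ ℝ).map Polynomial.C)
    have hdeg : p.degree < s.card := by
      refine lt_of_le_of_lt Polynomial.degree_le_natDegree ?_
      have := Polynomial.natDegree_det_X_add_C_le M 1
      rw [Fintype.card_fin] at this
      exact_mod_cast lt_of_le_of_lt this hs
    have hev : ∀ t : ℝ, p.eval t = (ContinuousLinearMap.id ℝ E + t • A).det := by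
      intro t
      have h1 : (ContinuousLinearMap.id ℝ E + t • A).det
          = (LinearMap.toMatrix b b
            ((ContinuousLinearMap.id ℝ E + t • A : E →L[ℝ] E) : E →ₗ[ℝ] E)).det :=
        (LinearMap.det_toMatrix b _).symm
      rw [h1]
      simp only [p]
      rw [← Polynomial.coe_evalRingHom, RingHom.map_det]
      congr 1
      have h2 : ((ContinuousLinearMap.id ℝ E + t • A : E →L[ℝ] E) : E →ₗ[ℝ] E)
          = LinearMap.id + t • (A : E →ₗ[ℝ] E) := by
        ext; simp
      have h3 : LinearMap.toMatrix b b (LinearMap.id + t • (A : E →ₗ[ℝ] E)) = 1 + t • M := by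
        rw [map_add, map_smul, LinearMap.toMatrix_id]
      rw [h2, h3]
      ext i j
      by_cases hij : i = j <;>
        simp [RingHom.mapMatrix_apply, Matrix.map_apply, hij] <;> ring
    have h := congrArg (Polynomial.eval 1) (Lagrange.eq_interpolate hinj hdeg)
    rw [hev, one_smul] at h
    rw [h, Lagrange.interpolate_apply, Polynomial.eval_finsetSum]
    refine Finset.sum_congr rfl fun t _ => ?_
    simp only [Polynomial.eval_mul, Polynomial.eval_C, id, hev]
    ring

theorem det_one_add_pos_of_norm_lt_one {A : E →L[ℝ] E} (hA : ‖A‖ < 1) :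
    0 < (ContinuousLinearMap.id ℝ E + A).det := by
  have hne : ∀ t ∈ Icc (0 : ℝ) 1, (ContinuousLinearMap.id ℝ E + t • A).det ≠ 0 := by
    intro t ht h0
    obtain ⟨v, hv, hv0⟩ := (Submodule.exists_mem_ne_zero_of_ne_bot (p := LinearMap.ker
      ((ContinuousLinearMap.id ℝ E + t • A : E →L[ℝ] E) : E →ₗ[ℝ] E))
      (by
        have := LinearMap.bot_lt_ker_of_det_eq_zero (f := ((ContinuousLinearMap.id ℝ E + t • A : E →L[ℝ] E) : E →ₗ[ℝ] E)) h0
        exact this.ne'))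
    have h1 : v = -(t • A v) := by
      have : v + t • A v = 0 := by simpa using hv
      exact eq_neg_of_add_eq_zero_left this
    have h2 : ‖v‖ ≤ ‖A‖ * ‖v‖ := by
      calc ‖v‖ = ‖t • A v‖ := by conv_lhs => rw [h1, norm_neg]
        _ = t * ‖A v‖ := by rw [norm_smul, Real.norm_of_nonneg ht.1]
        _ ≤ 1 * ‖A v‖ := by gcongr; exact ht.2
        _ ≤ ‖A‖ * ‖v‖ := by rw [one_mul]; exact A.le_opNorm v
    have h3 : 0 < ‖v‖ := norm_pos_iff.2 hv0
    nlinarith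
  have hc : Continuous fun t : ℝ => (ContinuousLinearMap.id ℝ E + t • A).det :=
    ContinuousLinearMap.continuous_det.comp (by fun_prop)
  by_contra hneg
  push Not at hneg
  have h0 : (0 : ℝ) ∈ Icc ((ContinuousLinearMap.id ℝ E + (1 : ℝ) • A).det)
      ((ContinuousLinearMap.id ℝ E + (0 : ℝ) • A).det) := by
    refine ⟨by simpa using hneg, ?_⟩
    have : (ContinuousLinearMap.id ℝ E).det = 1 := by
      simp [ContinuousLinearMap.det]
    simp [this]
  obtain ⟨t, ht, h⟩ := intermediate_value_Icc' zero_le_one hc.continuousOn h0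
  exact hne t ht h

/-- A continuous self-map of a Euclidean space which is the identity off the unit ball has a
zero. -/
theorem exists_eq_zero_of_eq_self_of_one_le_norm {f : E → E} (hf : Continuous f)
    (hid : ∀ x, 1 ≤ ‖x‖ → f x = x) : ∃ x, f x = 0 := by
  let _ : MeasurableSpace E := borel E
  have _ : BorelSpace E := ⟨rfl⟩
  by_contra hzero
  push Not at hzero
  obtain ⟨g, hg, hgf, hgS, -⟩ := hf.exists_contDiff_approx_and_eqOn (ε := fun x => ‖f x‖) ⊤
    hf.norm (fun x => norm_pos_iff.2 (hzero x)) (S := {x | 2 ≤ ‖x‖}) (U := {x | 1 < ‖x‖})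
    (isClosed_le continuous_const continuous_norm)
    ((isOpen_lt continuous_const continuous_norm).mem_nhdsSet.2
      fun x (hx : 2 ≤ ‖x‖) => lt_of_lt_of_le one_lt_two hx)
    (contDiffOn_id.congr fun x (hx : 1 < ‖x‖) => hid x hx.le)
  have hg0 : ∀ x, g x ≠ 0 := by
    intro x h
    have := hgf x
    rw [h, dist_zero_left] at this
    exact lt_irrefl _ this
  have hgid : ∀ x, 2 ≤ ‖x‖ → g x = x := fun x hx => by
    rw [hgS hx, hid x (by linarith)]
  -- the retraction onto the sphere of radius 2
  set r : E → E := fun x => (2 * ‖g x‖⁻¹) • g x with hr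
  have hrC : ContDiff ℝ ∞ r :=
    (contDiff_const.mul ((hg.norm ℝ hg0).inv fun x => norm_ne_zero_iff.2 (hg0 x))).smul hg
  have hrn : ∀ x, ‖r x‖ = 2 := by
    intro x
    have : ‖g x‖ ≠ 0 := norm_ne_zero_iff.2 (hg0 x)
    simp [hr, norm_smul, this]
  have hrS : ∀ x, ‖x‖ = 2 → r x = x := by
    intro x hx
    simp [hr, hgid x hx.ge, hx]
  have hrd : Differentiable ℝ r := hrC.differentiable (by simp)
  set u : E → E := fun x => r x - x with hu
  have huC : ContDiff ℝ ∞ u := hrC.sub contDiff_id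
  have hud : Differentiable ℝ u := huC.differentiable (by simp)
  obtain ⟨L, hL⟩ : ∃ L : ℝ, ∀ x ∈ closedBall (0 : E) 2, ‖fderiv ℝ u x‖ ≤ L :=
    (isCompact_closedBall (0 : E) 2).exists_bound_of_continuousOn
      (huC.continuous_fderiv (by simp)).continuousOn
  have hL0 : 0 ≤ L := (norm_nonneg _).trans (hL 0 (by simp))
  have hLip : ∀ x ∈ closedBall (0 : E) 2, ∀ y ∈ closedBall (0 : E) 2,
      ‖u x - u y‖ ≤ L * ‖x - y‖ := fun x hx y hy =>
    (convex_closedBall (0 : E) 2).norm_image_sub_le_of_norm_fderiv_le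
      (fun z _ => hud z) hL hy hx
  -- extension of `u` by zero
  set w : E → E := fun x => if ‖x‖ ≤ 2 then u x else 0 with hw
  have hwout : ∀ x, 2 ≤ ‖x‖ → w x = 0 := by
    intro x hx
    rcases hx.eq_or_lt with h | h
    · simp [hw, hu, h.symm.le, hrS x h.symm]
    · simp [hw, not_le.2 h]
  have hwin : ∀ x, ‖x‖ ≤ 2 → w x = u x := fun x hx => by simp [hw, hx]
  have hmix : ∀ x y, ‖x‖ ≤ 2 → 2 ≤ ‖y‖ → ‖w x - w y‖ ≤ L * ‖x - y‖ := by
    intro x y hx hy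
    have hc : Continuous fun t : ℝ => ‖x + t • (y - x)‖ := by fun_prop
    obtain ⟨t, ht, hxt⟩ := intermediate_value_Icc zero_le_one hc.continuousOn
      (show (2 : ℝ) ∈ Icc (‖x + (0 : ℝ) • (y - x)‖) (‖x + (1 : ℝ) • (y - x)‖) by
        simpa using ⟨hx, hy⟩)
    set z := x + t • (y - x)
    have hz : ‖z‖ = 2 := hxt
    rw [hwout y hy, ← hwout z hz.ge, hwin x hx, hwin z hz.le]
    refine (hLip x (by simpa using hx) z (by simp [hz])).trans ?_
    gcongr
    have : x - z = t • (x - y) := by simp only [z, smul_sub]; abel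
    rw [this, norm_smul, Real.norm_of_nonneg ht.1]
    exact mul_le_of_le_one_left (norm_nonneg _) ht.2
  have hwL : ∀ x y, ‖w x - w y‖ ≤ L * ‖x - y‖ := by
    intro x y
    rcases le_total ‖x‖ 2 with hx | hx <;> rcases le_total ‖y‖ 2 with hy | hy
    · rw [hwin x hx, hwin y hy]
      exact hLip x (by simpa using hx) y (by simpa using hy)
    · exact hmix x y hx hy
    · rw [norm_sub_rev, norm_sub_rev x]; exact hmix y x hy hx
    · rw [hwout x hx, hwout y hy]; simp; positivity
  -- small perturbations of the identity preserve the ball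
  have hvol : ∀ t : ℝ, 0 ≤ t → t * (L + 1) < 1 →
      ∫ x in ball (0 : E) 2, (ContinuousLinearMap.id ℝ E + t • fderiv ℝ u x).det
        = (volume (ball (0 : E) 2)).toReal := by
    intro t ht0 ht
    have htL : t * L < 1 := by nlinarith
    have hsurj : ∀ y, ∃ x, x + t • w x = y := by
      intro y
      have hcon : ContractingWith (⟨t * L, by positivity⟩ : NNReal) fun x => y - t • w x := by
        refine ⟨by exact_mod_cast htL, LipschitzWith.of_dist_le_mul fun a b => ?_⟩
        rw [dist_eq_norm, dist_eq_norm]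
        have : y - t • w a - (y - t • w b) = -(t • (w a - w b)) := by
          rw [smul_sub]; abel
        rw [this, norm_neg, norm_smul, Real.norm_of_nonneg ht0]
        change _ ≤ t * L * _
        rw [mul_assoc]
        exact mul_le_mul_of_nonneg_left (hwL a b) ht0
      refine ⟨hcon.fixedPoint, ?_⟩
      have := hcon.fixedPoint_isFixedPt
      nth_rewrite 1 [← this.eq]
      simp
    have hinj : ∀ x y, x + t • w x = y + t • w y → x = y := by
      intro x y h
      have h1 : x - y = -(t • (w x - w y)) := by
        rw [smul_sub, neg_sub, sub_eq_sub_iff_add_eq_add, h, add_comm]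
      have h2 : ‖x - y‖ ≤ t * L * ‖x - y‖ := by
        conv_lhs => rw [h1]
        rw [norm_neg, norm_smul, Real.norm_of_nonneg ht0, mul_assoc]
        exact mul_le_mul_of_nonneg_left (hwL x y) ht0
      by_contra hne
      have : 0 < ‖x - y‖ := norm_pos_iff.2 (sub_ne_zero.2 hne)
      nlinarith
    have himg : (fun x => x + t • u x) '' ball (0 : E) 2 = ball (0 : E) 2 := by
      ext y
      constructor
      · rintro ⟨x, hx, rfl⟩
        by_contra hy
        have hx' : ‖x‖ < 2 := by simpa using hx
        have hy' : 2 ≤ ‖x + t • u x‖ := by simpa using hy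
        have := hinj x (x + t • u x) (by rw [hwout _ hy', hwin x hx'.le]; simp)
        rw [← this] at hy'
        linarith
      · intro hy
        obtain ⟨x, hx⟩ := hsurj y
        rcases lt_or_ge ‖x‖ 2 with h | h
        · exact ⟨x, by simpa using h, by simpa [hwin x h.le] using hx⟩
        · rw [hwout x h, smul_zero, add_zero] at hx
          have : ‖y‖ < 2 := by simpa using hy
          rw [hx] at h; linarith
    have hder : ∀ x ∈ ball (0 : E) 2, HasFDerivWithinAt (fun x => x + t • u x)
        (ContinuousLinearMap.id ℝ E + t • fderiv ℝ u x) (ball (0 : E) 2) x := fun x _ =>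
      ((hasFDerivAt_id x).add ((hud x).hasFDerivAt.const_smul t)).hasFDerivWithinAt
    have hinjOn : InjOn (fun x => x + t • u x) (ball (0 : E) 2) := by
      intro x hx y hy h
      have hx' : ‖x‖ < 2 := by simpa using hx
      have hy' : ‖y‖ < 2 := by simpa using hy
      exact hinj x y (by rw [hwin x hx'.le, hwin y hy'.le]; exact h)
    have hch := integral_image_eq_integral_abs_det_fderiv_smul volume measurableSet_ball hder
      hinjOn (fun _ => (1 : ℝ))
    rw [himg] at hch
    simp only [smul_eq_mul, mul_one, integral_const, measureReal_restrict_apply_univ] at hch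
    rw [← measureReal_def, hch]
    refine setIntegral_congr_fun measurableSet_ball fun x hx => (abs_of_pos ?_).symm
    refine det_one_add_pos_of_norm_lt_one ?_
    rw [norm_smul, Real.norm_of_nonneg ht0]
    have := hL x (ball_subset_closedBall hx)
    nlinarith
  -- interpolation at small nodes
  set d := Module.finrank ℝ E
  let τ : ℕ → ℝ := fun i => ((i : ℝ) + 1) / ((d + 2) * (L + 1))
  have hτ : Function.Injective τ := by
    intro i j h
    have h1 : ((d : ℝ) + 2) * (L + 1) ≠ 0 := by positivity
    simp only [τ] at h
    rw [div_left_inj' h1] at h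
    exact_mod_cast add_right_cancel h
  let s : Finset ℝ := (Finset.range (d + 1)).image τ
  have hs : d < s.card := by
    rw [Finset.card_image_of_injective _ hτ]; simp
  obtain ⟨c, hc1, hc⟩ := exists_interpolation_det_one_add_smul hs
  have hsmall : ∀ t ∈ s, 0 ≤ t ∧ t * (L + 1) < 1 := by
    intro t ht
    obtain ⟨i, hi, rfl⟩ := Finset.mem_image.1 ht
    have hi' : (i : ℝ) < d + 1 := by exact_mod_cast Finset.mem_range.1 hi
    refine ⟨by positivity, ?_⟩
    have h1 : (0 : ℝ) < L + 1 := by positivity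
    simp only [τ]
    rw [div_mul_eq_mul_div, div_lt_one (by positivity)]
    nlinarith
  have hdet0 : ∀ x, (ContinuousLinearMap.id ℝ E + fderiv ℝ u x).det = 0 := by
    intro x
    have h1 : ContinuousLinearMap.id ℝ E + fderiv ℝ u x = fderiv ℝ r x := by
      rw [hu, fderiv_fun_sub (hrd x) differentiableAt_fun_id, fderiv_fun_id]; abel
    rw [h1]
    by_contra hne
    have h2 : ∀ v, inner ℝ (r x) (fderiv ℝ r x v) = 0 := by
      intro v
      have h3 := ((hrd x).hasFDerivAt.inner ℝ (hrd x).hasFDerivAt)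
      have h4 : (fun y => inner ℝ (r y) (r y)) = fun _ => (4 : ℝ) := by
        ext y; rw [real_inner_self_eq_norm_sq, hrn]; norm_num
      rw [h4] at h3
      have h5 := congrArg (fun A => A v) (h3.unique (hasFDerivAt_const (4 : ℝ) x))
      simp [real_inner_comm] at h5
      rw [real_inner_comm] at h5
      rw [real_inner_comm]
      linarith
    obtain ⟨v, hv⟩ := ((fderiv ℝ r x).toContinuousLinearEquivOfDetNeZero hne).surjective (r x)
    have h6 := h2 v
    have hv' : fderiv ℝ r x v = r x := hv
    rw [hv', real_inner_self_eq_norm_sq, hrn] at h6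
    norm_num at h6
  have hcontD : Continuous fun x => fderiv ℝ u x := huC.continuous_fderiv (by simp)
  have hIntg : ∀ t : ℝ, IntegrableOn (fun x => (ContinuousLinearMap.id ℝ E + t • fderiv ℝ u x).det)
      (ball (0 : E) 2) := by
    intro t
    have : Continuous fun x => (ContinuousLinearMap.id ℝ E + t • fderiv ℝ u x).det :=
      ContinuousLinearMap.continuous_det.comp (by fun_prop)
    exact (this.continuousOn.integrableOn_compact (isCompact_closedBall (0 : E) 2)).mono_set
      ball_subset_closedBall
  have h0 : ∫ x in ball (0 : E) 2, (ContinuousLinearMap.id ℝ E + fderiv ℝ u x).det = 0 := by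
    simp [hdet0]
  have h1 : ∫ x in ball (0 : E) 2, (ContinuousLinearMap.id ℝ E + fderiv ℝ u x).det
      = (volume (ball (0 : E) 2)).toReal := by
    rw [integral_congr_ae (ae_of_all _ fun x => hc (fderiv ℝ u x)),
      integral_finsetSum _ fun t _ => (hIntg t).const_mul _]
    simp_rw [integral_const_mul]
    rw [Finset.sum_congr rfl fun t ht => by rw [hvol t (hsmall t ht).1 (hsmall t ht).2],
      ← Finset.sum_mul, hc1, one_mul]
  have h2 : 0 < (volume (ball (0 : E) 2)).toReal :=
    ENNReal.toReal_pos (measure_ball_pos _ _ two_pos).ne' measure_ball_lt_top.ne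
  linarith

end NoRetraction

section Linking

variable {E : Type*} [NormedAddCommGroup E] [InnerProductSpace ℝ E]

/-- Moving along the gradient for a short time increases the function. -/
theorem add_half_mul_norm_sq_le_of_lipschitz_gradient {Φ : E → ℝ} {g : E → E} {K : ℝ}
    (hΦ : ∀ x, HasFDerivAt Φ (innerSL ℝ (g x)) x) (hg : ∀ x y, ‖g x - g y‖ ≤ K * ‖x - y‖)
    (x : E) {s : ℝ} (hs : 0 ≤ s) (hKs : K * s ≤ 1 / 2) :
    Φ x + s / 2 * ‖g x‖ ^ 2 ≤ Φ (x + s • g x) := by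
  have hd : ∀ σ : ℝ, HasDerivAt (fun σ : ℝ => Φ (x + σ • g x))
      (inner ℝ (g (x + σ • g x)) (g x)) σ := by
    intro σ
    have h1 : HasDerivAt (fun σ : ℝ => x + σ • g x) (g x) σ := by
      simpa using ((hasDerivAt_id σ).smul_const (g x)).const_add x
    simpa [Function.comp_def] using (hΦ _).comp_hasDerivAt σ h1
  have hle : ∀ σ ∈ interior (Icc 0 s), 1 / 2 * ‖g x‖ ^ 2 ≤
      deriv (fun σ : ℝ => Φ (x + σ • g x)) σ := by
    intro σ hσ
    rw [interior_Icc] at hσ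
    rw [(hd σ).deriv]
    have h1 : inner ℝ (g (x + σ • g x)) (g x) =
        ‖g x‖ ^ 2 - inner ℝ (g x - g (x + σ • g x)) (g x) := by
      rw [inner_sub_left, real_inner_self_eq_norm_sq]; ring
    have h2 := real_inner_le_norm (g x - g (x + σ • g x)) (g x)
    have h3 := hg x (x + σ • g x)
    have h4 : ‖x - (x + σ • g x)‖ = σ * ‖g x‖ := by
      rw [sub_add_cancel_left, norm_neg, norm_smul, Real.norm_of_nonneg hσ.1.le]
    rw [h4] at h3
    have h5 : K * (σ * ‖g x‖) * ‖g x‖ ≤ 1 / 2 * ‖g x‖ ^ 2 := by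
      have hK : K * σ ≤ 1 / 2 := by
        rcases le_total K 0 with hK | hK
        · nlinarith [mul_nonneg (neg_nonneg.2 hK) hσ.1.le]
        · exact (mul_le_mul_of_nonneg_left hσ.2.le hK).trans hKs
      nlinarith [mul_le_mul_of_nonneg_right hK (sq_nonneg ‖g x‖)]
    have h6 := mul_le_mul_of_nonneg_right h3 (norm_nonneg (g x))
    rw [h1]; linarith
  have := (convex_Icc 0 s).mul_sub_le_image_sub_of_le_deriv
    (fun σ _ => (hd σ).continuousAt.continuousWithinAt)
    (fun σ _ => (hd σ).differentiableAt.differentiableWithinAt) hle 0 (left_mem_Icc.2 hs) s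
    (right_mem_Icc.2 hs) hs
  simp only [zero_smul, add_zero, sub_zero] at this
  linarith

/-- Piecewise affine interpolation of the discrete gradient flow with step `τ`. -/
def gradientSteps (g : E → E) (τ : ℝ) : ℕ → ℝ → E → E
  | 0, _, x => x
  | j + 1, t, x => gradientSteps g τ j t x +
      (τ * max 0 (min 1 (t - j))) • g (gradientSteps g τ j t x)

theorem continuous_gradientSteps {g : E → E} (hg : Continuous g) (τ : ℝ) (j : ℕ) :
    Continuous fun p : ℝ × E => gradientSteps g τ j p.1 p.2 := by
  induction j with
  | zero => exact continuous_snd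
  | succ j ih =>
    simp only [gradientSteps]
    exact ih.add ((by fun_prop : Continuous fun p : ℝ × E =>
      τ * max 0 (min 1 (p.1 - j))).smul (hg.comp ih))

theorem gradientSteps_zero (g : E → E) (τ : ℝ) (j : ℕ) (x : E) :
    gradientSteps g τ j 0 x = x := by
  induction j with
  | zero => rfl
  | succ j ih =>
    have : max (0 : ℝ) (min 1 (0 - (j : ℝ))) = 0 := by
      rw [max_eq_left]
      exact (min_le_right _ _).trans (by simp)
    simp [gradientSteps, ih]

/-- A finite-dimensional linking theorem producing almost critical points. -/
theorem exists_almost_critical_of_linking [FiniteDimensional ℝ E] {Φ : E → ℝ} {g : E → E} {K : ℝ}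
    (hΦ : ∀ x, HasFDerivAt Φ (innerSL ℝ (g x)) x) (hg : ∀ x y, ‖g x - g y‖ ≤ K * ‖x - y‖)
    (P : E →L[ℝ] E) (hP : ∀ x, P (P x) = P x) {e : E} (hPe : P e = e) (he : e ≠ 0)
    {α β ϱ : ℝ} (hϱ : 0 < ϱ)
    (hS : ∀ x, P x = x → ‖x‖ = ϱ → α ≤ Φ x)
    (hX : ∀ x, ∀ s : ℝ, 0 ≤ s → P x = s • e → Φ x ≤ β)
    (hα : ∀ x, P x = 0 → Φ x < α) {δ : ℝ} (hδ : 0 < δ) :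
    ∃ x, α ≤ Φ x ∧ Φ x ≤ β ∧ ‖g x‖ ≤ δ := by
  by_contra hno
  push Not at hno
  have hgc : Continuous g := by
    refine continuous_iff_continuousAt.2 fun x => ?_
    refine continuousAt_of_locally_lipschitz one_pos K fun y _ => ?_
    rw [dist_eq_norm, dist_eq_norm]; exact hg y x
  set τ : ℝ := 1 / (2 * (|K| + 1)) with hτ
  have hτ0 : 0 < τ := by positivity
  have hKτ : ∀ s, 0 ≤ s → s ≤ 1 → K * (τ * s) ≤ 1 / 2 := by
    intro s h0 h1
    have h2 : K * (τ * s) ≤ (|K| + 1) * (τ * s) :=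
      mul_le_mul_of_nonneg_right (by linarith [le_abs_self K]) (by positivity)
    have h3 : (|K| + 1) * τ = 1 / 2 := by rw [hτ]; field_simp
    nlinarith
  have hmono : ∀ j t x, Φ x ≤ Φ (gradientSteps g τ j t x) := by
    intro j t x
    induction j with
    | zero => exact le_rfl
    | succ j ih =>
      refine ih.trans ?_
      simp only [gradientSteps]
      have hs0 : 0 ≤ max (0 : ℝ) (min 1 (t - j)) := le_max_left _ _
      have hs1 : max (0 : ℝ) (min 1 (t - j)) ≤ 1 := max_le zero_le_one (min_le_left _ _)
      have := add_half_mul_norm_sq_le_of_lipschitz_gradient hΦ hg (gradientSteps g τ j t x)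
        (mul_nonneg hτ0.le hs0) (hKτ _ hs0 hs1)
      have h2 : 0 ≤ τ * max (0 : ℝ) (min 1 (t - j)) / 2 * ‖g (gradientSteps g τ j t x)‖ ^ 2 := by
        positivity
      linarith
  obtain ⟨N, hN⟩ := exists_nat_gt ((β - α) / (τ / 2 * δ ^ 2))
  rw [div_lt_iff₀ (by positivity)] at hN
  have hgrow : ∀ x, α ≤ Φ x → ∀ j ≤ N, β < Φ (gradientSteps g τ j N x) ∨
      α + j * (τ / 2 * δ ^ 2) ≤ Φ (gradientSteps g τ j N x) := by
    intro x hx j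
    induction j with
    | zero => intro _; right; simpa [gradientSteps] using hx
    | succ j ih =>
      intro hj
      have h1 : max (0 : ℝ) (min 1 ((N : ℝ) - j)) = 1 := by
        have : (1 : ℝ) ≤ N - j := by
          rw [le_sub_iff_add_le]; exact_mod_cast (by omega : 1 + j ≤ N)
        rw [min_eq_left this, max_eq_right zero_le_one]
      set y := gradientSteps g τ j N x with hy
      have h2 : gradientSteps g τ (j + 1) N x = y + τ • g y := by
        simp [gradientSteps, h1, ← hy]
      have h3 := add_half_mul_norm_sq_le_of_lipschitz_gradient hΦ hg y hτ0.le
        (by simpa using hKτ 1 zero_le_one le_rfl)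
      have h4 : 0 ≤ τ / 2 * ‖g y‖ ^ 2 := by positivity
      rw [h2]
      rcases le_or_gt (Φ y) β with hb | hb
      · rcases ih (by omega) with h | h
        · exact absurd hb (not_le.2 h)
        · right
          have h5 := hno y (hx.trans (hmono j N x)) hb
          have h6 : τ / 2 * δ ^ 2 ≤ τ / 2 * ‖g y‖ ^ 2 := by gcongr
          push_cast
          linarith
      · left; linarith
  set Γ : ℝ → E → E := fun t x => P (gradientSteps g τ N t x) with hΓ
  have hΓc : Continuous fun p : ℝ × E => Γ p.1 p.2 :=
    P.continuous.comp (continuous_gradientSteps hgc τ N)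
  have hΓ0 : ∀ x, P x = x → ‖x‖ = ϱ → ∀ t, Γ t x ≠ 0 := fun x hx hn t h =>
    absurd (hα _ h) (not_lt.2 ((hS x hx hn).trans (hmono N t x)))
  have hΓN : ∀ x, P x = x → ‖x‖ = ϱ → ∀ s : ℝ, 0 ≤ s → Γ N x ≠ s • e := by
    intro x hx hn s hs h
    have h1 := hX _ s hs h
    rcases hgrow x (hS x hx hn) N le_rfl with h2 | h2 <;> linarith
  -- the map violating the Brouwer-type lemma
  let F : Submodule ℝ E := LinearMap.range (P : E →ₗ[ℝ] E)
  have hF : ∀ x : F, P x = x := by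
    rintro ⟨_, y, rfl⟩; exact hP y
  have heF : e ∈ F := ⟨e, hPe⟩
  have hΓF : ∀ t x, Γ t x ∈ F := fun t x => ⟨_, rfl⟩
  let lam : F → ℝ := fun x => max 0 (min 1 (4 * ‖x‖ - 1))
  let time : F → ℝ := fun x => N * max 0 (min 1 (2 * (1 - ‖x‖)))
  let pt : F → E := fun x => (ϱ * (max ‖x‖ (1 / 4))⁻¹) • (x : E)
  have hptc : Continuous pt := by
    refine Continuous.smul (continuous_const.mul (Continuous.inv₀ (by fun_prop) fun x => ?_))
      continuous_subtype_val
    exact (lt_of_lt_of_le (by norm_num) (le_max_right _ _)).ne'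
  have htime : Continuous time := by fun_prop
  let f : F → F := fun x => (max 1 ‖x‖) •
    ((lam x * ϱ⁻¹) • (⟨Γ (time x) (pt x), hΓF _ _⟩ : F) - (1 - lam x) • (⟨e, heF⟩ : F))
  have hfc : Continuous f := by
    have h1 : Continuous fun x : F => (⟨Γ (time x) (pt x), hΓF _ _⟩ : F) :=
      (hΓc.comp (htime.prodMk hptc)).subtype_mk _
    exact (by fun_prop : Continuous fun x : F => max 1 ‖x‖).smul
      (((by fun_prop : Continuous fun x : F => lam x * ϱ⁻¹).smul h1).sub
        ((by fun_prop : Continuous fun x : F => 1 - lam x).smul continuous_const))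
  have hpt : ∀ x : F, 1 / 4 ≤ ‖x‖ → P (pt x) = pt x ∧ ‖pt x‖ = ϱ := by
    intro x hx
    have hx0 : 0 < ‖x‖ := lt_of_lt_of_le (by norm_num) hx
    refine ⟨by simp only [pt]; rw [map_smul, hF x], ?_⟩
    simp only [pt]
    rw [norm_smul, max_eq_left hx, Real.norm_of_nonneg (by positivity), Submodule.coe_norm]
    rw [Submodule.coe_norm] at hx0
    field_simp
  obtain ⟨x, hx⟩ := exists_eq_zero_of_eq_self_of_one_le_norm hfc (by
    intro x hx
    have h1 : lam x = 1 := by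
      simp only [lam]; rw [min_eq_left (by linarith), max_eq_right zero_le_one]
    have h2 : time x = 0 := by
      simp only [time]; rw [min_eq_right (by linarith), max_eq_left (by linarith), mul_zero]
    have h3 : max ‖x‖ (1 / 4) = ‖x‖ := max_eq_left (by linarith)
    have h4 : Γ 0 (pt x) = pt x := by
      simp only [hΓ, gradientSteps_zero]; exact (hpt x (by linarith)).1
    ext
    simp only [f, h1, h2, h4, max_eq_right hx]
    simp only [pt, h3, Submodule.coe_smul, sub_self, zero_smul, sub_zero,
      smul_smul]
    have : (‖x‖ * (1 * ϱ⁻¹ * (ϱ * ‖x‖⁻¹))) = 1 := by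
      have : ‖x‖ ≠ 0 := by linarith
      field_simp
    rw [mul_assoc, mul_assoc] at *
    rw [this, one_smul])
  have hx' : (lam x * ϱ⁻¹) • Γ (time x) (pt x) = (1 - lam x) • e := by
    have h1 : (0 : ℝ) < max 1 ‖x‖ := lt_of_lt_of_le one_pos (le_max_left _ _)
    have h2 := (smul_eq_zero.1 hx).resolve_left h1.ne'
    have h3 := congrArg Subtype.val h2
    simp only [Submodule.coe_smul, Submodule.coe_sub, Submodule.coe_zero] at h3
    exact sub_eq_zero.1 h3
  rcases le_or_gt ‖x‖ (1 / 4) with h | h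
  · have h1 : lam x = 0 := by
      simp only [lam]; rw [min_eq_right (by linarith), max_eq_left (by linarith)]
    rw [h1] at hx'
    simp at hx'
    exact he hx'.symm
  · obtain ⟨hp1, hp2⟩ := hpt x h.le
    have hl0 : 0 < lam x := lt_max_of_lt_right (lt_min one_pos (by linarith))
    have hl1 : lam x ≤ 1 := max_le zero_le_one (min_le_left _ _)
    rcases le_or_gt (1 / 2) ‖x‖ with h2 | h2
    · have h1 : lam x = 1 := by
        simp only [lam]; rw [min_eq_left (by linarith), max_eq_right zero_le_one]
      rw [h1] at hx'
      simp only [one_mul, sub_self, zero_smul] at hx'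
      exact hΓ0 _ hp1 hp2 _ ((smul_eq_zero.1 hx').resolve_left (by positivity))
    · have h1 : time x = N := by
        simp only [time]; rw [min_eq_left (by linarith), max_eq_right zero_le_one, mul_one]
      rw [h1] at hx'
      refine hΓN _ hp1 hp2 ((lam x * ϱ⁻¹)⁻¹ * (1 - lam x)) ?_ ?_
      · have : 0 ≤ 1 - lam x := by linarith
        positivity
      · rw [mul_smul, ← hx', smul_smul, inv_mul_cancel₀ (by positivity), one_smul]

end Linking

section Loops

variable {V : Type*} [NormedAddCommGroup V] [InnerProductSpace ℝ V]

/-- `J` is a complex structure compatible with the inner product. -/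
structure IsOrthogonalComplexStructure (J : V →L[ℝ] V) : Prop where
  apply_apply : ∀ v, J (J v) = -v
  inner_apply_apply : ∀ v w, inner ℝ (J v) (J w) = inner ℝ v w

/-- Rotation by the angle `θ`, i.e. multiplication by `e^{Jθ}`. -/
def rot (J : V →L[ℝ] V) (θ : ℝ) : V →L[ℝ] V :=
  Real.cos θ • ContinuousLinearMap.id ℝ V + Real.sin θ • J

variable {J : V →L[ℝ] V}

theorem rot_apply (θ : ℝ) (v : V) : rot J θ v = Real.cos θ • v + Real.sin θ • J v := by
  simp [rot]

@[simp] theorem rot_zero (v : V) : rot J 0 v = v := by simp [rot_apply]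

theorem rot_add_int_mul_two_pi (θ : ℝ) (k : ℤ) (v : V) :
    rot J (θ + k * (2 * π)) v = rot J θ v := by
  simp [rot_apply, Real.cos_add_int_mul_two_pi, Real.sin_add_int_mul_two_pi]

@[fun_prop]
theorem continuous_rot : Continuous (rot J) := by unfold rot; fun_prop

theorem hasDerivAt_rot_aux (a t : ℝ) (v : V) :
    HasDerivAt (fun t : ℝ => rot J (a * t) v)
      (a • (-Real.sin (a * t) • v + Real.cos (a * t) • J v)) t := by
  simp only [rot_apply]
  have h1 : HasDerivAt (fun t : ℝ => a * t) a t := by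
    simpa using (hasDerivAt_id t).const_mul a
  convert! (h1.cos.smul_const v).add (h1.sin.smul_const (J v)) using 1
  rw [smul_add, smul_smul, smul_smul]
  ring_nf

namespace IsOrthogonalComplexStructure

theorem inner_apply_left (hJ : IsOrthogonalComplexStructure J) (v w : V) :
    inner ℝ (J v) w = -inner ℝ v (J w) := by
  rw [← hJ.inner_apply_apply v (J w), hJ.apply_apply, inner_neg_right, neg_neg]

theorem inner_self_apply (hJ : IsOrthogonalComplexStructure J) (v : V) :
    inner ℝ v (J v) = 0 := by
  have h := hJ.inner_apply_left v v
  rw [real_inner_comm] at h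
  linarith

theorem norm_apply (hJ : IsOrthogonalComplexStructure J) (v : V) : ‖J v‖ = ‖v‖ := by
  rw [← sq_eq_sq₀ (norm_nonneg _) (norm_nonneg _), ← real_inner_self_eq_norm_sq,
    ← real_inner_self_eq_norm_sq, hJ.inner_apply_apply]

theorem apply_rot (θ : ℝ) (v : V) : J (rot J θ v) = rot J θ (J v) := by
  simp [rot_apply]

theorem rot_add (hJ : IsOrthogonalComplexStructure J) (a b : ℝ) (v : V) :
    rot J (a + b) v = rot J a (rot J b v) := by
  simp only [rot_apply, map_add, map_smul, hJ.apply_apply, Real.cos_add, Real.sin_add]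
  module

theorem inner_rot_left (hJ : IsOrthogonalComplexStructure J) (θ : ℝ) (v w : V) :
    inner ℝ (rot J θ v) w = inner ℝ v (rot J (-θ) w) := by
  simp only [rot_apply, inner_add_left, inner_add_right, real_inner_smul_left,
    real_inner_smul_right, hJ.inner_apply_left, Real.cos_neg, Real.sin_neg]
  ring

theorem rot_neg_rot (hJ : IsOrthogonalComplexStructure J) (θ : ℝ) (v : V) :
    rot J (-θ) (rot J θ v) = v := by
  rw [← hJ.rot_add]; simp

theorem norm_rot (hJ : IsOrthogonalComplexStructure J) (θ : ℝ) (v : V) :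
    ‖rot J θ v‖ = ‖v‖ := by
  rw [← sq_eq_sq₀ (norm_nonneg _) (norm_nonneg _), ← real_inner_self_eq_norm_sq,
    ← real_inner_self_eq_norm_sq, hJ.inner_rot_left, hJ.rot_neg_rot]

theorem hasDerivAt_rot (hJ : IsOrthogonalComplexStructure J) (a t : ℝ) (v : V) :
    HasDerivAt (fun t : ℝ => rot J (a * t) v) (a • J (rot J (a * t) v)) t := by
  convert! hasDerivAt_rot_aux a t v using 2
  simp only [rot_apply, map_add, map_smul, hJ.apply_apply]
  module

end IsOrthogonalComplexStructure

section Fourier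

open IsOrthogonalComplexStructure intervalIntegral

/-- The `k`-th Fourier coefficient of a loop of period one. -/
def loopCoeff (J : V →L[ℝ] V) (k : ℤ) (f : ℝ → V) : V :=
  ∫ t in (0 : ℝ)..1, rot J (-(2 * π * k * t)) (f t)

/-- The frequencies of trigonometric loops of degree at most `m`. -/
abbrev Freq (m : ℕ) : Type := Finset.Icc (-(m : ℤ)) (m : ℤ)

/-- Finite-dimensional space of coefficients of trigonometric loops of degree at most `m`. -/
abbrev TrigLoopSpace (V : Type*) (m : ℕ) : Type _ :=
  PiLp 2 fun _ : Freq m => V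

/-- The trigonometric loop with given coefficients. -/
def trigLoop {m : ℕ} (J : V →L[ℝ] V) (c : TrigLoopSpace V m) (t : ℝ) : V :=
  ∑ k : Freq m, rot J (2 * π * (k : ℤ) * t) (c k)

variable {m : ℕ}

@[fun_prop]
theorem continuous_trigLoop (c : TrigLoopSpace V m) : Continuous (trigLoop J c) := by
  unfold trigLoop
  exact continuous_finsetSum _ fun k _ =>
    ((continuous_rot (J := J)).comp (by fun_prop : Continuous fun t : ℝ =>
      2 * π * (k : ℤ) * t)).clm_apply continuous_const

theorem trigLoop_add (c d : TrigLoopSpace V m) (t : ℝ) :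
    trigLoop J (c + d) t = trigLoop J c t + trigLoop J d t := by
  simp [trigLoop, Finset.sum_add_distrib]

theorem trigLoop_sub (c d : TrigLoopSpace V m) (t : ℝ) :
    trigLoop J (c - d) t = trigLoop J c t - trigLoop J d t := by
  simp [trigLoop, Finset.sum_sub_distrib]

theorem trigLoop_add_one (c : TrigLoopSpace V m) (t : ℝ) :
    trigLoop J c (t + 1) = trigLoop J c t := by
  unfold trigLoop
  refine Finset.sum_congr rfl fun k _ => ?_
  rw [← rot_add_int_mul_two_pi (2 * π * (k : ℤ) * t) k]
  ring_nf

theorem continuous_rot_apply {f : ℝ → V} (hf : Continuous f) (a : ℝ) :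
    Continuous fun t => rot J (a * t) (f t) :=
  ((continuous_rot (J := J)).comp (by fun_prop : Continuous fun t : ℝ => a * t)).clm_apply hf

theorem continuous_rot_neg_apply {f : ℝ → V} (hf : Continuous f) (a : ℝ) :
    Continuous fun t => rot J (-(a * t)) (f t) :=
  ((continuous_rot (J := J)).comp (by fun_prop : Continuous fun t : ℝ => -(a * t))).clm_apply hf

variable [FiniteDimensional ℝ V]

theorem integral_rot (hJ : IsOrthogonalComplexStructure J) (k : ℤ) (v : V) :
    ∫ t in (0 : ℝ)..1, rot J (2 * π * k * t) v = if k = 0 then v else 0 := by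
  split_ifs with hk
  · simp [hk]
  · have hk' : (2 * π * k : ℝ) ≠ 0 := by
      have : (k : ℝ) ≠ 0 := by exact_mod_cast hk
      positivity
    have hd : ∀ t ∈ uIcc (0 : ℝ) 1, HasDerivAt
        (fun t : ℝ => rot J (2 * π * k * t) (-((2 * π * k)⁻¹ • J v)))
        (rot J (2 * π * k * t) v) t := by
      intro t _
      convert! hJ.hasDerivAt_rot (2 * π * k) t (-((2 * π * k)⁻¹ • J v)) using 1
      rw [apply_rot, map_neg, map_smul, hJ.apply_apply, smul_neg, neg_neg, map_smul, smul_smul,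
        mul_inv_cancel₀ hk', one_smul]
    rw [integral_eq_sub_of_hasDerivAt hd
      ((continuous_rot_apply continuous_const _).intervalIntegrable _ _)]
    have := rot_add_int_mul_two_pi (J := J) 0 k (-((2 * π * k)⁻¹ • J v))
    rw [zero_add] at this
    rw [mul_one, mul_zero, mul_comm (2 * π : ℝ) k, sub_eq_zero]
    rw [mul_comm (2 * π : ℝ) k] at this
    exact this

theorem loopCoeff_trigLoop (hJ : IsOrthogonalComplexStructure J) (c : TrigLoopSpace V m)
    (k : Freq m) : loopCoeff J k (trigLoop J c) = c k := by
  unfold loopCoeff trigLoop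
  have : ∀ t : ℝ, rot J (-(2 * π * (k : ℤ) * t)) (∑ j : Freq m, rot J (2 * π * (j : ℤ) * t) (c j))
      = ∑ j : Freq m, rot J (2 * π * ((j : ℤ) - (k : ℤ) : ℤ) * t) (c j) := by
    intro t
    rw [map_sum]
    refine Finset.sum_congr rfl fun j _ => ?_
    rw [← hJ.rot_add]
    push_cast; ring_nf
  simp_rw [this]
  rw [integral_finsetSum fun j _ => (continuous_rot_apply continuous_const _).intervalIntegrable _ _]
  simp_rw [integral_rot hJ]
  rw [Finset.sum_eq_single k]
  · simp
  · intro j _ hj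
    rw [if_neg]
    intro h
    exact hj (Subtype.ext (sub_eq_zero.1 h))
  · simp

theorem sum_inner_loopCoeff (hJ : IsOrthogonalComplexStructure J) {f : ℝ → V} (hf : Continuous f)
    (d : TrigLoopSpace V m) :
    ∑ k : Freq m, inner ℝ (loopCoeff J k f) (d k)
      = ∫ t in (0 : ℝ)..1, inner ℝ (f t) (trigLoop J d t) := by
  unfold trigLoop
  simp_rw [inner_sum]
  rw [integral_finsetSum fun j _ =>
    (hf.inner (continuous_rot_apply continuous_const _)).intervalIntegrable _ _]
  refine Finset.sum_congr rfl fun k _ => ?_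
  unfold loopCoeff
  have h := ((innerSL ℝ (d k)).intervalIntegral_comp_comm
    ((continuous_rot_neg_apply (J := J) hf (2 * π * (k : ℤ))).intervalIntegrable
      (μ := volume) 0 1))
  simp only [innerSL_apply_apply] at h
  rw [real_inner_comm, ← h]
  refine integral_congr fun t _ => ?_
  rw [real_inner_comm, hJ.inner_rot_left, neg_neg]

theorem integral_norm_sq_trigLoop (hJ : IsOrthogonalComplexStructure J) (c : TrigLoopSpace V m) :
    ∫ t in (0 : ℝ)..1, ‖trigLoop J c t‖ ^ 2 = ‖c‖ ^ 2 := by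
  have h := sum_inner_loopCoeff hJ (continuous_trigLoop (J := J) c) c
  simp_rw [loopCoeff_trigLoop hJ, real_inner_self_eq_norm_sq] at h
  rw [← h, PiLp.norm_sq_eq_of_L2]

theorem integral_inner_trigLoop (hJ : IsOrthogonalComplexStructure J) {W : V →L[ℝ] V}
    (hW : ∀ v, W (J v) = J (W v)) (c : TrigLoopSpace V m) :
    ∫ t in (0 : ℝ)..1, inner ℝ (W (trigLoop J c t)) (trigLoop J c t)
      = ∑ k : Freq m, inner ℝ (W (c k)) (c k) := by
  rw [← sum_inner_loopCoeff hJ (f := fun t => W (trigLoop J c t))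
    (W.continuous.comp (continuous_trigLoop c)) c]
  refine Finset.sum_congr rfl fun k _ => ?_
  congr 1
  conv_rhs => rw [← loopCoeff_trigLoop hJ c k]
  unfold loopCoeff
  rw [← W.intervalIntegral_comp_comm
    ((continuous_rot_neg_apply (continuous_trigLoop c) _).intervalIntegrable _ _)]
  refine integral_congr fun t _ => ?_
  simp [rot_apply, hW]

theorem sum_norm_sq_loopCoeff_le (hJ : IsOrthogonalComplexStructure J) {f : ℝ → V}
    (hf : Continuous f) (m : ℕ) :
    ∑ k : Freq m, ‖loopCoeff J k f‖ ^ 2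
      ≤ ∫ t in (0 : ℝ)..1, ‖f t‖ ^ 2 := by
  let d : TrigLoopSpace V m := WithLp.toLp 2 fun k => loopCoeff J k f
  have h1 := sum_inner_loopCoeff hJ hf d
  have h2 := integral_norm_sq_trigLoop hJ d
  rw [PiLp.norm_sq_eq_of_L2] at h2
  simp only [d, real_inner_self_eq_norm_sq] at h1
  have h3 : ∫ t in (0 : ℝ)..1, inner ℝ (f t) (trigLoop J d t) ≤
      ∫ t in (0 : ℝ)..1, (1 / 2 * ‖f t‖ ^ 2 + 1 / 2 * ‖trigLoop J d t‖ ^ 2) := by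
    refine integral_mono_on zero_le_one ?_ ?_ fun t _ => ?_
    · exact (hf.inner (continuous_trigLoop d)).intervalIntegrable _ _
    · exact (by fun_prop : Continuous fun t => 1 / 2 * ‖f t‖ ^ 2 +
        1 / 2 * ‖trigLoop J d t‖ ^ 2).intervalIntegrable _ _
    · nlinarith [real_inner_le_norm (f t) (trigLoop J d t),
        sq_nonneg (‖f t‖ - ‖trigLoop J d t‖)]
  rw [integral_add
    ((by fun_prop : Continuous fun t => 1 / 2 * ‖f t‖ ^ 2).intervalIntegrable _ _)
    ((by fun_prop : Continuous fun t => 1 / 2 * ‖trigLoop J d t‖ ^ 2).intervalIntegrable _ _),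
    intervalIntegral.integral_const_mul, intervalIntegral.integral_const_mul, h2] at h3
  simp only [d] at h3 h1 ⊢
  linarith

theorem norm_loopCoeff_le (hJ : IsOrthogonalComplexStructure J) {f : ℝ → V} {C : ℝ}
    (hC : ∀ t, ‖f t‖ ≤ C) (k : ℤ) : ‖loopCoeff J k f‖ ≤ C := by
  have := norm_integral_le_of_norm_le_const (a := (0 : ℝ)) (b := 1) (C := C)
    (f := fun t => rot J (-(2 * π * k * t)) (f t)) fun t _ => by rw [hJ.norm_rot]; exact hC t
  simpa [loopCoeff] using this

theorem loopCoeff_sub {f h : ℝ → V} (hf : Continuous f) (hh : Continuous h) (k : ℤ) :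
    loopCoeff J k (fun t => f t - h t) = loopCoeff J k f - loopCoeff J k h := by
  unfold loopCoeff
  rw [← integral_sub ((continuous_rot_neg_apply hf _).intervalIntegrable _ _)
    ((continuous_rot_neg_apply hh _).intervalIntegrable _ _)]
  simp

theorem norm_trigLoop_le (hJ : IsOrthogonalComplexStructure J) (c : TrigLoopSpace V m) (t : ℝ) :
    ‖trigLoop J c t‖ ≤ (2 * m + 1) * ‖c‖ := by
  unfold trigLoop
  refine (norm_sum_le _ _).trans ?_
  simp_rw [hJ.norm_rot]
  refine (Finset.sum_le_card_nsmul _ _ ‖c‖ fun k _ => PiLp.norm_apply_le c k).trans ?_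
  rw [nsmul_eq_mul]
  refine le_of_eq ?_
  congr 1
  simp only [Finset.card_univ, Fintype.card_coe, Int.card_Icc]
  have : ((m : ℤ) + 1 - -(m : ℤ)).toNat = 2 * m + 1 := by omega
  rw [this]; push_cast; ring

end Fourier

end Loops

section Galerkin

open intervalIntegral

variable {V : Type*} [NormedAddCommGroup V] [InnerProductSpace ℝ V] {J : V →L[ℝ] V}

/-- The Hamiltonian action functional on trigonometric loops. -/
def loopAction (J : V →L[ℝ] V) (H : V → ℝ) {m : ℕ} (c : TrigLoopSpace V m) : ℝ :=
  π * ∑ k : Freq m, ((k : ℤ) : ℝ) * ‖c k‖ ^ 2 - ∫ t in (0 : ℝ)..1, H (trigLoop J c t)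

/-- The gradient of `loopAction`, where `g` is the gradient of the Hamiltonian. -/
def loopActionGrad (J : V →L[ℝ] V) (g : V → V) {m : ℕ} (c : TrigLoopSpace V m) :
    TrigLoopSpace V m :=
  WithLp.toLp 2 fun k =>
    (2 * π * ((k : ℤ) : ℝ)) • c k - loopCoeff J k fun t => g (trigLoop J c t)

theorem continuous_of_norm_sub_le {E F : Type*} [NormedAddCommGroup E] [NormedAddCommGroup F]
    {g : E → F} {K : ℝ} (hg : ∀ x y, ‖g x - g y‖ ≤ K * ‖x - y‖) : Continuous g := by
  refine continuous_iff_continuousAt.2 fun x => ?_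
  refine continuousAt_of_locally_lipschitz one_pos K fun y _ => ?_
  rw [dist_eq_norm, dist_eq_norm]
  exact hg y x

theorem abs_sub_sub_inner_le_of_lipschitz_gradient {H : V → ℝ} {g : V → V} {K : ℝ} (hK : 0 ≤ K)
    (hH : ∀ x, HasFDerivAt H (innerSL ℝ (g x)) x) (hg : ∀ x y, ‖g x - g y‖ ≤ K * ‖x - y‖)
    (x y : V) : |H (x + y) - H x - inner ℝ (g x) y| ≤ K * ‖y‖ ^ 2 := by
  have h := (convex_closedBall x ‖y‖).norm_image_sub_le_of_norm_hasFDerivWithin_le'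
    (f := H) (f' := fun z => innerSL ℝ (g z)) (φ := innerSL ℝ (g x)) (C := K * ‖y‖)
    (x := x) (y := x + y) (fun z _ => (hH z).hasFDerivWithinAt) (fun z hz => by
      rw [← map_sub, innerSL_apply_norm]
      refine (hg z x).trans ?_
      gcongr
      rwa [mem_closedBall, dist_eq_norm] at hz) (by simp) (by simp)
  simp only [add_sub_cancel_left, innerSL_apply_apply, Real.norm_eq_abs] at h
  rwa [pow_two, ← mul_assoc]

theorem abs_freq_le {m : ℕ} (k : Freq m) : |((k : ℤ) : ℝ)| ≤ m := by
  have := Finset.mem_Icc.1 k.2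
  rw [abs_le]
  exact ⟨by exact_mod_cast this.1, by exact_mod_cast this.2⟩

variable [FiniteDimensional ℝ V]

theorem hasFDerivAt_loopAction (hJ : IsOrthogonalComplexStructure J) {H : V → ℝ} {g : V → V}
    {K : ℝ} (hK : 0 ≤ K) (hH : ∀ x, HasFDerivAt H (innerSL ℝ (g x)) x)
    (hg : ∀ x y, ‖g x - g y‖ ≤ K * ‖x - y‖) {m : ℕ} (c : TrigLoopSpace V m) :
    HasFDerivAt (loopAction J H) (innerSL ℝ (loopActionGrad J g c)) c := by
  have hgc : Continuous g := continuous_of_norm_sub_le hg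
  have hHc : Continuous H := continuous_iff_continuousAt.2 fun x => (hH x).continuousAt
  rw [hasFDerivAt_iff_isLittleO_nhds_zero]
  refine Asymptotics.IsBigO.trans_isLittleO (g := fun h : TrigLoopSpace V m => ‖h‖ ^ 2) ?_
    (Asymptotics.isLittleO_norm_pow_id one_lt_two)
  refine Asymptotics.IsBigO.of_bound (π * m + K) (Filter.Eventually.of_forall fun h => ?_)
  have hi1 : IntervalIntegrable (fun t => H (trigLoop J c t + trigLoop J h t)) volume 0 1 :=
    (hHc.comp (by fun_prop : Continuous fun t =>
      trigLoop J c t + trigLoop J h t)).intervalIntegrable _ _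
  have hi2 : IntervalIntegrable (fun t => H (trigLoop J c t)) volume 0 1 :=
    (hHc.comp (continuous_trigLoop c)).intervalIntegrable _ _
  have hi3 : IntervalIntegrable (fun t => inner ℝ (g (trigLoop J c t)) (trigLoop J h t))
      volume 0 1 :=
    ((hgc.comp (continuous_trigLoop c)).inner (continuous_trigLoop h)).intervalIntegrable _ _
  have key : loopAction J H (c + h) - loopAction J H c - innerSL ℝ (loopActionGrad J g c) h
      = π * ∑ k : Freq m, ((k : ℤ) : ℝ) * ‖h k‖ ^ 2
        - ∫ t in (0 : ℝ)..1, (H (trigLoop J c t + trigLoop J h t) - H (trigLoop J c t)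
          - inner ℝ (g (trigLoop J c t)) (trigLoop J h t)) := by
    rw [integral_sub (hi1.sub hi2) hi3, integral_sub hi1 hi2,
      ← sum_inner_loopCoeff hJ (f := fun t => g (trigLoop J c t))
        (hgc.comp (continuous_trigLoop c)) h]
    simp only [loopAction, trigLoop_add, innerSL_apply_apply, PiLp.inner_apply, loopActionGrad,
      inner_sub_left, real_inner_smul_left, Finset.sum_sub_distrib, PiLp.add_apply,
      norm_add_sq_real, mul_add, Finset.sum_add_distrib, Finset.mul_sum]
    have : ∀ k : Freq m, π * (((k : ℤ) : ℝ) * (2 * inner ℝ (c k) (h k)))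
        = 2 * π * ((k : ℤ) : ℝ) * inner ℝ (c k) (h k) := fun k => by ring
    simp only [this]
    ring
  rw [key]
  have h1 : |π * ∑ k : Freq m, ((k : ℤ) : ℝ) * ‖h k‖ ^ 2| ≤ π * m * ‖h‖ ^ 2 := by
    rw [abs_mul, abs_of_pos pi_pos, mul_assoc, PiLp.norm_sq_eq_of_L2, Finset.mul_sum]
    refine mul_le_mul_of_nonneg_left ?_ pi_pos.le
    refine (Finset.abs_sum_le_sum_abs _ _).trans (Finset.sum_le_sum fun k _ => ?_)
    rw [abs_mul, abs_of_nonneg (sq_nonneg ‖h k‖)]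
    exact mul_le_mul_of_nonneg_right (abs_freq_le k) (sq_nonneg _)
  have h2 : ‖∫ t in (0 : ℝ)..1, (H (trigLoop J c t + trigLoop J h t) - H (trigLoop J c t)
          - inner ℝ (g (trigLoop J c t)) (trigLoop J h t))‖ ≤ K * ‖h‖ ^ 2 := by
    rw [← integral_norm_sq_trigLoop hJ h, ← intervalIntegral.integral_const_mul]
    refine norm_integral_le_of_norm_le zero_le_one (Filter.Eventually.of_forall fun t _ => ?_) ?_
    · exact abs_sub_sub_inner_le_of_lipschitz_gradient hK hH hg _ _
    · exact (by fun_prop : Continuous fun t =>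
        K * ‖trigLoop J h t‖ ^ 2).intervalIntegrable _ _
  rw [Real.norm_eq_abs] at h2 ⊢
  rw [Real.norm_of_nonneg (sq_nonneg _), add_mul]
  exact (abs_sub _ _).trans (add_le_add h1 h2)

theorem norm_loopActionGrad_sub_le (hJ : IsOrthogonalComplexStructure J) {g : V → V}
    {K : ℝ} (hK : 0 ≤ K) (hg : ∀ x y, ‖g x - g y‖ ≤ K * ‖x - y‖) {m : ℕ}
    (c d : TrigLoopSpace V m) :
    ‖loopActionGrad J g c - loopActionGrad J g d‖
      ≤ (2 * m + 1) * (2 * π * m + K * (2 * m + 1)) * ‖c - d‖ := by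
  have hgc : Continuous g := continuous_of_norm_sub_le hg
  set C : ℝ := 2 * π * m + K * (2 * m + 1)
  have hC : 0 ≤ C := by positivity
  have hk : ∀ k : Freq m, ‖(loopActionGrad J g c - loopActionGrad J g d) k‖ ≤ C * ‖c - d‖ := by
    intro k
    have h0 : (loopActionGrad J g c - loopActionGrad J g d) k
        = (2 * π * ((k : ℤ) : ℝ)) • (c - d) k
          - loopCoeff J k (fun t => g (trigLoop J c t) - g (trigLoop J d t)) := by
      rw [loopCoeff_sub (f := fun t => g (trigLoop J c t)) (h := fun t => g (trigLoop J d t))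
        (hgc.comp (continuous_trigLoop c)) (hgc.comp (continuous_trigLoop d))]
      simp only [loopActionGrad, PiLp.sub_apply, smul_sub]
      abel
    rw [h0]
    refine (norm_sub_le _ _).trans ?_
    rw [add_mul]
    refine add_le_add ?_ ?_
    · rw [norm_smul, Real.norm_eq_abs, abs_mul, abs_of_pos (by positivity : 0 < 2 * π)]
      gcongr
      · exact abs_freq_le k
      · exact PiLp.norm_apply_le _ k
    · refine norm_loopCoeff_le hJ (fun t => (hg _ _).trans ?_) k
      rw [← trigLoop_sub, mul_assoc]
      exact mul_le_mul_of_nonneg_left (norm_trigLoop_le hJ _ _) hK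
  refine abs_le_of_sq_le_sq' ?_ (by positivity) |>.2
  rw [PiLp.norm_sq_eq_of_L2]
  refine (Finset.sum_le_card_nsmul _ _ ((C * ‖c - d‖) ^ 2) fun k _ =>
    pow_le_pow_left₀ (norm_nonneg _) (hk k) 2).trans ?_
  have hcard : (Finset.univ : Finset (Freq m)).card = 2 * m + 1 := by
    simp only [Finset.card_univ, Fintype.card_coe, Int.card_Icc]; omega
  rw [hcard, nsmul_eq_mul, mul_assoc, mul_pow _ (C * ‖c - d‖)]
  push_cast
  refine mul_le_mul_of_nonneg_right ?_ (sq_nonneg _)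
  nlinarith [(Nat.cast_nonneg m : (0 : ℝ) ≤ m)]

end Galerkin

section FourierUniqueness

open intervalIntegral

theorem eq_zero_of_periodic_of_integral_cos_sin_eq_zero {f : ℝ → ℝ} (hf : Continuous f)
    (hper : Function.Periodic f 1)
    (hcos : ∀ k : ℤ, ∫ t in (0 : ℝ)..1, Real.cos (2 * π * k * t) * f t = 0)
    (hsin : ∀ k : ℤ, ∫ t in (0 : ℝ)..1, Real.sin (2 * π * k * t) * f t = 0) (t : ℝ) :
    f t = 0 := by
  have hperC : Function.Periodic (fun t => (f t : ℂ)) 1 := fun t => by simp [hper t]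
  have : Fact ((0 : ℝ) < 1) := ⟨one_pos⟩
  let F : C(AddCircle (1 : ℝ), ℂ) := ⟨hperC.lift, continuous_coinduced_dom.mpr (by
    exact Complex.continuous_ofReal.comp hf)⟩
  have hF : ∀ t : ℝ, F (t : AddCircle (1 : ℝ)) = f t := fun t => rfl
  have hcoef : ∀ k, fourierCoeff F k = 0 := by
    intro k
    rw [fourierCoeff_eq_intervalIntegral _ _ 0]
    simp only [zero_add, div_one, one_smul]
    have h1 : ∀ t : ℝ, fourier (-k) (t : AddCircle (1 : ℝ)) • F (t : AddCircle (1 : ℝ))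
        = ((Real.cos (2 * π * k * t) * f t : ℝ) : ℂ)
          - ((Real.sin (2 * π * k * t) * f t : ℝ) : ℂ) * Complex.I := by
      intro t
      rw [fourier_coe_apply, hF]
      have : (2 * π * Complex.I * ((-k : ℤ) : ℂ) * t / (1 : ℝ) : ℂ)
          = ((-(2 * π * k * t) : ℝ) : ℂ) * Complex.I := by push_cast; ring
      rw [this, Complex.exp_mul_I, ← Complex.ofReal_cos, ← Complex.ofReal_sin, Real.cos_neg,
        Real.sin_neg]
      push_cast
      simp only [smul_eq_mul]
      ring
    simp_rw [h1]
    rw [intervalIntegral.integral_sub, intervalIntegral.integral_mul_const, intervalIntegral.integral_ofReal,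
      intervalIntegral.integral_ofReal, hcos, hsin]
    · simp
    · exact (by fun_prop : Continuous fun t : ℝ =>
        ((Real.cos (2 * π * k * t) * f t : ℝ) : ℂ)).intervalIntegrable _ _
    · exact (by fun_prop : Continuous fun t : ℝ =>
        ((Real.sin (2 * π * k * t) * f t : ℝ) : ℂ) * Complex.I).intervalIntegrable _ _
  have hs : Summable (fourierCoeff F) := by
    rw [show fourierCoeff F = 0 from funext hcoef]; exact summable_zero
  have h := has_pointwise_sum_fourier_series_of_summable hs (t : AddCircle (1 : ℝ))
  simp only [hcoef, zero_smul] at h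
  have h2 := h.unique hasSum_zero
  rw [hF] at h2
  exact_mod_cast h2

variable {V : Type*} [NormedAddCommGroup V] [InnerProductSpace ℝ V] [FiniteDimensional ℝ V]
  {J : V →L[ℝ] V}

theorem eq_zero_of_periodic_of_loopCoeff_eq_zero (hJ : IsOrthogonalComplexStructure J)
    {p : ℝ → V} (hp : Continuous p) (hper : ∀ t, p (t + 1) = p t)
    (hc : ∀ k, loopCoeff J k p = 0) (t : ℝ) : p t = 0 := by
  have hi1 : ∀ k : ℤ, IntervalIntegrable (fun t => Real.cos (2 * π * k * t) • p t) volume 0 1 :=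
    fun k => (by fun_prop : Continuous fun t : ℝ =>
      Real.cos (2 * π * k * t) • p t).intervalIntegrable _ _
  have hi2 : ∀ k : ℤ, IntervalIntegrable (fun t => Real.sin (2 * π * k * t) • p t) volume 0 1 :=
    fun k => (by fun_prop : Continuous fun t : ℝ =>
      Real.sin (2 * π * k * t) • p t).intervalIntegrable _ _
  have h1 : ∀ k : ℤ, (∫ t in (0 : ℝ)..1, Real.cos (2 * π * k * t) • p t)
      - J (∫ t in (0 : ℝ)..1, Real.sin (2 * π * k * t) • p t) = 0 := by
    intro k
    have hi3 : IntervalIntegrable (fun t => J (Real.sin (2 * π * k * t) • p t)) volume 0 1 :=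
      (J.continuous.comp (by fun_prop : Continuous fun t : ℝ =>
        Real.sin (2 * π * k * t) • p t)).intervalIntegrable _ _
    rw [← hc k, ← J.intervalIntegral_comp_comm (hi2 k),
      ← intervalIntegral.integral_sub (hi1 k) hi3]
    refine integral_congr fun t _ => ?_
    simp [rot_apply, sub_eq_add_neg]
  have h2 : ∀ k : ℤ, (∫ t in (0 : ℝ)..1, Real.cos (2 * π * k * t) • p t) = 0 ∧
      (∫ t in (0 : ℝ)..1, Real.sin (2 * π * k * t) • p t) = 0 := by
    intro k
    have ha := h1 k
    have hb := h1 (-k)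
    simp only [Int.cast_neg, mul_neg, neg_mul, Real.cos_neg, Real.sin_neg, neg_smul,
      intervalIntegral.integral_neg, map_neg, sub_neg_eq_add] at hb
    have hA : (2 : ℝ) • (∫ t in (0 : ℝ)..1, Real.cos (2 * π * k * t) • p t) = 0 := by
      rw [two_smul]
      calc _ = ((∫ t in (0 : ℝ)..1, Real.cos (2 * π * k * t) • p t)
          - J (∫ t in (0 : ℝ)..1, Real.sin (2 * π * k * t) • p t))
          + ((∫ t in (0 : ℝ)..1, Real.cos (2 * π * k * t) • p t)
          + J (∫ t in (0 : ℝ)..1, Real.sin (2 * π * k * t) • p t)) := by abel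
        _ = 0 := by rw [ha, hb, add_zero]
    have hA' := (smul_eq_zero.1 hA).resolve_left two_ne_zero
    refine ⟨hA', ?_⟩
    rw [hA', zero_add] at hb
    rw [← norm_eq_zero, ← hJ.norm_apply, hb, norm_zero]
  rw [← inner_self_eq_zero (𝕜 := ℝ)]
  set v := p t with hv
  rw [hv]
  have hpv : Continuous fun s => inner ℝ v (p s) := continuous_const.inner hp
  have h3 : inner ℝ v (p t) = 0 := by
    refine eq_zero_of_periodic_of_integral_cos_sin_eq_zero hpv (fun s => by simp only [hper])
      (fun k => ?_) (fun k => ?_) t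
    · have := (innerSL ℝ v).intervalIntegral_comp_comm (hi1 k)
      rw [(h2 k).1, map_zero] at this
      simpa [real_inner_smul_right] using this
    · have := (innerSL ℝ v).intervalIntegral_comp_comm (hi2 k)
      rw [(h2 k).2, map_zero] at this
      simpa [real_inner_smul_right] using this
  exact h3

end FourierUniqueness

section PalaisSmale

variable {V : Type*} [NormedAddCommGroup V] [InnerProductSpace ℝ V] [FiniteDimensional ℝ V]
  {J : V →L[ℝ] V}

theorem tendsto_intervalIntegral_of_tendsto_of_norm_le {F : Type*} [NormedAddCommGroup F]
    [NormedSpace ℝ F] {Ψ : ℝ × V → F} (hΨ : Continuous Ψ) {x : ℕ → ℝ → V}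
    (hx : ∀ n, Continuous (x n)) {R : ℝ} (hR : ∀ n t, ‖x n t‖ ≤ R) {y : ℝ → V}
    (hy : ∀ t, Tendsto (fun n => x n t) atTop (𝓝 (y t))) :
    Tendsto (fun n => ∫ t in (0 : ℝ)..1, Ψ (t, x n t)) atTop
      (𝓝 (∫ t in (0 : ℝ)..1, Ψ (t, y t))) := by
  obtain ⟨C, hC⟩ := ((isCompact_Icc (a := (0 : ℝ)) (b := 1)).prod
    (isCompact_closedBall (0 : V) R)).exists_bound_of_continuousOn hΨ.continuousOn
  refine intervalIntegral.tendsto_integral_filter_of_dominated_convergence (fun _ => C)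
    (Filter.Eventually.of_forall fun n => ?_) (Filter.Eventually.of_forall fun n => ?_)
    intervalIntegrable_const (Filter.Eventually.of_forall fun t _ => ?_)
  · exact (hΨ.comp (continuous_id.prodMk (hx n))).aestronglyMeasurable
  · refine Filter.Eventually.of_forall fun t ht => hC _ ⟨?_, ?_⟩
    · rw [uIoc_of_le zero_le_one] at ht
      exact ⟨ht.1.le, ht.2⟩
    · simpa using hR n t
  · exact (hΨ.tendsto (t, y t)).comp (tendsto_const_nhds.prodMk_nhds (hy t))

theorem loopCoeff_clm_comp {W : V →L[ℝ] V} (hW : ∀ v, W (J v) = J (W v)) {f : ℝ → V}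
    (hf : Continuous f) (k : ℤ) : loopCoeff J k (fun t => W (f t)) = W (loopCoeff J k f) := by
  unfold loopCoeff
  rw [← W.intervalIntegral_comp_comm ((continuous_rot_neg_apply hf _).intervalIntegrable _ _)]
  refine intervalIntegral.integral_congr fun t _ => ?_
  simp [rot_apply, hW]

theorem hasDerivAt_trigLoop (hJ : IsOrthogonalComplexStructure J) {m : ℕ}
    (c : TrigLoopSpace V m) (t : ℝ) :
    HasDerivAt (trigLoop J c)
      (J (trigLoop J (WithLp.toLp 2 fun k : Freq m => (2 * π * ((k : ℤ) : ℝ)) • c k) t)) t := by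
  unfold trigLoop
  rw [map_sum]
  refine HasDerivAt.fun_sum fun k _ => ?_
  convert! hJ.hasDerivAt_rot (2 * π * (k : ℤ)) t (c k) using 1
  simp

theorem norm_sub_le_of_integral_norm_sq_deriv_le {x x' : ℝ → V} (hx' : Continuous x')
    (hx : ∀ t, HasDerivAt x (x' t) t) (hper : ∀ t, x' (t + 1) = x' t) {C : ℝ}
    (hC : ∫ t in (0 : ℝ)..1, ‖x' t‖ ^ 2 ≤ C) {l : ℝ} (hl : 0 < l) {s t : ℝ} (hst : s ≤ t)
    (hts : t ≤ s + 1) : ‖x t - x s‖ ≤ l * (t - s) + C / l := by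
  have hi := intervalIntegral.integral_eq_sub_of_hasDerivAt (a := s) (b := t)
    (fun u _ => hx u) (hx'.intervalIntegrable _ _)
  have hc2 : Continuous fun u => ‖x' u‖ ^ 2 := by fun_prop
  have h2 : ∫ u in s..t, ‖x' u‖ ^ 2 ≤ C := by
    have hp : Function.Periodic (fun u => ‖x' u‖ ^ 2) 1 := fun u => by simp only [hper]
    have h3 := hp.intervalIntegral_add_eq s 0
    rw [zero_add] at h3
    refine le_trans ?_ (h3.trans_le hC)
    exact intervalIntegral.integral_mono_interval le_rfl hst hts
      (Filter.Eventually.of_forall fun u => sq_nonneg _) (hc2.intervalIntegrable _ _)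
  rw [← hi]
  calc ‖∫ u in s..t, x' u‖ ≤ ∫ u in s..t, ‖x' u‖ :=
        intervalIntegral.norm_integral_le_integral_norm hst
    _ ≤ ∫ u in s..t, (l + l⁻¹ * ‖x' u‖ ^ 2) := by
        refine intervalIntegral.integral_mono hst (hx'.norm.intervalIntegrable _ _)
          ((by fun_prop : Continuous fun u => l + l⁻¹ * ‖x' u‖ ^ 2).intervalIntegrable _ _)
          fun u => ?_
        have h : ‖x' u‖ = 2 * ‖x' u‖ - ‖x' u‖ := by ring
        have h4 : 0 ≤ l⁻¹ * (‖x' u‖ - l) ^ 2 := by positivity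
        have h5 : l⁻¹ * (‖x' u‖ - l) ^ 2 = l⁻¹ * ‖x' u‖ ^ 2 - 2 * ‖x' u‖ + l := by
          field_simp; ring
        linarith [norm_nonneg (x' u)]
    _ = l * (t - s) + l⁻¹ * ∫ u in s..t, ‖x' u‖ ^ 2 := by
        rw [intervalIntegral.integral_add intervalIntegrable_const
          ((hc2.const_mul _).intervalIntegrable _ _), intervalIntegral.integral_const_mul]
        simp [mul_comm]
    _ ≤ _ := by
        rw [div_eq_inv_mul]
        gcongr

/-- A continuous one-periodic curve satisfying the Fourier version of `x' = J (g x)` solves it. -/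
theorem hasDerivAt_of_loopCoeff_eq (hJ : IsOrthogonalComplexStructure J) {y z : ℝ → V}
    (hy : Continuous y) (hz : Continuous z) (hyp : ∀ t, y (t + 1) = y t)
    (hzp : ∀ t, z (t + 1) = z t)
    (h : ∀ k : ℤ, (2 * π * (k : ℝ)) • loopCoeff J k y = loopCoeff J k z) (t : ℝ) :
    HasDerivAt y (J (z t)) t := by
  have hJz : Continuous fun t => J (z t) := J.continuous.comp hz
  set w : ℝ → V := fun t => ∫ u in (0 : ℝ)..t, J (z u) with hw
  have hwd : ∀ t, HasDerivAt w (J (z t)) t := fun t =>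
    (hJz.integral_hasStrictDerivAt 0 t).hasDerivAt
  have hwc : Continuous w := continuous_iff_continuousAt.2 fun t => (hwd t).continuousAt
  have hz0 : ∫ u in (0 : ℝ)..1, z u = 0 := by
    have := (h 0).symm
    simpa [loopCoeff] using this
  have hw0 : w 0 = 0 := by simp [hw]
  have hw1 : w 1 = 0 := by
    rw [hw]
    simp only
    rw [J.intervalIntegral_comp_comm (hz.intervalIntegrable _ _), hz0, map_zero]
  have hwp : ∀ t, w (t + 1) = w t := by
    intro t
    have hper : Function.Periodic (fun u => J (z u)) 1 := fun u => by simp only [hzp]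
    have h3 := hper.intervalIntegral_add_eq t 0
    rw [zero_add] at h3
    have h4 : w (t + 1) = w t + ∫ u in t..(t + 1), J (z u) :=
      (intervalIntegral.integral_add_adjacent_intervals (hJz.intervalIntegrable _ _)
        (hJz.intervalIntegrable _ _)).symm
    rw [h4, h3]
    have : ∫ u in (0 : ℝ)..1, J (z u) = 0 := hw1
    rw [this, add_zero]
  have hwk : ∀ k : ℤ, (2 * π * (k : ℝ)) • loopCoeff J k w = loopCoeff J k z := by
    intro k
    have hd : ∀ t, HasDerivAt (fun t => rot J (-(2 * π * k * t)) (w t))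
        (rot J (-(2 * π * k * t)) (J (z t)) - (2 * π * k : ℝ) • J (rot J (-(2 * π * k * t)) (w t)))
        t := by
      intro t
      have ha : HasDerivAt (fun t : ℝ => -(2 * π * k * t)) (-(2 * π * k)) t := by
        have := ((hasDerivAt_id t).const_mul (2 * π * (k : ℝ))).fun_neg
        simpa using this
      simp only [rot_apply]
      convert! (ha.cos.smul (hwd t)).add (ha.sin.smul (J.hasFDerivAt.comp_hasDerivAt t (hwd t)))
        using 1
      simp only [map_add, map_smul, hJ.apply_apply, Function.comp]
      module
    have hc1 : Continuous fun t => rot J (-(2 * π * k * t)) (J (z t)) :=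
      continuous_rot_neg_apply hJz _
    have hc2 : Continuous fun t => J (rot J (-(2 * π * k * t)) (w t)) :=
      J.continuous.comp (continuous_rot_neg_apply hwc _)
    have hc3 : Continuous fun t => (2 * π * k : ℝ) • J (rot J (-(2 * π * k * t)) (w t)) :=
      hc2.const_smul _
    have hi := intervalIntegral.integral_eq_sub_of_hasDerivAt (a := 0) (b := 1)
      (fun u _ => hd u) ((hc1.sub hc3).intervalIntegrable _ _)
    rw [hw0, hw1, map_zero, map_zero, sub_zero, intervalIntegral.integral_sub
      (hc1.intervalIntegrable _ _) (hc3.intervalIntegrable _ _),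
      intervalIntegral.integral_smul, J.intervalIntegral_comp_comm
        ((continuous_rot_neg_apply hwc _).intervalIntegrable _ _)] at hi
    have e1 : ∫ t in (0 : ℝ)..1, rot J (-(2 * π * k * t)) (J (z t)) = J (loopCoeff J k z) :=
      loopCoeff_clm_comp (fun _ => rfl) hz k
    rw [e1] at hi
    have hi' : J (loopCoeff J k z - (2 * π * k : ℝ) • loopCoeff J k w) = 0 := by
      rw [map_sub, map_smul]; exact hi
    have := hJ.norm_apply (loopCoeff J k z - (2 * π * k : ℝ) • loopCoeff J k w)
    rw [hi', norm_zero] at this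
    exact (sub_eq_zero.1 (norm_eq_zero.1 this.symm)).symm
  set e := loopCoeff J 0 fun t => y t - w t with he
  have hp : ∀ t, y t - w t - e = 0 := by
    refine eq_zero_of_periodic_of_loopCoeff_eq_zero hJ ((hy.sub hwc).sub continuous_const)
      (fun t => by rw [hyp, hwp]) fun k => ?_
    have hce : loopCoeff J k (fun _ => e) = if k = 0 then e else 0 := by
      rcases eq_or_ne k 0 with rfl | hk
      · simp [loopCoeff]
      · have := integral_rot hJ (-k) e
        rw [if_neg hk, ← (if_neg (neg_ne_zero.2 hk) : (if -k = 0 then e else 0) = 0), ← this]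
        refine intervalIntegral.integral_congr fun t _ => ?_
        simp
    rw [loopCoeff_sub (f := fun t => y t - w t) (hy.sub hwc) continuous_const, hce]
    split_ifs with hk
    · rw [hk, sub_self]
    · rw [sub_zero, loopCoeff_sub hy hwc]
      have h5 : (2 * π * (k : ℝ)) ≠ 0 := by
        have : (k : ℝ) ≠ 0 := by exact_mod_cast hk
        have := pi_pos
        positivity
      have h6 : (2 * π * (k : ℝ)) • (loopCoeff J k y - loopCoeff J k w) = 0 := by
        rw [smul_sub, h, hwk, sub_self]
      exact (smul_eq_zero.1 h6).resolve_left h5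
  have hyw : y = fun t => w t + e := by
    funext t
    have := hp t
    rw [sub_sub, sub_eq_zero] at this
    exact this
  rw [hyw]
  exact (hwd t).add_const e

end PalaisSmale

section Compactness

variable {V : Type*} [NormedAddCommGroup V] [InnerProductSpace ℝ V] [FiniteDimensional ℝ V]
  {J : V →L[ℝ] V}

theorem loopAction_eq (hJ : IsOrthogonalComplexStructure J) {H : V → ℝ} {g : V → V}
    (hg : Continuous g) (hH : Continuous H) {m : ℕ} (c : TrigLoopSpace V m) :
    loopAction J H c = (∫ t in (0 : ℝ)..1,
      (inner ℝ (g (trigLoop J c t)) (trigLoop J c t) / 2 - H (trigLoop J c t)))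
      + inner ℝ (loopActionGrad J g c) c / 2 := by
  have hc := continuous_trigLoop (J := J) c
  have hc1 : Continuous fun t => inner ℝ (g (trigLoop J c t)) (trigLoop J c t) :=
    (hg.comp hc).inner hc
  have hc2 : Continuous fun t => H (trigLoop J c t) := hH.comp hc
  rw [intervalIntegral.integral_sub ((hc1.div_const 2).intervalIntegrable _ _)
    (hc2.intervalIntegrable _ _), intervalIntegral.integral_div,
    ← sum_inner_loopCoeff hJ (f := fun t => g (trigLoop J c t)) (hg.comp hc) c]
  simp only [loopAction, PiLp.inner_apply, loopActionGrad, inner_sub_left, real_inner_smul_left,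
    real_inner_self_eq_norm_sq, Finset.sum_sub_distrib]
  have : ∑ k : Freq m, 2 * π * ((k : ℤ) : ℝ) * ‖c k‖ ^ 2
      = 2 * (π * ∑ k : Freq m, ((k : ℤ) : ℝ) * ‖c k‖ ^ 2) := by
    rw [Finset.mul_sum, Finset.mul_sum]
    exact Finset.sum_congr rfl fun k _ => by ring
  rw [this]
  ring

theorem norm_le_of_almost_critical (hJ : IsOrthogonalComplexStructure J) {g : V → V}
    (hg : Continuous g) {W : V →L[ℝ] V} (hW : ∀ v, W (J v) = J (W v)) {B : ℝ}
    (hb : ∀ x, ‖g x - (2 : ℝ) • W x‖ ≤ B) {d : ℝ} (hd : 0 < d)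
    (hnr : ∀ (k : ℤ) v, d * ‖v‖ ≤ ‖(2 * π * (k : ℝ)) • v - (2 : ℝ) • W v‖) {m : ℕ}
    {c : TrigLoopSpace V m} (hc : ‖loopActionGrad J g c‖ ≤ 1) :
    ‖c‖ ^ 2 ≤ 2 * (1 + B ^ 2) / d ^ 2 := by
  have hB : 0 ≤ B := (norm_nonneg _).trans (hb 0)
  have hcc := continuous_trigLoop (J := J) c
  have hgc : Continuous fun t => g (trigLoop J c t) := hg.comp hcc
  have hWc : Continuous fun t => (2 : ℝ) • W (trigLoop J c t) :=
    (W.continuous.comp hcc).const_smul _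
  have hbc : Continuous fun t => g (trigLoop J c t) - (2 : ℝ) • W (trigLoop J c t) := hgc.sub hWc
  have hbc2 : Continuous fun t => ‖g (trigLoop J c t) - (2 : ℝ) • W (trigLoop J c t)‖ ^ 2 := by
    fun_prop
  have hk : ∀ k : Freq m, (2 * π * ((k : ℤ) : ℝ)) • c k - (2 : ℝ) • W (c k)
      = loopActionGrad J g c k
        + loopCoeff J k (fun t => g (trigLoop J c t) - (2 : ℝ) • W (trigLoop J c t)) := by
    intro k
    have h1 : loopCoeff J k (fun t => (2 : ℝ) • W (trigLoop J c t)) = (2 : ℝ) • W (c k) := by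
      have := loopCoeff_clm_comp (J := J) (W := (2 : ℝ) • W) (fun v => by simp [hW]) hcc k
      rw [loopCoeff_trigLoop hJ] at this
      exact this
    rw [loopCoeff_sub hgc hWc, h1]
    simp only [loopActionGrad]
    abel
  have hIntg : ∫ t in (0 : ℝ)..1, ‖g (trigLoop J c t) - (2 : ℝ) • W (trigLoop J c t)‖ ^ 2
      ≤ B ^ 2 := by
    have := intervalIntegral.integral_mono (a := 0) (b := 1) (μ := volume) zero_le_one
      (hbc2.intervalIntegrable _ _)
      (intervalIntegrable_const (c := B ^ 2))
      fun t => pow_le_pow_left₀ (norm_nonneg _) (hb (trigLoop J c t)) 2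
    simpa using this
  have hsum := (sum_norm_sq_loopCoeff_le hJ hbc m).trans hIntg
  rw [le_div_iff₀ (by positivity), PiLp.norm_sq_eq_of_L2, Finset.sum_mul]
  calc ∑ k : Freq m, ‖c k‖ ^ 2 * d ^ 2
      ≤ ∑ k : Freq m, (2 * ‖loopActionGrad J g c k‖ ^ 2 + 2 * ‖loopCoeff J k (fun t =>
        g (trigLoop J c t) - (2 : ℝ) • W (trigLoop J c t))‖ ^ 2) := by
        refine Finset.sum_le_sum fun k _ => ?_
        rw [← mul_pow, mul_comm]
        refine (pow_le_pow_left₀ (by positivity) (hnr k (c k)) 2).trans ?_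
        rw [hk]
        refine (pow_le_pow_left₀ (norm_nonneg _) (norm_add_le _ _) 2).trans ?_
        nlinarith [sq_nonneg (‖loopActionGrad J g c k‖ - ‖loopCoeff J k (fun t =>
          g (trigLoop J c t) - (2 : ℝ) • W (trigLoop J c t))‖)]
    _ ≤ _ := by
        rw [Finset.sum_add_distrib, ← Finset.mul_sum, ← Finset.mul_sum,
          ← PiLp.norm_sq_eq_of_L2]
        have : ‖loopActionGrad J g c‖ ^ 2 ≤ 1 := pow_le_one₀ (norm_nonneg _) hc
        linarith

theorem integral_norm_sq_deriv_trigLoop_le (hJ : IsOrthogonalComplexStructure J) {g : V → V}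
    {K : ℝ} (hg : ∀ x y, ‖g x - g y‖ ≤ K * ‖x - y‖) {m : ℕ}
    {c : TrigLoopSpace V m} (hc : ‖loopActionGrad J g c‖ ≤ 1) {R : ℝ} (hR : ‖c‖ ^ 2 ≤ R) :
    ∫ t in (0 : ℝ)..1, ‖J (trigLoop J
      (WithLp.toLp 2 fun k : Freq m => (2 * π * ((k : ℤ) : ℝ)) • c k) t)‖ ^ 2
      ≤ 2 + 2 * (2 * ‖g 0‖ ^ 2 + 2 * K ^ 2 * R) := by
  have hgc : Continuous g := continuous_of_norm_sub_le hg
  have hcc := continuous_trigLoop (J := J) c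
  have hgcc : Continuous fun t => g (trigLoop J c t) := hgc.comp hcc
  simp_rw [hJ.norm_apply]
  rw [integral_norm_sq_trigLoop hJ]
  have hIntg : ∫ t in (0 : ℝ)..1, ‖g (trigLoop J c t)‖ ^ 2 ≤ 2 * ‖g 0‖ ^ 2 + 2 * K ^ 2 * R := by
    have hgcc2 : Continuous fun t => ‖g (trigLoop J c t)‖ ^ 2 := hgcc.norm.pow 2
    have hcb : Continuous fun t => 2 * ‖g 0‖ ^ 2 + 2 * K ^ 2 * ‖trigLoop J c t‖ ^ 2 := by fun_prop
    have h1 := intervalIntegral.integral_mono (a := 0) (b := 1) (μ := volume) zero_le_one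
      (hgcc2.intervalIntegrable _ _) (hcb.intervalIntegrable _ _) fun t => by
        have h2 : ‖g (trigLoop J c t)‖ ≤ ‖g 0‖ + K * ‖trigLoop J c t‖ := by
          have h3 := norm_add_le (g 0) (g (trigLoop J c t) - g 0)
          rw [add_sub_cancel] at h3
          have h4 := hg (trigLoop J c t) 0
          rw [sub_zero] at h4
          linarith
        refine (pow_le_pow_left₀ (norm_nonneg _) h2 2).trans ?_
        nlinarith [sq_nonneg (‖g 0‖ - K * ‖trigLoop J c t‖)]
    rw [intervalIntegral.integral_add intervalIntegrable_const
      ((by fun_prop : Continuous fun t => 2 * K ^ 2 * ‖trigLoop J c t‖ ^ 2).intervalIntegrable _ _),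
      intervalIntegral.integral_const_mul (2 * K ^ 2), integral_norm_sq_trigLoop hJ] at h1
    refine h1.trans ?_
    simp only [intervalIntegral.integral_const, sub_zero, one_smul]
    gcongr
  have hsum := (sum_norm_sq_loopCoeff_le hJ hgcc m).trans hIntg
  rw [PiLp.norm_sq_eq_of_L2]
  calc ∑ k : Freq m, ‖(2 * π * ((k : ℤ) : ℝ)) • c k‖ ^ 2
      ≤ ∑ k : Freq m, (2 * ‖loopActionGrad J g c k‖ ^ 2 + 2 * ‖loopCoeff J k (fun t =>
        g (trigLoop J c t))‖ ^ 2) := by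
        refine Finset.sum_le_sum fun k _ => ?_
        have hk : (2 * π * ((k : ℤ) : ℝ)) • c k
            = loopActionGrad J g c k + loopCoeff J k (fun t => g (trigLoop J c t)) := by
          simp [loopActionGrad]
        rw [hk]
        refine (pow_le_pow_left₀ (norm_nonneg _) (norm_add_le _ _) 2).trans ?_
        nlinarith [sq_nonneg (‖loopActionGrad J g c k‖ - ‖loopCoeff J k (fun t =>
          g (trigLoop J c t))‖)]
    _ ≤ _ := by
        rw [Finset.sum_add_distrib, ← Finset.mul_sum, ← Finset.mul_sum,
          ← PiLp.norm_sq_eq_of_L2]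
        have : ‖loopActionGrad J g c‖ ^ 2 ≤ 1 := pow_le_one₀ (norm_nonneg _) hc
        linarith

/-- Arzelà–Ascoli for one-periodic curves with a uniform `H¹` type modulus of continuity. -/
theorem exists_subseq_tendsto_of_periodic {x : ℕ → ℝ → V} (hx : ∀ n, Continuous (x n))
    (hper : ∀ n t, x n (t + 1) = x n t) {R C : ℝ} (hC : 0 ≤ C) (hR : ∀ n t, ‖x n t‖ ≤ R)
    (hmod : ∀ n (s t l : ℝ), 0 < l → s ≤ t → t ≤ s + 1 → ‖x n t - x n s‖ ≤ l * (t - s) + C / l) :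
    ∃ y : ℝ → V, Continuous y ∧ (∀ t, y (t + 1) = y t) ∧ ∃ φ : ℕ → ℕ, StrictMono φ ∧
      ∀ t, Tendsto (fun n => x (φ n) t) atTop (𝓝 (y t)) := by
  have : Fact ((0 : ℝ) < 1) := ⟨one_pos⟩
  have hp : ∀ n, Function.Periodic (x n) 1 := hper
  let X : ℕ → BoundedContinuousFunction (AddCircle (1 : ℝ)) V := fun n =>
    BoundedContinuousFunction.mkOfCompact ⟨(hp n).lift, continuous_coinduced_dom.mpr (hx n)⟩
  have hX : ∀ n (t : ℝ), X n (t : AddCircle (1 : ℝ)) = x n t := fun n t => rfl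
  have hmod' : ∀ n (s t l : ℝ), 0 < l → |t - s| ≤ 1 →
      dist (x n s) (x n t) ≤ l * |t - s| + C / l := by
    intro n s t l hl hst
    rcases le_total s t with h | h
    · rw [abs_of_nonneg (sub_nonneg.2 h)] at hst ⊢
      rw [dist_comm, dist_eq_norm]
      exact hmod n s t l hl h (by linarith)
    · rw [abs_sub_comm, abs_of_nonneg (sub_nonneg.2 h)] at hst ⊢
      rw [dist_eq_norm]
      exact hmod n t s l hl h (by linarith)
  have hcomp : IsCompact (closure (Set.range X)) := by
    refine BoundedContinuousFunction.arzela_ascoli (closedBall 0 R) (isCompact_closedBall _ _) _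
      ?_ ?_
    · rintro _ q ⟨n, rfl⟩
      induction q using QuotientAddGroup.induction_on with
      | H t => simpa [hX] using hR n t
    · intro q
      induction q using QuotientAddGroup.induction_on with
      | H s =>
      rw [Metric.equicontinuousAt_iff_right]
      intro ε hε
      set l := 2 * (C + 1) / ε with hl
      have hl0 : 0 < l := by positivity
      have hη : 0 < min 1 (ε / (2 * l)) := by positivity
      have := (QuotientAddGroup.isOpenMap_coe (N := AddSubgroup.zmultiples (1 : ℝ))).image_mem_nhds
        (Metric.ball_mem_nhds s hη)
      filter_upwards [this]
      rintro _ ⟨t, ht, rfl⟩ ⟨_, n, rfl⟩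
      rw [mem_ball, Real.dist_eq] at ht
      change dist (x n s) (x n t) < ε
      refine (hmod' n s t l hl0 (ht.le.trans (min_le_left _ _))).trans_lt ?_
      have h1 : l * |t - s| ≤ ε / 2 := by
        have := ht.le.trans (min_le_right _ _)
        rw [le_div_iff₀ (by positivity)] at this
        linarith
      have h2 : C / l < ε / 2 := by
        rw [hl, div_div_eq_mul_div, div_lt_div_iff₀ (by positivity) two_pos]
        nlinarith
      linarith
  obtain ⟨F, -, φ, hφ, hF⟩ := hcomp.tendsto_subseq fun n => subset_closure (mem_range_self (f := X) n)
  refine ⟨fun t => F (t : AddCircle (1 : ℝ)), F.continuous.comp continuous_quotient_mk', ?_, φ, hφ,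
    fun t => ?_⟩
  · intro t
    simp
  · exact (BoundedContinuousFunction.tendsto_iff_tendstoUniformly.1 hF).tendsto_at _

/-- The limit of almost critical points of the Galerkin actions is a periodic orbit. -/
theorem exists_periodic_orbit_of_almost_critical (hJ : IsOrthogonalComplexStructure J)
    {H : V → ℝ} {g : V → V} {K : ℝ} (hK : 0 ≤ K) (hH : Continuous H)
    (hg : ∀ x y, ‖g x - g y‖ ≤ K * ‖x - y‖) {W : V →L[ℝ] V} (hW : ∀ v, W (J v) = J (W v)) {B : ℝ}
    (hb : ∀ x, ‖g x - (2 : ℝ) • W x‖ ≤ B) {d : ℝ} (hd : 0 < d)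
    (hnr : ∀ (k : ℤ) v, d * ‖v‖ ≤ ‖(2 * π * (k : ℝ)) • v - (2 : ℝ) • W v‖) {α β : ℝ}
    (hc : ∀ m : ℕ, 1 ≤ m → ∃ c : TrigLoopSpace V m, α ≤ loopAction J H c ∧ loopAction J H c ≤ β ∧
      ‖loopActionGrad J g c‖ ≤ 1 / (m : ℝ)) :
    ∃ x : ℝ → V, (∀ t, HasDerivAt x (J (g (x t))) t) ∧ (∀ t, x (t + 1) = x t) ∧
      (∫ t in (0 : ℝ)..1, (inner ℝ (g (x t)) (x t) / 2 - H (x t))) ∈ Icc α β := by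
  have hgc : Continuous g := continuous_of_norm_sub_le hg
  choose c hcα hcβ hcg using fun n : ℕ => hc (n + 1) (Nat.le_add_left 1 n)
  have hcg1 : ∀ n, ‖loopActionGrad J g (c n)‖ ≤ 1 := fun n => (hcg n).trans (by
    rw [div_le_one (by positivity)]; push_cast; linarith [(Nat.cast_nonneg n : (0 : ℝ) ≤ n)])
  obtain ⟨R, hR⟩ : ∃ R, ∀ n, ‖c n‖ ^ 2 ≤ R :=
    ⟨_, fun n => norm_le_of_almost_critical hJ hgc hW hb hd hnr (hcg1 n)⟩
  have hR0 : 0 ≤ R := (sq_nonneg _).trans (hR 0)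
  set C := 2 + 2 * (2 * ‖g 0‖ ^ 2 + 2 * K ^ 2 * R) with hCdef
  have hC0 : 0 ≤ C := by positivity
  let X : ℕ → ℝ → V := fun n => trigLoop J (c n)
  have hXc : ∀ n, Continuous (X n) := fun n => continuous_trigLoop _
  have hXp : ∀ n t, X n (t + 1) = X n t := fun n t => trigLoop_add_one _ t
  have hmod : ∀ n (s t l : ℝ), 0 < l → s ≤ t → t ≤ s + 1 →
      ‖X n t - X n s‖ ≤ l * (t - s) + C / l := fun n s t l hl hst hts =>
    norm_sub_le_of_integral_norm_sq_deriv_le (J.continuous.comp (continuous_trigLoop _))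
      (hasDerivAt_trigLoop hJ (c n)) (fun t => by simp only [Function.comp, trigLoop_add_one])
      (integral_norm_sq_deriv_trigLoop_le hJ hg (hcg1 n) (hR n)) hl hst hts
  have hbound : ∀ n t, ‖X n t‖ ≤ (1 + R) + (1 + C) := by
    intro n t
    have h0 : ∫ u in t..(t + 1), X n u = loopCoeff J 0 (X n) := by
      have hp : Function.Periodic (X n) 1 := hXp n
      have h3 := hp.intervalIntegral_add_eq t 0
      rw [zero_add] at h3
      rw [h3]
      simp [loopCoeff]
    have h1 : ‖loopCoeff J 0 (X n)‖ ≤ 1 + R := by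
      have h2 := loopCoeff_trigLoop hJ (c n) ⟨0, by rw [Finset.mem_Icc]; omega⟩
      simp only at h2
      change loopCoeff J 0 (X n) = _ at h2
      rw [h2]
      refine (PiLp.norm_apply_le _ _).trans ?_
      nlinarith [hR n, sq_nonneg (‖c n‖ - 1), norm_nonneg (c n)]
    have h2 : ‖(∫ u in t..(t + 1), X n u) - X n t‖ ≤ 1 + C := by
      have h3 : (∫ u in t..(t + 1), X n u) - X n t = ∫ u in t..(t + 1), (X n u - X n t) := by
        rw [intervalIntegral.integral_sub ((hXc n).intervalIntegrable _ _)
          intervalIntegrable_const]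
        simp
      rw [h3]
      have h4 := intervalIntegral.norm_integral_le_of_norm_le_const (a := t) (b := t + 1)
        (C := 1 + C) (f := fun u => X n u - X n t) fun u hu => by
          rw [uIoc_of_le (by linarith)] at hu
          have := hmod n t u 1 one_pos hu.1.le hu.2
          have h5 := hu.2
          rw [div_one, one_mul] at this
          linarith
      simpa using h4
    have h3 := norm_sub_le (∫ u in t..(t + 1), X n u) ((∫ u in t..(t + 1), X n u) - X n t)
    rw [sub_sub_cancel, h0] at h3
    rw [h0] at h2
    linarith
  obtain ⟨y, hyc, hyp, φ, hφ, hy⟩ := exists_subseq_tendsto_of_periodic hXc hXp hC0 hbound hmod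
  have hlim : Tendsto (fun n => (1 : ℝ) / ((φ n + 1 : ℕ) : ℝ)) atTop (𝓝 0) :=
    ((tendsto_one_div_add_atTop_nhds_zero_nat (𝕜 := ℝ)).comp hφ.tendsto_atTop).congr fun n => by
      simp
  refine ⟨y, ?_, hyp, ?_⟩
  · refine hasDerivAt_of_loopCoeff_eq hJ hyc (hgc.comp hyc) hyp
      (fun t => by simp only [hyp]) fun k => ?_
    have t1 : Tendsto (fun n => loopCoeff J k (X (φ n))) atTop (𝓝 (loopCoeff J k y)) :=
      tendsto_intervalIntegral_of_tendsto_of_norm_le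
        (Ψ := fun p => rot J (-(2 * π * k * p.1)) p.2)
        (((continuous_rot (J := J)).comp (by fun_prop : Continuous fun p : ℝ × V =>
          -(2 * π * k * p.1))).clm_apply continuous_snd) (fun n => hXc (φ n))
        (fun n => hbound (φ n)) hy
    have t2 : Tendsto (fun n => loopCoeff J k (fun t => g (X (φ n) t))) atTop
        (𝓝 (loopCoeff J k (g ∘ y))) :=
      tendsto_intervalIntegral_of_tendsto_of_norm_le
        (Ψ := fun p => rot J (-(2 * π * k * p.1)) (g p.2))
        (((continuous_rot (J := J)).comp (by fun_prop : Continuous fun p : ℝ × V =>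
          -(2 * π * k * p.1))).clm_apply (hgc.comp continuous_snd)) (fun n => hXc (φ n))
        (fun n => hbound (φ n)) hy
    have t3 := (t1.const_smul (2 * π * (k : ℝ))).sub t2
    have t4 : Tendsto (fun n => (2 * π * (k : ℝ)) • loopCoeff J k (X (φ n))
        - loopCoeff J k (fun t => g (X (φ n) t))) atTop (𝓝 0) := by
      refine squeeze_zero_norm' ?_ hlim
      filter_upwards [hφ.tendsto_atTop.eventually_ge_atTop k.natAbs] with n hn
      have hk : k ∈ Finset.Icc (-((φ n + 1 : ℕ) : ℤ)) ((φ n + 1 : ℕ) : ℤ) := by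
        rw [Finset.mem_Icc]; omega
      have h1 : (2 * π * (k : ℝ)) • loopCoeff J k (X (φ n))
          - loopCoeff J k (fun t => g (X (φ n) t)) = loopActionGrad J g (c (φ n)) ⟨k, hk⟩ := by
        have := loopCoeff_trigLoop hJ (c (φ n)) ⟨k, hk⟩
        simp only at this
        simp only [loopActionGrad, X, this]
      rw [h1]
      exact (PiLp.norm_apply_le _ _).trans (hcg (φ n))
    exact sub_eq_zero.1 (tendsto_nhds_unique t3 t4)
  · have t1 : Tendsto (fun n => ∫ t in (0 : ℝ)..1,
        (inner ℝ (g (X (φ n) t)) (X (φ n) t) / 2 - H (X (φ n) t))) atTop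
        (𝓝 (∫ t in (0 : ℝ)..1, (inner ℝ (g (y t)) (y t) / 2 - H (y t)))) :=
      tendsto_intervalIntegral_of_tendsto_of_norm_le
        (Ψ := fun p => inner ℝ (g p.2) p.2 / 2 - H p.2)
        ((((hgc.comp continuous_snd).inner continuous_snd).div_const 2).sub
          (hH.comp continuous_snd)) (fun n => hXc (φ n)) (fun n => hbound (φ n)) hy
    have t2 : Tendsto (fun n => inner ℝ (loopActionGrad J g (c (φ n))) (c (φ n)) / 2) atTop
        (𝓝 0) := by
      refine squeeze_zero_norm (a := fun n => (1 : ℝ) / ((φ n + 1 : ℕ) : ℝ) * ((1 + R) / 2))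
        (fun n => ?_) (by simpa using hlim.mul_const ((1 + R) / 2))
      rw [norm_div, Real.norm_two, mul_div_assoc']
      gcongr
      refine (norm_inner_le_norm _ _).trans (mul_le_mul (hcg (φ n)) ?_ (norm_nonneg _)
        (by positivity))
      nlinarith [hR (φ n), sq_nonneg (‖c (φ n)‖ - 1), norm_nonneg (c (φ n))]
    have t3 := t1.add t2
    rw [add_zero] at t3
    have h1 : ∀ n, (∫ t in (0 : ℝ)..1,
        (inner ℝ (g (X (φ n) t)) (X (φ n) t) / 2 - H (X (φ n) t)))
        + inner ℝ (loopActionGrad J g (c (φ n))) (c (φ n)) / 2 = loopAction J H (c (φ n)) :=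
      fun n => (loopAction_eq hJ hgc hH (c (φ n))).symm
    simp only [h1] at t3
    exact ⟨ge_of_tendsto' t3 fun n => hcα _, le_of_tendsto' t3 fun n => hcβ _⟩

end Compactness

section PrimitivePushforward

theorem exists_primitive_of_symmetric_fderiv {E : Type*} [NormedAddCommGroup E] [NormedSpace ℝ E]
    {β : E → E →L[ℝ] ℝ} {β' : E → E →L[ℝ] E →L[ℝ] ℝ} (hβ : ∀ x, HasFDerivAt β (β' x) x)
    (hsymm : ∀ x u v, β' x u v = β' x v u) : ∃ G : E → ℝ, ∀ x, HasFDerivAt G (β x) x := by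
  obtain ⟨G, hG⟩ := (convex_univ (𝕜 := ℝ) (E := E)).exists_forall_hasFDerivWithinAt_of_hasFDerivWithinAt_symmetric
    (F := ℝ) (fun x _ => (hβ x).hasFDerivWithinAt)
    fun x _ u _ v _ => hsymm x u v
  exact ⟨G, fun x => hasFDerivWithinAt_univ.1 (hG x (mem_univ x))⟩

variable {E : Type*} [NormedAddCommGroup E] [NormedSpace ℝ E] [CompleteSpace E]

/-- If `f` is locally constant on `A \ K`, then the differential of the push-forward of `f` under a
diffeomorphism `φ` defined on `A` extends by zero to an exact one-form. -/
theorem exists_primitive_pushforward {A K : Set E} (hA : IsOpen A) (hK : IsCompact K) (hKA : K ⊆ A)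
    {φ : E → E} (hφ : ContDiffOn ℝ ∞ φ A) (hinj : InjOn φ A)
    (hφ' : ∀ w ∈ A, ∃ L : E ≃L[ℝ] E, HasFDerivAt φ (L : E →L[ℝ] E) w)
    {f : E → ℝ} (hf : ContDiffOn ℝ ∞ f A) (hfK : ∀ w ∈ A \ K, fderiv ℝ f w = 0) :
    ∃ G : E → ℝ, ContDiff ℝ ∞ G ∧
      (∀ w ∈ A, (fderiv ℝ G (φ w)).comp (fderiv ℝ φ w) = fderiv ℝ f w) ∧
      ∀ x, x ∉ φ '' K → fderiv ℝ G x = 0 := by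
  classical
  rcases A.eq_empty_or_nonempty with rfl | ⟨w₀, hw₀⟩
  · exact ⟨fun _ => 0, contDiff_const, fun w hw => hw.elim, fun x _ => by simp⟩
  have : Nonempty E := ⟨w₀⟩
  have hφA : ∀ w ∈ A, ContDiffAt ℝ ∞ φ w := fun w hw => hφ.contDiffAt (hA.mem_nhds hw)
  set χ : E → E := Function.invFunOn φ A
  have hχ : ∀ w ∈ A, χ (φ w) = w := fun w hw => hinj.leftInvOn_invFunOn hw
  -- the inverse is smooth
  have hopen : ∀ w ∈ A, ∀ N ∈ 𝓝 w, φ '' N ∈ 𝓝 (φ w) := by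
    intro w hw N hN
    obtain ⟨L, hL⟩ := hφ' w hw
    have := ((hφA w hw).hasStrictFDerivAt' hL (by simp)).map_nhds_eq_of_equiv
    rw [← this]
    exact Filter.image_mem_map hN
  have hχs : ∀ w ∈ A, ContDiffAt ℝ ∞ χ (φ w) := by
    intro w hw
    obtain ⟨L, hL⟩ := hφ' w hw
    have hloc := (hφA w hw).to_localInverse hL (by simp)
    refine hloc.congr_of_eventuallyEq ?_
    have h1 := ((hφA w hw).hasStrictFDerivAt' hL (by simp)).eventually_right_inverse
    have h2 : Tendsto ((hφA w hw).localInverse hL (by simp)) (𝓝 (φ w)) (𝓝 w) := by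
      have := hloc.continuousAt.tendsto
      rwa [(hφA w hw).localInverse_apply_image hL] at this
    filter_upwards [h1, h2.eventually (hA.mem_nhds hw)] with y hy hyA
    have := hχ _ hyA
    change φ ((hφA w hw).localInverse hL (by simp) y) = y at hy
    rw [hy] at this
    exact this
  have hφAo : IsOpen (φ '' A) := isOpen_iff_mem_nhds.2 (by
    rintro _ ⟨w, hw, rfl⟩; exact hopen w hw A (hA.mem_nhds hw))
  have hφc : ContinuousOn φ A := hφ.continuousOn
  have hKc : IsClosed (φ '' K) := (hK.image_of_continuousOn (hφc.mono hKA)).isClosed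
  set F : E → ℝ := fun x => f (χ x) with hF
  have hFs : ∀ x ∈ φ '' A, ContDiffAt ℝ ∞ F x := by
    rintro _ ⟨w, hw, rfl⟩
    refine ContDiffAt.comp _ ?_ (hχs w hw)
    rw [hχ w hw]
    exact hf.contDiffAt (hA.mem_nhds hw)
  have hFφ : ∀ w ∈ A, (fderiv ℝ F (φ w)).comp (fderiv ℝ φ w) = fderiv ℝ f w := by
    intro w hw
    rw [← fderiv_comp _ ((hFs _ (mem_image_of_mem φ hw)).differentiableAt (by simp))
      ((hφA w hw).differentiableAt (by simp))]
    refine Filter.EventuallyEq.fderiv_eq ?_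
    filter_upwards [hA.mem_nhds hw] with y hy
    simp [hF, hχ y hy]
  set β : E → E →L[ℝ] ℝ := fun x => if x ∈ φ '' A then fderiv ℝ F x else 0 with hβ
  have hβ1 : ∀ x ∈ φ '' A, β =ᶠ[𝓝 x] fderiv ℝ F := fun x hx => by
    filter_upwards [hφAo.mem_nhds hx] with y hy
    simp only [hβ, if_pos hy]
  have hβ0 : ∀ x, x ∉ φ '' K → β x = 0 := by
    intro x hx
    by_cases hxA : x ∈ φ '' A
    · obtain ⟨w, hw, rfl⟩ := hxA
      have hwK : w ∉ K := fun h => hx (mem_image_of_mem _ h)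
      have h1 := hFφ w hw
      rw [hfK w ⟨hw, hwK⟩] at h1
      simp only [hβ, if_pos (mem_image_of_mem φ hw)]
      obtain ⟨L, hL⟩ := hφ' w hw
      rw [hL.fderiv] at h1
      ext v
      have := congrArg (fun T => T (L.symm v)) h1
      simpa using this
    · simp only [hβ, if_neg hxA]
  have hβ2 : ∀ x, x ∉ φ '' K → β =ᶠ[𝓝 x] fun _ => 0 := fun x hx => by
    filter_upwards [hKc.isOpen_compl.mem_nhds hx] with y hy using hβ0 y hy
  have hcases : ∀ x, x ∈ φ '' A ∨ x ∉ φ '' K := fun x => by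
    by_cases h : x ∈ φ '' K
    · exact Or.inl (image_mono hKA h)
    · exact Or.inr h
  have hβs : ContDiff ℝ ∞ β := contDiff_iff_contDiffAt.2 fun x => by
    rcases hcases x with h | h
    · exact ((hFs x h).fderiv_right (m := ∞) (by simp)).congr_of_eventuallyEq (hβ1 x h)
    · exact contDiffAt_const.congr_of_eventuallyEq (hβ2 x h)
  obtain ⟨G, hG⟩ := exists_primitive_of_symmetric_fderiv
    (fun x => (hβs.differentiable (by simp) x).hasFDerivAt) (by
      intro x u v
      rcases hcases x with h | h
      · rw [(hβ1 x h).fderiv_eq]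
        exact ((hFs x h).isSymmSndFDerivAt (by simp only [minSmoothness_of_isRCLikeNormedField]; exact WithTop.coe_le_coe.2 le_top)).eq u v
      · rw [(hβ2 x h).fderiv_eq]
        simp)
  have hG' : fderiv ℝ G = β := funext fun x => (hG x).fderiv
  refine ⟨G, ?_, ?_, ?_⟩
  · exact contDiff_infty_iff_fderiv.2 ⟨fun x => (hG x).differentiableAt, hG' ▸ hβs⟩
  · intro w hw
    rw [hG', ← hFφ w hw]
    simp only [hβ, if_pos (mem_image_of_mem φ hw)]
  · intro x hx
    rw [hG', hβ0 x hx]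

end PrimitivePushforward

section SymplecticEmbedding

variable {V : Type*} [NormedAddCommGroup V] [InnerProductSpace ℝ V] {J : V →L[ℝ] V}

/-- `φ` is a smooth embedding of the open set `A` preserving the symplectic form
`(v, w) ↦ ⟪J v, w⟫`. -/
structure IsSymplecticEmbedding (J : V →L[ℝ] V) (A : Set V) (φ : V → V) : Prop where
  isOpen : IsOpen A
  contDiffOn : ContDiffOn ℝ ∞ φ A
  injOn : InjOn φ A
  inner_fderiv : ∀ w ∈ A, ∀ u v,
    inner ℝ (J (fderiv ℝ φ w u)) (fderiv ℝ φ w v) = inner ℝ (J u) v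

namespace IsSymplecticEmbedding

variable {A : Set V} {φ : V → V}

theorem mono (hφ : IsSymplecticEmbedding J A φ) {B : Set V} (hB : IsOpen B) (hBA : B ⊆ A) :
    IsSymplecticEmbedding J B φ :=
  ⟨hB, hφ.contDiffOn.mono hBA, hφ.injOn.mono hBA, fun w hw => hφ.inner_fderiv w (hBA hw)⟩

theorem contDiffAt (hφ : IsSymplecticEmbedding J A φ) {w : V} (hw : w ∈ A) :
    ContDiffAt ℝ ∞ φ w := hφ.contDiffOn.contDiffAt (hφ.isOpen.mem_nhds hw)

theorem hasFDerivAt (hφ : IsSymplecticEmbedding J A φ) {w : V} (hw : w ∈ A) :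
    HasFDerivAt φ (fderiv ℝ φ w) w :=
  ((hφ.contDiffAt hw).differentiableAt (by simp)).hasFDerivAt

theorem injective_fderiv (hφ : IsSymplecticEmbedding J A φ) (hJ : IsOrthogonalComplexStructure J)
    {w : V} (hw : w ∈ A) : Function.Injective (fderiv ℝ φ w) := by
  rw [injective_iff_map_eq_zero]
  intro u hu
  have := hφ.inner_fderiv w hw u (J u)
  rw [hu, map_zero, inner_zero_left, real_inner_self_eq_norm_sq, hJ.norm_apply] at this
  simpa using this.symm

variable [FiniteDimensional ℝ V]

theorem exists_hasFDerivAt_equiv (hφ : IsSymplecticEmbedding J A φ)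
    (hJ : IsOrthogonalComplexStructure J) {w : V} (hw : w ∈ A) :
    ∃ L : V ≃L[ℝ] V, HasFDerivAt φ (L : V →L[ℝ] V) w := by
  refine ⟨(LinearEquiv.ofInjectiveEndo (fderiv ℝ φ w : V →ₗ[ℝ] V)
    (hφ.injective_fderiv hJ hw)).toContinuousLinearEquiv, ?_⟩
  convert! hφ.hasFDerivAt hw using 1

theorem abs_det_fderiv (hφ : IsSymplecticEmbedding J A φ)
    (hJ : IsOrthogonalComplexStructure J) {w : V} (hw : w ∈ A) :
    |(fderiv ℝ φ w).det| = 1 := by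
  let b := stdOrthonormalBasis ℝ V
  let L : V →ₗ[ℝ] V := fderiv ℝ φ w
  have h : LinearMap.adjoint L ∘ₗ (J : V →ₗ[ℝ] V) ∘ₗ L = (J : V →ₗ[ℝ] V) := by
    ext u
    refine ext_inner_right ℝ fun v => ?_
    simp only [LinearMap.comp_apply, LinearMap.adjoint_inner_left]
    exact hφ.inner_fderiv w hw u v
  have hJJ : (J : V →ₗ[ℝ] V) ∘ₗ (-(J : V →ₗ[ℝ] V)) = LinearMap.id := by
    ext u; simp [hJ.apply_apply u]
  have hJ0 : LinearMap.det (J : V →ₗ[ℝ] V) ≠ 0 := by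
    intro h0
    have := congrArg LinearMap.det hJJ
    rw [LinearMap.det_comp, h0, zero_mul, LinearMap.det_id] at this
    exact zero_ne_one this
  have hadj : LinearMap.det (LinearMap.adjoint L) = LinearMap.det L := by
    rw [← LinearMap.det_toMatrix b.toBasis, LinearMap.toMatrix_adjoint, Matrix.det_conjTranspose,
      LinearMap.det_toMatrix]
    simp
  have hd := congrArg LinearMap.det h
  rw [LinearMap.det_comp, LinearMap.det_comp, hadj] at hd
  have : LinearMap.det L * LinearMap.det L = 1 :=
    mul_right_cancel₀ hJ0 (by linear_combination hd)
  change |LinearMap.det L| = 1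
  rcases mul_self_eq_one_iff.1 this with h | h <;> simp [h]

end IsSymplecticEmbedding

section Hopf

variable {E : Type*} [NormedAddCommGroup E] [NormedSpace ℝ E] [FiniteDimensional ℝ V]

/-- The pull-back of the Liouville form `⟪-J dx, x⟫` under `f`. -/
def liouvillePullback (J : V →L[ℝ] V) (f : E → V) (z : E) : E →L[ℝ] ℝ :=
  -((innerSL ℝ (f z)).comp (J.comp (fderiv ℝ f z)))

theorem liouvillePullback_apply (f : E → V) (z v : E) :
    liouvillePullback J f z v = -inner ℝ (f z) (J (fderiv ℝ f z v)) := by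
  simp [liouvillePullback]

theorem exists_hasFDerivAt_liouvillePullback (hJ : IsOrthogonalComplexStructure J) {f : E → V}
    (hf : ContDiff ℝ ∞ f) (z : E) : ∃ Λ : E →L[ℝ] E →L[ℝ] ℝ,
      HasFDerivAt (liouvillePullback J f) Λ z ∧ ∀ u v, Λ u v - Λ v u =
        2 * inner ℝ (J (fderiv ℝ f z u)) (fderiv ℝ f z v) := by
  have h1 : HasFDerivAt f (fderiv ℝ f z) z := (hf.differentiable (by simp) z).hasFDerivAt
  have h2 : HasFDerivAt (fderiv ℝ f) (fderiv ℝ (fderiv ℝ f) z) z :=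
    ((hf.fderiv_right (m := ∞) (by simp)).differentiable (by simp) z).hasFDerivAt
  have hs : ∀ u v, fderiv ℝ (fderiv ℝ f) z u v = fderiv ℝ (fderiv ℝ f) z v u :=
    (hf.contDiffAt.isSymmSndFDerivAt
      (by simp only [minSmoothness_of_isRCLikeNormedField]; exact WithTop.coe_le_coe.2 le_top)).eq
  have h3 : HasFDerivAt (fun z => innerSL ℝ (f z)) ((innerSL ℝ (E := V)).comp (fderiv ℝ f z)) z :=
    (innerSL ℝ (E := V)).hasFDerivAt.comp z h1
  have h4 : HasFDerivAt (fun z => J.comp (fderiv ℝ f z))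
      ((ContinuousLinearMap.compL ℝ E V V J).comp (fderiv ℝ (fderiv ℝ f) z)) z :=
    (ContinuousLinearMap.compL ℝ E V V J).hasFDerivAt.comp z h2
  have h5 := (h3.clm_comp h4).neg
  refine ⟨_, h5, fun u v => ?_⟩
  simp [hs u v, real_inner_comm (J (fderiv ℝ f z u)), hJ.inner_apply_left (fderiv ℝ f z u)]
  ring

theorem exists_norm_eq_of_inner_eq_zero (hV : 3 ≤ Module.finrank ℝ V) (v w : V) (r : ℝ)
    (hr : 0 ≤ r) : ∃ u : V, inner ℝ v u = 0 ∧ inner ℝ w u = 0 ∧ ‖u‖ = r := by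
  have h1 : Module.finrank ℝ (Submodule.span ℝ ({v, w} : Set V)) ≤ 2 := by
    classical
    have := finrank_span_finset_le_card (R := ℝ) ({v, w} : Finset V)
    rw [Finset.coe_pair] at this
    exact this.trans Finset.card_le_two
  have h2 := Submodule.finrank_add_finrank_orthogonal (Submodule.span ℝ ({v, w} : Set V))
  have h3 : (Submodule.span ℝ ({v, w} : Set V))ᗮ ≠ ⊥ := by
    intro h
    rw [h, finrank_bot] at h2
    omega
  obtain ⟨u, hu, hu0⟩ := Submodule.exists_mem_ne_zero_of_ne_bot h3
  rw [Submodule.mem_orthogonal] at hu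
  have hu0' : ‖u‖ ≠ 0 := norm_ne_zero_iff.2 hu0
  refine ⟨(r / ‖u‖) • u, ?_, ?_, ?_⟩
  · rw [inner_smul_right, hu v (Submodule.subset_span (by simp)), mul_zero]
  · rw [inner_smul_right, hu w (Submodule.subset_span (by simp)), mul_zero]
  · rw [norm_smul, Real.norm_of_nonneg (by positivity)]
    field_simp

theorem contDiff_rot_apply (a : ℝ) (v : V) : ContDiff ℝ ∞ fun t : ℝ => rot J (a * t) v := by
  simp only [rot_apply]
  fun_prop

/-- A symplectic embedding of a neighbourhood of a sphere preserves the action of the Hopf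
circles. -/
theorem IsSymplecticEmbedding.integral_hopf_circle (hJ : IsOrthogonalComplexStructure J)
    (hV : 3 ≤ Module.finrank ℝ V) {A : Set V} {φ : V → V} (hφ : IsSymplecticEmbedding J A φ)
    {w : V} (hA : ∀ x, ‖x‖ = ‖w‖ → x ∈ A) :
    ∫ t in (0 : ℝ)..1, -inner ℝ (φ (rot J (2 * π * t) w))
      (J (fderiv ℝ φ (rot J (2 * π * t) w) (J (rot J (2 * π * t) w)))) = ‖w‖ ^ 2 := by
  obtain ⟨w', hw1, hw2, hw3⟩ := exists_norm_eq_of_inner_eq_zero hV w (J w) ‖w‖ (norm_nonneg _)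
  let e : ℝ → V := fun t => rot J (2 * π * t) w
  have he : ContDiff ℝ ∞ e := contDiff_rot_apply _ _
  have he' : ∀ t, HasDerivAt e ((2 * π) • J (e t)) t := fun t => hJ.hasDerivAt_rot _ _ _
  let η : ℝ × ℝ → V := fun z => Real.cos z.1 • e z.2 + Real.sin z.1 • w'
  have hη : ContDiff ℝ ∞ η := by
    have : ContDiff ℝ ∞ fun z : ℝ × ℝ => e z.2 := he.comp contDiff_snd
    fun_prop
  have hηA : ∀ z, η z ∈ A := fun z => hA _ (by
    rw [← sq_eq_sq₀ (norm_nonneg _) (norm_nonneg _), norm_add_sq_real]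
    have h0 : inner ℝ (e z.2) w' = 0 := by
      simp only [e, rot_apply, inner_add_left, real_inner_smul_left, hw1, hw2]; ring
    simp only [norm_smul, real_inner_smul_left, inner_smul_right, h0, hw3, e, hJ.norm_rot, mul_pow,
      Real.norm_eq_abs, sq_abs]
    linear_combination ‖w‖ ^ 2 * Real.sin_sq_add_cos_sq z.1)
  have hΓ : ContDiff ℝ ∞ fun z => φ (η z) :=
    contDiff_iff_contDiffAt.2 fun z => (hφ.contDiffAt (hηA z)).comp z hη.contDiffAt
  have hDΓ : ∀ z u, fderiv ℝ (fun z => φ (η z)) z u = fderiv ℝ φ (η z) (fderiv ℝ η z u) := by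
    intro z u
    have := (hφ.hasFDerivAt (hηA z)).comp z (hη.differentiable (by simp) z).hasFDerivAt
    rw [HasFDerivAt.fderiv (f := fun z => φ (η z)) this]
    rfl
  choose Λ₁ hΛ₁ hs₁ using fun z => exists_hasFDerivAt_liouvillePullback hJ hΓ z
  choose Λ₂ hΛ₂ hs₂ using fun z => exists_hasFDerivAt_liouvillePullback hJ hη z
  obtain ⟨F, hF⟩ := exists_primitive_of_symmetric_fderiv
    (fun z => (hΛ₁ z).fun_sub (hΛ₂ z)) (fun z u v => by
      have h1 := hs₁ z u v
      have h2 := hs₂ z u v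
      rw [hDΓ, hDΓ, hφ.inner_fderiv _ (hηA z)] at h1
      simp only [sub_apply]
      linarith)
  have hper : ∀ s : ℝ, η (s, 1) = η (s, 0) := fun s => by
    simp only [η, e]
    congr 2
    simpa using rot_add_int_mul_two_pi (J := J) 0 1 w
  have hηs : ∀ s t : ℝ, fderiv ℝ η (s, t) (1, 0) = -Real.sin s • e t + Real.cos s • w' := by
    intro s t
    have h1 := (hη.differentiable (by simp) (s, t)).hasFDerivAt.comp_hasDerivAt s
      ((hasDerivAt_id s).prodMk (hasDerivAt_const s t))
    have h2 := ((Real.hasDerivAt_cos s).smul_const (e t)).add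
      ((Real.hasDerivAt_sin s).smul_const w')
    exact h1.unique h2
  have hηt : ∀ s t : ℝ, fderiv ℝ η (s, t) (0, 1) = (2 * π * Real.cos s) • J (e t) := by
    intro s t
    have h1 := (hη.differentiable (by simp) (s, t)).hasFDerivAt.comp_hasDerivAt t
      ((hasDerivAt_const t s).prodMk (hasDerivAt_id t))
    have h2 := ((he' t).const_smul (Real.cos s)).add_const (Real.sin s • w')
    refine (h1.unique h2).trans ?_
    module
  have hFs : ∀ s t : ℝ, HasDerivAt (fun s => F (s, t))
      (liouvillePullback J (fun z => φ (η z)) (s, t) (1, 0) -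
        liouvillePullback J η (s, t) (1, 0)) s := fun s t =>
    HasFDerivAt.comp_hasDerivAt (f := fun s : ℝ => (s, t)) s (hF (s, t))
      ((hasDerivAt_id s).prodMk (hasDerivAt_const s t))
  have hFt : ∀ s t : ℝ, HasDerivAt (fun t => F (s, t))
      (liouvillePullback J (fun z => φ (η z)) (s, t) (0, 1) -
        liouvillePullback J η (s, t) (0, 1)) t := fun s t =>
    HasFDerivAt.comp_hasDerivAt (f := fun t : ℝ => (s, t)) t (hF (s, t))
      ((hasDerivAt_const t s).prodMk (hasDerivAt_id t))
  have he01 : e 1 = e 0 := by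
    simpa [e] using rot_add_int_mul_two_pi (J := J) 0 1 w
  have hD : ∀ s : ℝ, HasDerivAt (fun s => F (s, 1) - F (s, 0)) 0 s := by
    intro s
    convert! (hFs s 1).fun_sub (hFs s 0) using 1
    simp only [liouvillePullback_apply, hDΓ, hηs, hper, he01, sub_self]
  have hconst := is_const_of_deriv_eq_zero (fun s => (hD s).differentiableAt)
    (fun s => (hD s).deriv) 0 (π / 2)
  have hconst' := is_const_of_deriv_eq_zero (f := fun t => F (π / 2, t))
    (fun t => (hFt (π / 2) t).differentiableAt)
    (fun t => by
      rw [(hFt (π / 2) t).deriv]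
      simp only [liouvillePullback_apply, hDΓ, hηt, Real.cos_pi_div_two]
      simp) 1 0
  simp only [hconst', sub_self] at hconst
  have hη0 : ∀ t : ℝ, η (0, t) = e t := fun t => by simp [η]
  have hfc : Continuous fun t : ℝ => -inner ℝ (φ (e t)) (J (fderiv ℝ φ (e t) (J (e t)))) := by
    have h1 : Continuous fun t : ℝ => φ (e t) := by
      have := hΓ.continuous.comp (by fun_prop : Continuous fun t : ℝ => ((0 : ℝ), t))
      simpa only [Function.comp_def, hη0] using this
    have h2 : Continuous fun t : ℝ => fderiv ℝ φ (e t) := continuous_iff_continuousAt.2 fun t =>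
      ContinuousAt.comp (f := e) (g := fderiv ℝ φ)
        ((hφ.contDiffAt (hη0 t ▸ hηA (0, t))).fderiv_right (m := ∞) (by simp)).continuousAt
        he.continuous.continuousAt
    have h3 : Continuous fun t : ℝ => J (e t) := J.continuous.comp he.continuous
    have h4 : Continuous fun t : ℝ => J (fderiv ℝ φ (e t) (J (e t))) :=
      J.continuous.comp (h2.clm_apply h3)
    exact (h1.inner h4).neg
  have hIntg := intervalIntegral.integral_eq_sub_of_hasDerivAt (a := 0) (b := 1)
    (f := fun t => F (0, t)) (f' := fun t => (2 * π) *
      (-inner ℝ (φ (e t)) (J (fderiv ℝ φ (e t) (J (e t)))) - ‖w‖ ^ 2))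
    (fun t _ => by
      convert! hFt 0 t using 1
      simp only [liouvillePullback_apply, hDΓ, hηt, hη0, Real.cos_zero, mul_one, map_smul,
        inner_smul_right, hJ.apply_apply, inner_neg_right, real_inner_self_eq_norm_sq]
      rw [show ‖e t‖ = ‖w‖ from hJ.norm_rot _ _]
      ring)
    ((continuous_const.mul (hfc.sub continuous_const)).intervalIntegrable _ _)
  rw [hconst, intervalIntegral.integral_const_mul,
    intervalIntegral.integral_sub (hfc.intervalIntegrable _ _) (by simp)] at hIntg
  simp only [intervalIntegral.integral_const, sub_zero, one_smul, mul_eq_zero] at hIntg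
  rcases hIntg with h | h
  · exact absurd h (by have := Real.pi_pos; simp; try positivity)
  · exact sub_eq_zero.1 h

end Hopf

end SymplecticEmbedding

section IntegralIdentities

theorem IsPreconnected.exists_eq_const_of_fderiv_eq_zero {E : Type*} [NormedAddCommGroup E]
    [NormedSpace ℝ E] {O S : Set E} (hS : IsPreconnected S) (hO : IsOpen O) (hSO : S ⊆ O)
    {f : E → ℝ} (hf : Differentiable ℝ f) (hf' : ∀ x ∈ O, fderiv ℝ f x = 0) :
    ∃ c, ∀ x ∈ S, f x = c := by
  rcases S.eq_empty_or_nonempty with rfl | ⟨y, hy⟩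
  · exact ⟨0, by simp⟩
  have ho := fun t => hO.isOpen_inter_preimage_of_fderiv_eq_zero hf.differentiableOn hf' (t : Set ℝ)
  refine ⟨f y, fun x hx => ?_⟩
  refine (hS.subset_left_of_subset_union (ho {f y}) (ho {f y}ᶜ) ?_ (fun z hz => ?_)
    ⟨y, hy, hSO hy, rfl⟩ hx).2
  · exact disjoint_left.2 fun z h1 h2 => h2.2 h1.2
  · by_cases h : f z = f y
    · exact Or.inl ⟨hSO hz, h⟩
    · exact Or.inr ⟨hSO hz, h⟩

variable {V : Type*} [NormedAddCommGroup V] [InnerProductSpace ℝ V] [FiniteDimensional ℝ V]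

theorem isPreconnected_shell (hV : 2 ≤ Module.finrank ℝ V) (a b : ℝ) :
    IsPreconnected {x : V | a < ‖x‖ ^ 2 ∧ ‖x‖ ^ 2 < b ∧ x ≠ 0} := by
  have hr : 1 < Module.rank ℝ V := by
    rw [← Module.finrank_eq_rank]
    exact_mod_cast hV
  have hI : IsPreconnected {s : ℝ | 0 < s ∧ a < s ^ 2 ∧ s ^ 2 < b} := by
    refine OrdConnected.isPreconnected ⟨fun x hx y hy z hz => ⟨?_, ?_, ?_⟩⟩
    · exact hx.1.trans_le hz.1
    · have := hx.1; have := hx.2.1; have := hz.1; nlinarith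
    · have := hx.1; have := hy.2.2; have := hz.1; have := hz.2; nlinarith
  have := (hI.prod (isPreconnected_sphere hr 0 1)).image (fun p : ℝ × V => p.1 • p.2)
    (by fun_prop)
  convert! this using 1
  ext x
  simp only [mem_ofPred_eq, mem_image, mem_prod, mem_sphere_zero_iff_norm, Prod.exists]
  constructor
  · rintro ⟨h1, h2, h3⟩
    have h4 := norm_pos_iff.2 h3
    refine ⟨‖x‖, ‖x‖⁻¹ • x, ⟨⟨h4, h1, h2⟩, ?_⟩, ?_⟩
    · rw [norm_smul, norm_inv, norm_norm, inv_mul_cancel₀ h4.ne']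
    · rw [smul_smul, mul_inv_cancel₀ h4.ne', one_smul]
  · rintro ⟨s, y, ⟨⟨h1, h2, h3⟩, h4⟩, rfl⟩
    have : ‖s • y‖ = s := by rw [norm_smul, h4, mul_one, Real.norm_of_nonneg h1.le]
    rw [this]
    exact ⟨h2, h3, fun h => h1.ne' (by rw [← this, h, norm_zero])⟩

theorem isPreconnected_setOf_le_of_homogeneous (hV : 2 ≤ Module.finrank ℝ V) {q : V → ℝ}
    (hq : Continuous q) (hq0 : ∀ x, x ≠ 0 → 0 < q x) (hqs : ∀ (s : ℝ) x, q (s • x) = s ^ 2 * q x)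
    {c : ℝ} (hc : 0 < c) : IsPreconnected {x | c ≤ q x} := by
  have hr : 1 < Module.rank ℝ V := by
    rw [← Module.finrank_eq_rank]
    exact_mod_cast hV
  have h0 : q 0 = 0 := by simpa using hqs 0 0
  have := (isConnected_compl_singleton_of_one_lt_rank hr (0 : V)).isPreconnected.image
    (fun x => max 1 (√c / √(q x)) • x) (by
      refine ContinuousOn.smul ?_ continuousOn_id
      refine ContinuousOn.sup continuousOn_const (continuousOn_const.div
        (hq.sqrt.continuousOn) fun x hx => (Real.sqrt_pos.2 (hq0 x hx)).ne'))
  convert! this using 1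
  ext x
  simp only [mem_ofPred_eq, mem_image, mem_compl_iff, mem_singleton_iff]
  constructor
  · intro h
    refine ⟨x, fun hx => ?_, ?_⟩
    · rw [hx, h0] at h; linarith
    · rw [max_eq_left, one_smul]
      exact div_le_one_of_le₀ (Real.sqrt_le_sqrt h) (Real.sqrt_nonneg _)
  · rintro ⟨y, hy, rfl⟩
    have hy' := hq0 y hy
    rw [hqs]
    have h1 : √c / √(q y) ≤ max 1 (√c / √(q y)) := le_max_right _ _
    have h2 : (√c / √(q y)) ^ 2 * q y = c := by
      rw [div_pow, Real.sq_sqrt hc.le, Real.sq_sqrt hy'.le]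
      field_simp
    calc c = (√c / √(q y)) ^ 2 * q y := h2.symm
      _ ≤ _ := by gcongr

variable [MeasurableSpace V] [BorelSpace V]

theorem integral_fderiv_apply_self {u : V → ℝ} (hu : ContDiff ℝ 1 u) (hc : HasCompactSupport u) :
    ∫ x, fderiv ℝ u x x = -(Module.finrank ℝ V * ∫ x, u x) := by
  let b := stdOrthonormalBasis ℝ V
  have hu' : Continuous (fderiv ℝ u) := hu.continuous_fderiv (by simp)
  have hc' : HasCompactSupport (fderiv ℝ u) := hc.fderiv ℝ
  have hIntg : ∀ i, Integrable fun x => inner ℝ (b i) x * fderiv ℝ u x (b i) := fun i => by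
    refine Continuous.integrable_of_hasCompactSupport (by fun_prop) ?_
    exact HasCompactSupport.mul_left (f := fun x => inner ℝ (b i) x)
      (f' := fun x => fderiv ℝ u x (b i)) (hc.fderiv_apply ℝ (b i))
  have hpart : ∀ i, ∫ x, inner ℝ (b i) x * fderiv ℝ u x (b i) = -∫ x, u x := by
    intro i
    have hd : ∀ x, fderiv ℝ (fun x : V => inner ℝ (b i) x) x (b i) = 1 := fun x => by
      have : HasFDerivAt (fun x : V => inner ℝ (b i) x) (innerSL ℝ (b i)) x :=
        (innerSL ℝ (b i)).hasFDerivAt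
      rw [this.fderiv]
      simp [b.norm_eq_one]
    rw [integral_mul_fderiv_eq_neg_fderiv_mul_of_integrable]
    · simp [hd]
    · simpa [hd] using hu.continuous.integrable_of_hasCompactSupport hc
    · exact hIntg i
    · refine Continuous.integrable_of_hasCompactSupport
        ((continuous_const.inner continuous_id).mul hu.continuous) ?_
      exact HasCompactSupport.mul_left hc
    · exact fun x _ => (innerSL ℝ (b i)).differentiableAt
    · exact fun x _ => (hu.differentiable (by simp)) x
  have hsum : ∀ x, fderiv ℝ u x x = ∑ i, inner ℝ (b i) x * fderiv ℝ u x (b i) := fun x => by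
    have h := congrArg (fderiv ℝ u x) (b.sum_repr' x)
    rw [map_sum] at h
    simpa using h.symm
  simp_rw [hsum]
  rw [integral_finsetSum _ fun i _ => hIntg i]
  simp [hpart]

theorem IsOrthogonalComplexStructure.integral_comp_rot {J : V →L[ℝ] V}
    (hJ : IsOrthogonalComplexStructure J) (θ : ℝ) (f : V → ℝ) :
    ∫ x, f (rot J θ x) = ∫ x, f x := by
  let L : V ≃ₗᵢ[ℝ] V := LinearIsometry.toLinearIsometryEquiv
    ⟨(rot J θ : V →ₗ[ℝ] V), hJ.norm_rot θ⟩ rfl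
  exact L.measurePreserving.integral_comp L.toHomeomorph.measurableEmbedding f

theorem IsOrthogonalComplexStructure.integral_integral_rot {J : V →L[ℝ] V}
    (hJ : IsOrthogonalComplexStructure J) {f : V → ℝ} (hf : Continuous f)
    (hc : HasCompactSupport f) :
    ∫ x, (∫ t in (0 : ℝ)..1, f (rot J (2 * π * t) x)) = ∫ x, f x := by
  obtain ⟨r, hr⟩ := hc.isCompact.isBounded.subset_closedBall 0
  have h0 : ∀ x, x ∉ closedBall (0 : V) r → f x = 0 := fun x hx =>
    image_eq_zero_of_notMem_tsupport fun h => hx (hr h)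
  have h0' : ∀ x, x ∉ closedBall (0 : V) r → ∀ t : ℝ, f (rot J (2 * π * t) x) = 0 := fun x hx t =>
    h0 _ (by simpa [hJ.norm_rot] using hx)
  obtain ⟨C, hC⟩ := hf.bounded_above_of_compact_support hc
  have hF : Continuous fun p : ℝ × V => f (rot J (2 * π * p.1) p.2) :=
    hf.comp (((continuous_rot (J := J)).comp
      (by fun_prop : Continuous fun p : ℝ × V => 2 * π * p.1)).clm_apply continuous_snd)
  rw [← setIntegral_eq_integral_of_forall_compl_eq_zero (s := closedBall (0 : V) r)
    fun x hx => by simp [h0' x hx]]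
  simp_rw [intervalIntegral.integral_of_le zero_le_one]
  have : IsFiniteMeasure ((volume : Measure V).restrict (closedBall (0 : V) r)) :=
    ⟨by simpa using (isCompact_closedBall (0 : V) r).measure_lt_top⟩
  rw [integral_integral_swap]
  · have : ∀ t : ℝ, ∫ x in closedBall (0 : V) r, f (rot J (2 * π * t) x) = ∫ x, f x := fun t => by
      rw [setIntegral_eq_integral_of_forall_compl_eq_zero fun x hx => h0' x hx t,
        hJ.integral_comp_rot]
    simp [this]
  · refine Integrable.of_bound (C := C) ?_ (Filter.Eventually.of_forall fun p => hC _)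
    exact (hF.comp continuous_swap).aestronglyMeasurable

end IntegralIdentities

section ShellHamiltonian

variable {V : Type*} [NormedAddCommGroup V] [InnerProductSpace ℝ V]

/-- The points whose squared norm lies in the open interval `(a, b)`. -/
def sqShell (V : Type*) [NormedAddCommGroup V] (a b : ℝ) : Set V := {x | a < ‖x‖ ^ 2 ∧ ‖x‖ ^ 2 < b}

/-- The points whose squared norm lies in the closed interval `[a, b]`. -/
def closedSqShell (V : Type*) [NormedAddCommGroup V] (a b : ℝ) : Set V :=
  {x | a ≤ ‖x‖ ^ 2 ∧ ‖x‖ ^ 2 ≤ b}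

theorem isOpen_sqShell (a b : ℝ) : IsOpen (sqShell V a b) := by
  have h : Continuous fun x : V => ‖x‖ ^ 2 := by fun_prop
  exact isOpen_Ioo.preimage h

theorem closedSqShell_subset_sqShell {a b p q : ℝ} (hp : a < p) (hq : q < b) :
    closedSqShell V p q ⊆ sqShell V a b := fun _ hx => ⟨hp.trans_le hx.1, hx.2.trans_lt hq⟩

theorem hasFDerivAt_comp_norm_sq {ψ : ℝ → ℝ} {ψ' : ℝ} {w : V} (hψ : HasDerivAt ψ ψ' (‖w‖ ^ 2)) :
    HasFDerivAt (fun w : V => ψ (‖w‖ ^ 2)) ((2 * ψ') • innerSL ℝ w) w := by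
  have := hψ.comp_hasFDerivAt w (hasStrictFDerivAt_norm_sq w).hasFDerivAt
  convert! this using 1
  ext v
  simp
  ring

variable {J : V →L[ℝ] V}

theorem IsSymplecticEmbedding.fderiv_apply_of_comp_eq [FiniteDimensional ℝ V]
    {A : Set V} {φ : V → V} (hφ : IsSymplecticEmbedding J A φ)
    (hJ : IsOrthogonalComplexStructure J)
    {H : V → ℝ} {ψ : ℝ → ℝ} (hψ : Differentiable ℝ ψ)
    (h : ∀ w ∈ A, (fderiv ℝ H (φ w)).comp (fderiv ℝ φ w) =
      fderiv ℝ (fun w : V => ψ (‖w‖ ^ 2)) w) {w : V} (hw : w ∈ A) (v : V) :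
    fderiv ℝ H (φ w) v = 2 * deriv ψ (‖w‖ ^ 2) * -inner ℝ v (J (fderiv ℝ φ w (J w))) := by
  obtain ⟨L, hL⟩ := hφ.exists_hasFDerivAt_equiv hJ hw
  have h1 := congrArg (fun T => T (L.symm v)) (h w hw)
  have h2 : fderiv ℝ φ w (L.symm v) = v := by rw [hL.fderiv]; simp
  simp only [ContinuousLinearMap.comp_apply, h2] at h1
  rw [h1, (hasFDerivAt_comp_norm_sq (hψ _).hasDerivAt).fderiv]
  have h3 := hφ.inner_fderiv w hw (J w) (L.symm v)
  rw [h2, hJ.apply_apply, inner_neg_left] at h3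
  rw [real_inner_comm] at h3
  simp [h3]

theorem isCompact_closedSqShell [FiniteDimensional ℝ V] (a b : ℝ) :
    IsCompact (closedSqShell V a b) := by
  have h : Continuous fun x : V => ‖x‖ ^ 2 := by fun_prop
  refine Metric.isCompact_of_isClosed_isBounded (isClosed_Icc.preimage h : IsClosed
    ((fun x : V => ‖x‖ ^ 2) ⁻¹' Icc a b)) ((isBounded_closedBall (x := (0 : V)) (r := √b)).subset fun x hx => ?_)
  rw [mem_closedBall_zero_iff]
  exact Real.le_sqrt_of_sq_le hx.2

variable [FiniteDimensional ℝ V] [MeasurableSpace V] [BorelSpace V]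

/-- The integral of a Hamiltonian of the form `ψ (‖φ⁻¹ x‖ ^ 2)` is independent of the symplectic
embedding `φ`. -/
theorem IsSymplecticEmbedding.integral_sub_eq (hJ : IsOrthogonalComplexStructure J)
    (hV : 3 ≤ Module.finrank ℝ V) {a b : ℝ} {φ : V → V}
    (hφ : IsSymplecticEmbedding J (sqShell V a b) φ) {p q M : ℝ} (hp : a < p) (hq : q < b)
    {ψ : ℝ → ℝ} (hψ : ContDiff ℝ ∞ ψ) (hψ0 : ∀ s, s ∉ Icc p q → deriv ψ s = 0)
    (hψM : ∀ s, q ≤ s → ψ s = M) {G : V → ℝ} (hG : ContDiff ℝ ∞ G)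
    (hGφ : ∀ w ∈ sqShell V a b, (fderiv ℝ G (φ w)).comp (fderiv ℝ φ w) =
      fderiv ℝ (fun w : V => ψ (‖w‖ ^ 2)) w)
    (hG0 : ∀ x, x ∉ φ '' closedSqShell V p q → fderiv ℝ G x = 0)
    (hGM : HasCompactSupport fun x => G x - M) :
    ∫ x, (G x - M) = ∫ w : V, (ψ (‖w‖ ^ 2) - M) := by
  set A := sqShell V a b
  set K := closedSqShell V p q
  have hKA : K ⊆ A := closedSqShell_subset_sqShell hp hq
  have hKc : IsCompact K := isCompact_closedSqShell p q
  have hψd : Differentiable ℝ ψ := hψ.differentiable (by simp)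
  -- both sides through the radial derivative
  have h1 := integral_fderiv_apply_self (u := fun x => G x - M)
    ((hG.sub contDiff_const).of_le (by simp)) hGM
  have h2 := integral_fderiv_apply_self (u := fun w : V => ψ (‖w‖ ^ 2) - M)
    (((hψ.comp (contDiff_norm_sq ℝ)).sub contDiff_const).of_le (by simp))
    (HasCompactSupport.intro (isCompact_closedBall 0 √q) fun x hx => by
      rw [mem_closedBall_zero_iff, not_le] at hx
      rw [hψM _ (Real.lt_sq_of_sqrt_lt hx).le, sub_self])
  simp only [fderiv_sub_const] at h1 h2
  have h2' : ∀ w : V, fderiv ℝ (fun w : V => ψ (‖w‖ ^ 2)) w w =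
      2 * deriv ψ (‖w‖ ^ 2) * ‖w‖ ^ 2 := fun w => by
    rw [(hasFDerivAt_comp_norm_sq (hψd _).hasDerivAt).fderiv]
    simp
  -- change of variables
  let f : V → ℝ := A.indicator fun w => fderiv ℝ G (φ w) (φ w)
  have hf0 : ∀ w, w ∉ K → f w = 0 := by
    intro w hw
    by_cases hwA : w ∈ A
    · simp only [f, indicator_of_mem hwA]
      rw [hG0 _ fun ⟨w', hw', h⟩ => hw (hφ.injOn (hKA hw') hwA h ▸ hw'), zero_apply]
    · exact indicator_of_notMem hwA _
  have hfc : Continuous f := continuous_iff_continuousAt.2 fun w => by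
    by_cases hwA : w ∈ A
    · have hφc := (hφ.contDiffAt hwA).continuousAt
      have : ContinuousAt (fun w => fderiv ℝ G (φ w) (φ w)) w :=
        ((hG.continuous_fderiv (by simp)).continuousAt.comp hφc).clm_apply hφc
      refine this.congr ?_
      filter_upwards [(isOpen_sqShell a b).mem_nhds hwA] with y hy
      exact (indicator_of_mem (f := fun w => fderiv ℝ G (φ w) (φ w)) hy).symm
    · refine (continuousAt_const (y := (0 : ℝ))).congr ?_
      filter_upwards [hKc.isClosed.isOpen_compl.mem_nhds fun h => hwA (hKA h)] with y hy
      exact (hf0 y hy).symm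
  have hfcs : HasCompactSupport f := HasCompactSupport.intro hKc hf0
  have h3 : ∫ x, fderiv ℝ G x x = ∫ w, f w := by
    rw [← setIntegral_eq_integral_of_forall_compl_eq_zero (s := φ '' A) fun x hx => by
      rw [hG0 x fun h => hx (image_mono hKA h), zero_apply]]
    have hA : MeasurableSet A := (isOpen_sqShell a b).measurableSet
    rw [integral_image_eq_integral_abs_det_fderiv_smul volume hA
      (fun w hw => (hφ.hasFDerivAt hw).hasFDerivWithinAt) hφ.injOn, integral_indicator hA]
    exact setIntegral_congr_fun hA fun w hw => by simp [hφ.abs_det_fderiv hJ hw]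
  have h4 : ∀ w, ∫ t in (0 : ℝ)..1, f (rot J (2 * π * t) w) =
      2 * deriv ψ (‖w‖ ^ 2) * ‖w‖ ^ 2 := by
    intro w
    by_cases hw : w ∈ A
    · have hsph : ∀ x : V, ‖x‖ = ‖w‖ → x ∈ A := fun x hx => by
        simp only [A, sqShell, mem_ofPred_eq, hx]; exact hw
      refine Eq.trans ?_
        (congrArg (fun y => 2 * deriv ψ (‖w‖ ^ 2) * y) (hφ.integral_hopf_circle hJ hV hsph))
      rw [← intervalIntegral.integral_const_mul]
      refine intervalIntegral.integral_congr fun t _ => ?_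
      have ht := hsph _ (hJ.norm_rot (2 * π * t) w)
      simp only [f, indicator_of_mem ht]
      rw [hφ.fderiv_apply_of_comp_eq hJ hψd hGφ ht, hJ.norm_rot]
    · have hw' : ‖w‖ ^ 2 ∉ Icc p q := fun h => hw (hKA h)
      have : ∀ t : ℝ, rot J (2 * π * t) w ∉ A := fun t => by
        simpa only [A, sqShell, mem_ofPred_eq, hJ.norm_rot] using hw
      simp [hψ0 _ hw', f, this]
  have h5 := hJ.integral_integral_rot hfc hfcs
  simp_rw [h4] at h5
  simp_rw [h2'] at h2
  rw [h3, ← h5, h2, neg_inj] at h1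
  exact (mul_left_cancel₀ (by positivity) h1).symm

theorem IsSymplecticEmbedding.exists_shell_hamiltonian (hJ : IsOrthogonalComplexStructure J)
    (hV : 3 ≤ Module.finrank ℝ V) {a b : ℝ} (ha : 0 ≤ a) {φ : V → V}
    (hφ : IsSymplecticEmbedding J (sqShell V a b) φ) {D : Set V} (hDb : IsBounded D)
    (hDc : IsPreconnected Dᶜ) (hφD : MapsTo φ (sqShell V a b) D)
    {p q M : ℝ} (hp : a < p) (hpq : p ≤ q) (hq : q < b) (hM : 0 < M)
    {ψ : ℝ → ℝ} (hψ : ContDiff ℝ ∞ ψ) (hψ0 : ∀ s ≤ p, ψ s = 0) (hψM : ∀ s, q ≤ s → ψ s = M)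
    (hψI : ∀ s, ψ s ∈ Icc 0 M) :
    ∃ H : V → ℝ, ContDiff ℝ ∞ H ∧ (∀ w ∈ sqShell V a b, H (φ w) = ψ (‖w‖ ^ 2)) ∧
      (∀ x, x ∉ φ '' closedSqShell V p q → fderiv ℝ H x = 0 ∧ (H x = 0 ∨ H x = M)) ∧
      (∀ x, x ∉ D → H x = M) ∧ ∫ x, (H x - M) = ∫ w : V, (ψ (‖w‖ ^ 2) - M) := by
  set A := sqShell V a b with hA
  set K := closedSqShell V p q
  have hKA : K ⊆ A := closedSqShell_subset_sqShell hp hq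
  have hKc : IsCompact K := isCompact_closedSqShell p q
  have hψd : Differentiable ℝ ψ := hψ.differentiable (by simp)
  have hnt : Nontrivial V := Module.nontrivial_of_finrank_pos (R := ℝ) (by omega)
  have hφc : ContinuousOn φ A := hφ.contDiffOn.continuousOn
  have hφKc : IsClosed (φ '' K) := (hKc.image_of_continuousOn (hφc.mono hKA)).isClosed
  -- the derivative of the profile vanishes outside of `[p, q]`
  have hψ' : ∀ s, s ∉ Icc p q → deriv ψ s = 0 := by
    intro s hs
    rcases lt_or_ge s p with h | h
    · have : ψ =ᶠ[𝓝 s] fun _ => 0 := by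
        filter_upwards [Iio_mem_nhds h] with x hx using hψ0 x (le_of_lt hx)
      simp [this.deriv_eq]
    · have h' : q < s := not_le.1 fun h' => hs ⟨h, h'⟩
      have : ψ =ᶠ[𝓝 s] fun _ => M := by
        filter_upwards [Ioi_mem_nhds h'] with x hx using hψM x (le_of_lt hx)
      simp [this.deriv_eq]
  obtain ⟨G₀, hG₀, hG₀φ, hG₀0⟩ := exists_primitive_pushforward hφ.isOpen hKc hKA hφ.contDiffOn
    hφ.injOn (fun w hw => hφ.exists_hasFDerivAt_equiv hJ hw)
    (f := fun w : V => ψ (‖w‖ ^ 2)) (hψ.comp (contDiff_norm_sq ℝ)).contDiffOn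
    (fun w hw => by
      rw [(hasFDerivAt_comp_norm_sq (hψd _).hasDerivAt).fderiv, hψ' _ fun h => hw.2 h]
      simp)
  have hDK : Dᶜ ⊆ (φ '' K)ᶜ := compl_subset_compl.2 (by
    rintro _ ⟨w, hw, rfl⟩; exact hφD (hKA hw))
  obtain ⟨c, hc⟩ := hDc.exists_eq_const_of_fderiv_eq_zero hφKc.isOpen_compl hDK
    (hG₀.differentiable (by simp)) fun x hx => hG₀0 x hx
  -- normalise at infinity
  set H : V → ℝ := fun x => G₀ x - (c - M) with hH
  have hHs : ContDiff ℝ ∞ H := hG₀.sub contDiff_const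
  have hHd : fderiv ℝ H = fderiv ℝ G₀ := funext fun x => by simp [hH, fderiv_sub_const]
  have hHφ : ∀ w ∈ A, (fderiv ℝ H (φ w)).comp (fderiv ℝ φ w) =
      fderiv ℝ (fun w : V => ψ (‖w‖ ^ 2)) w := fun w hw => by rw [hHd]; exact hG₀φ w hw
  have hH0 : ∀ x, x ∉ φ '' K → fderiv ℝ H x = 0 := fun x hx => by rw [hHd]; exact hG₀0 x hx
  have hHM : ∀ x, x ∉ D → H x = M := fun x hx => by simp [hH, hc x hx]
  -- the constant on the shell
  have hA0 : ∀ w ∈ A, w ≠ 0 := by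
    rintro w hw rfl
    simp only [hA, sqShell, mem_ofPred_eq, norm_zero] at hw
    nlinarith [hw.1]
  have hAp : IsPreconnected A := by
    convert! isPreconnected_shell (V := V) (by omega) a b using 1
    ext x
    exact ⟨fun h => ⟨h.1, h.2, hA0 x h⟩, fun h => ⟨h.1, h.2.1⟩⟩
  have hdiff : ∀ w ∈ A, HasFDerivAt (fun w => H (φ w) - ψ (‖w‖ ^ 2)) (0 : V →L[ℝ] ℝ) w := by
    intro w hw
    have h1 := ((hHs.differentiable (by simp) (φ w)).hasFDerivAt.comp w (hφ.hasFDerivAt hw)).sub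
      (hasFDerivAt_comp_norm_sq (hψd (‖w‖ ^ 2)).hasDerivAt)
    rw [hHφ w hw, (hasFDerivAt_comp_norm_sq (hψd _).hasDerivAt).fderiv, sub_self] at h1
    exact h1
  obtain ⟨σ, hσ⟩ := hφ.isOpen.exists_is_const_of_fderiv_eq_zero (𝕜 := ℝ) hAp
    (fun w hw => (hdiff w hw).differentiableAt.differentiableWithinAt)
    (fun w hw => (hdiff w hw).fderiv)
  have hHψ : ∀ w ∈ A, H (φ w) = ψ (‖w‖ ^ 2) + σ := fun w hw => by linarith [hσ w hw]
  -- values outside of the image of the shell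
  have hoff : ∀ x, x ∉ φ '' K → H x = σ ∨ H x = σ + M := by
    set B : Set V := (φ '' K)ᶜ ∩ H ⁻¹' {σ, σ + M}ᶜ
    have hBo : IsOpen B := hφKc.isOpen_compl.isOpen_inter_preimage_of_fderiv_eq_zero
      (hHs.differentiable (by simp)).differentiableOn (fun x hx => hH0 x hx) _
    have hBo' : IsOpen Bᶜ := by
      rw [isOpen_iff_mem_nhds]
      intro x hx
      by_cases hxK : x ∈ φ '' K
      · obtain ⟨w, hw, rfl⟩ := hxK
        obtain ⟨L, hL⟩ := hφ.exists_hasFDerivAt_equiv hJ (hKA hw)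
        have h1 := ((hφ.contDiffAt (hKA hw)).hasStrictFDerivAt' hL (by simp)).map_nhds_eq_of_equiv
        have h2 : φ '' A ∈ 𝓝 (φ w) := by
          rw [← h1]; exact Filter.image_mem_map (hφ.isOpen.mem_nhds (hKA hw))
        filter_upwards [h2]
        rintro _ ⟨y, hy, rfl⟩ ⟨hyK, hyB⟩
        have hyK' : ¬ (p ≤ ‖y‖ ^ 2 ∧ ‖y‖ ^ 2 ≤ q) := fun h => hyK (mem_image_of_mem φ h)
        refine hyB ?_
        rcases lt_or_ge (‖y‖ ^ 2) p with h | h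
        · left; rw [hHψ y hy, hψ0 _ h.le, zero_add]
        · right
          rw [mem_singleton_iff, hHψ y hy, hψM _ (not_le.1 fun h' => hyK' ⟨h, h'⟩).le, add_comm]
      · have : IsOpen ((φ '' K)ᶜ ∩ H ⁻¹' {σ, σ + M}) :=
          hφKc.isOpen_compl.isOpen_inter_preimage_of_fderiv_eq_zero
            (hHs.differentiable (by simp)).differentiableOn (fun x hx => hH0 x hx) _
        have hxm : x ∈ (φ '' K)ᶜ ∩ H ⁻¹' {σ, σ + M} :=
          ⟨hxK, by by_contra h; exact hx ⟨hxK, h⟩⟩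
        filter_upwards [this.mem_nhds hxm] with y hy hyB using hyB.2 hy.2
    have hBc : IsClopen B := ⟨⟨hBo'⟩, hBo⟩
    obtain ⟨u, hu⟩ := exists_norm_eq V (Real.sqrt_nonneg p)
    have huK : u ∈ K := by
      have : ‖u‖ ^ 2 = p := by rw [hu, Real.sq_sqrt (ha.trans hp.le)]
      exact ⟨this.ge, this.le.trans hpq⟩
    rcases isClopen_iff.1 hBc with h | h
    · intro x hx
      by_contra hcon
      have : x ∈ B := ⟨hx, by simpa using hcon⟩
      rw [h] at this
      exact this
    · have : φ u ∈ B := h ▸ mem_univ _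
      exact absurd (mem_image_of_mem φ huK) this.1
  have hcs : HasCompactSupport fun x => H x - M := by
    obtain ⟨r, hr⟩ := hDb.subset_closedBall 0
    refine HasCompactSupport.intro (isCompact_closedBall 0 r) fun x hx => ?_
    rw [hHM x fun h => hx (hr h), sub_self]
  have hIntg := hφ.integral_sub_eq hJ hV hp hq hψ hψ' hψM hHs hHφ hH0 hcs
  have hσ0 : σ = 0 := by
    obtain ⟨x, hx⟩ : ∃ x, x ∉ D := by
      by_contra! h
      exact NormedSpace.unbounded_univ ℝ V (eq_univ_of_forall h ▸ hDb)
    rcases hoff x (hDK hx) with h | h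
    · rw [hHM x hx] at h
      exfalso
      have h1 : 0 ≤ ∫ x, (H x - M) := integral_nonneg fun x => by
        simp only [Pi.zero_apply, sub_nonneg]
        by_cases hxK : x ∈ φ '' K
        · obtain ⟨w, hw, rfl⟩ := hxK
          rw [hHψ w (hKA hw), ← h]
          linarith [(hψI (‖w‖ ^ 2)).1]
        · rcases hoff x hxK with h' | h' <;> linarith
      have h2 : 0 < ∫ w : V, (M - ψ (‖w‖ ^ 2)) := by
        refine Continuous.integral_pos_of_hasCompactSupport_nonneg_nonzero (x := 0)
          (continuous_const.sub (hψ.continuous.comp (by fun_prop)))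
          (HasCompactSupport.intro (isCompact_closedBall 0 √q) fun x hx => ?_)
          (fun w => sub_nonneg.2 (hψI _).2) ?_
        · rw [mem_closedBall_zero_iff, not_le] at hx
          rw [hψM _ (Real.lt_sq_of_sqrt_lt hx).le, sub_self]
        · rw [norm_zero, hψ0 _ (by nlinarith)]
          simpa using hM.ne'
      have h3 : ∫ w : V, (ψ (‖w‖ ^ 2) - M) = -∫ w : V, (M - ψ (‖w‖ ^ 2)) := by
        rw [← integral_neg]; simp
      linarith
    · rw [hHM x hx] at h; linarith
  subst hσ0
  refine ⟨H, hHs, fun w hw => by simpa using hHψ w hw, fun x hx => ⟨hH0 x hx, ?_⟩, hHM, hIntg⟩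
  simpa using hoff x hx

end ShellHamiltonian

section Hole

variable {V : Type*} [NormedAddCommGroup V] [InnerProductSpace ℝ V] [FiniteDimensional ℝ V]
  [MeasurableSpace V] [BorelSpace V] {J : V →L[ℝ] V}

theorem integral_profile_bounds {p q M : ℝ} {ψ : ℝ → ℝ} (hψ : Continuous ψ)
    (hψ0 : ∀ s ≤ p, ψ s = 0) (hψM : ∀ s, q ≤ s → ψ s = M) (hψI : ∀ s, ψ s ∈ Icc 0 M) :
    M * volume.real (ball (0 : V) √p) ≤ ∫ w : V, (M - ψ (‖w‖ ^ 2)) ∧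
      ∫ w : V, (M - ψ (‖w‖ ^ 2)) ≤ M * volume.real (closedBall (0 : V) √q) := by
  have hsupp : ∀ x : V, x ∉ closedBall (0 : V) √q → M - ψ (‖x‖ ^ 2) = 0 := fun x hx => by
    rw [mem_closedBall_zero_iff, not_le] at hx
    rw [hψM _ (Real.lt_sq_of_sqrt_lt hx).le, sub_self]
  have hIntg : Integrable fun w : V => M - ψ (‖w‖ ^ 2) :=
    Continuous.integrable_of_hasCompactSupport
      (continuous_const.sub (hψ.comp (by fun_prop : Continuous fun w : V => ‖w‖ ^ 2)))
      (HasCompactSupport.intro (isCompact_closedBall 0 √q) hsupp)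
  constructor
  · have h1 : ∫ w : V, (ball (0 : V) √p).indicator (fun _ => M) w =
        M * volume.real (ball (0 : V) √p) := by
      rw [integral_indicator measurableSet_ball, setIntegral_const, smul_eq_mul, mul_comm]
    rw [← h1]
    refine integral_mono 
      ((integrable_indicator_iff measurableSet_ball).2
        (integrableOn_const measure_ball_lt_top.ne)) hIntg ?_
    · intro w
      by_cases hw : w ∈ ball (0 : V) √p
      · simp only [indicator_of_mem hw]
        rw [mem_ball_zero_iff] at hw
        rw [hψ0 _ (Real.lt_sqrt (norm_nonneg w) |>.1 hw).le, sub_zero]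
      · simp only [indicator_of_notMem hw]
        exact sub_nonneg.2 (hψI _).2
  · have h1 : ∫ w : V, (closedBall (0 : V) √q).indicator (fun _ => M) w =
        M * volume.real (closedBall (0 : V) √q) := by
      rw [integral_indicator measurableSet_closedBall, setIntegral_const, smul_eq_mul, mul_comm]
    rw [← h1]
    refine integral_mono hIntg
      ((integrable_indicator_iff measurableSet_closedBall).2
        (integrableOn_const measure_closedBall_lt_top.ne)) ?_
    intro w
    by_cases hw : w ∈ closedBall (0 : V) √q
    · simp only [indicator_of_mem hw]
      linarith [(hψI (‖w‖ ^ 2)).1]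
    · simp only [indicator_of_notMem hw]
      exact (hsupp w hw).le

theorem IsSymplecticEmbedding.exists_shell_hamiltonian_of_hole
    (hJ : IsOrthogonalComplexStructure J)
    (hV : 3 ≤ Module.finrank ℝ V) {a b : ℝ} (ha : 0 ≤ a) {φ : V → V}
    (hφ : IsSymplecticEmbedding J (sqShell V a b) φ) {D : Set V} (hDo : IsOpen D)
    (hDb : IsBounded D)
    (hDc : IsPreconnected Dᶜ) (hφD : MapsTo φ (sqShell V a b) D)
    {Z : Set V} (hZD : Z ⊆ D) (hZc : IsClosed Z) (hZp : IsPreconnected Z)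
    (hφZ : ∀ w ∈ sqShell V a b, φ w ∉ Z)
    {p q M : ℝ} (hp : a < p) (hpq : p ≤ q) (hq : q < b) (hM : 0 < M)
    (hvol : volume.real D - volume.real Z < volume.real (ball (0 : V) √p))
    {ψ : ℝ → ℝ} (hψ : ContDiff ℝ ∞ ψ) (hψ0 : ∀ s ≤ p, ψ s = 0) (hψM : ∀ s, q ≤ s → ψ s = M)
    (hψI : ∀ s, ψ s ∈ Icc 0 M) :
    volume.real Z ≤ volume.real (closedBall (0 : V) √q) ∧
    ∃ H : V → ℝ, ContDiff ℝ ∞ H ∧ (∀ w ∈ sqShell V a b, H (φ w) = ψ (‖w‖ ^ 2)) ∧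
      (∀ x, x ∉ φ '' closedSqShell V p q → fderiv ℝ H x = 0 ∧ (H x = 0 ∨ H x = M)) ∧
      (∀ x, x ∉ D → H x = M) ∧ (∀ x ∈ Z, H x = 0) ∧ ∀ x, H x ∈ Icc 0 M := by
  obtain ⟨H, hH, hHφ, hH0, hHM, hIntg⟩ := hφ.exists_shell_hamiltonian hJ hV ha hDb hDc hφD hp hpq
    hq hM hψ hψ0 hψM hψI
  have hKA : closedSqShell V p q ⊆ sqShell V a b := closedSqShell_subset_sqShell hp hq
  have hHI : ∀ x, H x ∈ Icc 0 M := fun x => by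
    by_cases hx : x ∈ φ '' closedSqShell V p q
    · obtain ⟨w, hw, rfl⟩ := hx
      rw [hHφ w (hKA hw)]; exact hψI _
    · rcases (hH0 x hx).2 with h | h <;> rw [h]
      exacts [left_mem_Icc.2 hM.le, right_mem_Icc.2 hM.le]
  obtain ⟨hb1, hb2⟩ := integral_profile_bounds (V := V) hψ.continuous hψ0 hψM hψI
  have hIntg' : ∫ x, (M - H x) = ∫ w : V, (M - ψ (‖w‖ ^ 2)) := by
    have h1 : ∫ x, (M - H x) = -∫ x, (H x - M) := by rw [← integral_neg]; simp
    have h2 : ∫ w : V, (M - ψ (‖w‖ ^ 2)) = -∫ w : V, (ψ (‖w‖ ^ 2) - M) := by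
      rw [← integral_neg]; simp
    rw [h1, h2, hIntg]
  have hDf : volume D ≠ ⊤ := hDb.measure_lt_top.ne
  have hZf : volume Z ≠ ⊤ := (hDb.subset hZD).measure_lt_top.ne
  have hHint : Integrable fun x => M - H x := by
    obtain ⟨r, hr⟩ := hDb.subset_closedBall 0
    refine Continuous.integrable_of_hasCompactSupport (continuous_const.sub hH.continuous)
      (HasCompactSupport.intro (isCompact_closedBall 0 r) fun x hx => ?_)
    rw [hHM x fun h => hx (hr h), sub_self]
  have hZK : ∀ x ∈ Z, x ∉ φ '' closedSqShell V p q := by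
    rintro _ hx ⟨w, hw, rfl⟩
    exact hφZ w (hKA hw) hx
  have hK : IsClosed (φ '' closedSqShell V p q) :=
    ((isCompact_closedSqShell p q).image_of_continuousOn
      (hφ.contDiffOn.continuousOn.mono hKA)).isClosed
  obtain ⟨c, hc⟩ := hZp.exists_eq_const_of_fderiv_eq_zero hK.isOpen_compl (fun x hx => hZK x hx)
    (hH.differentiable (by simp)) fun x hx => (hH0 x hx).1
  have hZ0 : ∀ x ∈ Z, H x = 0 := by
    by_contra! hcon
    obtain ⟨y, hyZ, hy⟩ := hcon
    have hcM : c = M := by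
      rw [← hc y hyZ]; exact ((hH0 y (hZK y hyZ)).2).resolve_left hy
    have hDZ : MeasurableSet (D \ Z) := hDo.measurableSet.diff hZc.measurableSet
    have h1 : ∫ x, (D \ Z).indicator (fun _ => M) x = M * (volume.real D - volume.real Z) := by
      rw [integral_indicator hDZ, setIntegral_const, smul_eq_mul, mul_comm,
        measureReal_sdiff hZD hZc.measurableSet hDf]
    have h2 : ∫ x, (M - H x) ≤ ∫ x, (D \ Z).indicator (fun _ => M) x := by
      refine integral_mono hHint ((integrable_indicator_iff hDZ).2 (integrableOn_const
        (measure_ne_top_of_subset sdiff_subset hDf))) fun x => ?_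
      by_cases hx : x ∈ D \ Z
      · simp only [indicator_of_mem hx]
        linarith [(hHI x).1]
      · simp only [indicator_of_notMem hx]
        by_cases hxD : x ∈ D
        · have hxZ : x ∈ Z := by by_contra h; exact hx ⟨hxD, h⟩
          rw [hc x hxZ, hcM, sub_self]
        · rw [hHM x hxD, sub_self]
    rw [h1, hIntg'] at h2
    nlinarith [hb1.trans h2]
  refine ⟨?_, H, hH, hHφ, hH0, hHM, hZ0, hHI⟩
  have h1 : ∫ x, Z.indicator (fun _ => M) x = M * volume.real Z := by
    rw [integral_indicator hZc.measurableSet, setIntegral_const, smul_eq_mul, mul_comm]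
  have h2 : ∫ x, Z.indicator (fun _ => M) x ≤ ∫ x, (M - H x) := by
    refine integral_mono ((integrable_indicator_iff hZc.measurableSet).2 (integrableOn_const hZf))
      hHint fun x => ?_
    by_cases hx : x ∈ Z
    · simp only [indicator_of_mem hx]
      rw [hZ0 x hx, sub_zero]
    · simp only [indicator_of_notMem hx]
      exact sub_nonneg.2 (hHI x).2
  rw [h1, hIntg'] at h2
  exact le_of_mul_le_mul_left (h2.trans hb2) hM

end Hole

section Profile

theorem exists_mem_Icc_forall_int_ne {a b : ℝ} (hab : a < b) :
    ∃ K ∈ Ioo a b, ∀ k : ℤ, K ≠ k * π := by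
  have h1 : (range fun k : ℤ => (k : ℝ) * π).Countable := countable_range _
  obtain ⟨K, hK, hK'⟩ := (h1.dense_compl ℝ).exists_between hab
  exact ⟨K, hK', fun k h => hK ⟨k, h.symm⟩⟩

/-- A smooth monotone step `ψ`, from `0` on `(-∞, s₀]` to `M` on `[s₁, ∞)`, such that the values
`kπs - ψ(s)`, for `ψ'(s) = kπ`, are close to `kπs₀` or to `kπs₁ - M`. -/
theorem exists_profile {s₀ s₁ e M₀ : ℝ} (h₀ : 0 < s₀) (h₁ : s₀ < s₁) (he : 0 < e) :
    ∃ (M : ℝ) (ψ : ℝ → ℝ), M₀ ≤ M ∧ 0 < M ∧ ContDiff ℝ ∞ ψ ∧ (∀ s ≤ s₀, ψ s = 0) ∧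
      (∀ s, s₁ ≤ s → ψ s = M) ∧ (∀ s, ψ s ∈ Icc 0 M) ∧
      ∀ (k : ℤ) (s : ℝ), s ∈ Icc s₀ s₁ → deriv ψ s = k * π →
        (0 < k * π * s - ψ s → π * s₀ - 3 * e ≤ k * π * s - ψ s) ∧
        (k * π * s - ψ s + M ≤ 2 * π * s₀ - 3 * e →
          k * π * s - ψ s + M ≤ π * s₁ + e) := by
  have hπ := Real.pi_pos
  obtain ⟨N, hN⟩ := exists_nat_gt ((max M₀ 0 + 2 * π * s₀) / (π * s₁))
  have hs₁ : 0 < s₁ := h₀.trans h₁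
  rw [div_lt_iff₀ (by positivity)] at hN
  have hNM : max M₀ 0 + 2 * π * s₀ < N * π * s₁ := by linarith
  obtain ⟨K, ⟨hK1, hK2⟩, hK⟩ := exists_mem_Icc_forall_int_ne
    (a := (N * π * s₁ + 3 * e / 2) / (s₁ - s₀)) (b := (N * π * s₁ + 2 * e) / (s₁ - s₀))
    (div_lt_div_of_pos_right (by linarith) (by linarith))
  rw [div_lt_iff₀ (by linarith)] at hK1
  rw [lt_div_iff₀ (by linarith)] at hK2
  have hM0 : 0 ≤ max M₀ 0 := le_max_right _ _
  have hK0 : 0 < K := by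
    by_contra! h
    nlinarith [mul_pos hπ h₀]
  set η := min ((s₁ - s₀) / 4) (e / (4 * K))
  have hη0 : 0 < η := lt_min (by linarith) (by positivity)
  have hη1 : η ≤ (s₁ - s₀) / 4 := min_le_left _ _
  have hη2 : K * η ≤ e / 4 := by
    calc K * η ≤ K * (e / (4 * K)) := by gcongr; exact min_le_right _ _
      _ = e / 4 := by field_simp
  let f : ContDiffBump ((s₀ + s₁) / 2) := ⟨(s₁ - s₀) / 2 - η, (s₁ - s₀) / 2, by linarith, by linarith⟩
  have hfc : Continuous fun s => K * f s := continuous_const.mul f.continuous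
  have hfi : ∀ a b : ℝ, IntervalIntegrable (fun s => K * f s) volume a b :=
    fun a b => hfc.intervalIntegrable a b
  have hf0 : ∀ s, s ∉ Ioo s₀ s₁ → f s = 0 := fun s hs => by
    apply f.zero_of_le_dist
    simp only [f, Real.dist_eq]
    by_contra! h
    rw [abs_lt] at h
    exact hs ⟨by linarith, by linarith⟩
  have hf1 : ∀ s ∈ Icc (s₀ + η) (s₁ - η), f s = 1 := fun s hs => by
    apply f.one_of_mem_closedBall
    rw [mem_closedBall, Real.dist_eq, abs_le]
    simp only [f]
    constructor <;> linarith [hs.1, hs.2]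
  have hfI : ∀ s, 0 ≤ K * f s := fun s => mul_nonneg hK0.le f.nonneg
  have hfK : ∀ s, K * f s ≤ K := fun s => mul_le_of_le_one_right hK0.le f.le_one
  set ψ : ℝ → ℝ := fun s => ∫ t in s₀..s, K * f t with hψ
  have hψd : ∀ s, HasDerivAt ψ (K * f s) s := fun s =>
    intervalIntegral.integral_hasDerivAt_right (hfi _ _) (hfc.stronglyMeasurableAtFilter _ _)
      hfc.continuousAt
  have hψd' : deriv ψ = fun s => K * f s := funext fun s => (hψd s).deriv
  have hsub : ∀ a b : ℝ, ψ b - ψ a = ∫ t in a..b, K * f t := fun a b =>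
    intervalIntegral.integral_interval_sub_left (hfi _ _) (hfi _ _)
  have hmono : ∀ a b : ℝ, a ≤ b → ψ a ≤ ψ b := fun a b hab => by
    have := intervalIntegral.integral_nonneg (f := fun t => K * f t) (μ := volume) hab
      fun t _ => hfI t
    linarith [hsub a b]
  have hlip : ∀ a b : ℝ, a ≤ b → ψ b - ψ a ≤ K * (b - a) := fun a b hab => by
    have := intervalIntegral.integral_mono_on (f := fun t => K * f t) (g := fun _ => K)
      (μ := volume) hab (hfi a b) (by simp) fun t _ => hfK t
    rw [hsub]
    simpa [mul_comm] using this
  have hψ0 : ∀ s ≤ s₀, ψ s = 0 := fun s hs => by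
    simp only [hψ]
    rw [intervalIntegral.integral_congr (g := fun _ => 0), intervalIntegral.integral_zero]
    intro t ht
    rw [uIcc_of_ge hs] at ht
    simp [hf0 t fun h => (h.1.trans_le ht.2).false]
  have hψ1 : ∀ s, s₁ ≤ s → ψ s = ψ s₁ := fun s hs => by
    have := hsub s₁ s
    rw [intervalIntegral.integral_congr (g := fun _ => 0), intervalIntegral.integral_zero] at this
    · linarith
    intro t ht
    rw [uIcc_of_le hs] at ht
    simp [hf0 t fun h => (h.2.trans_le ht.1).false]
  have hψm : ψ (s₁ - η) - ψ (s₀ + η) = K * (s₁ - s₀ - 2 * η) := by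
    rw [hsub, intervalIntegral.integral_congr (g := fun _ => K)]
    · simp; ring_nf
    intro t ht
    rw [uIcc_of_le (by linarith)] at ht
    simp [hf1 t ht]
  have hψs₀ := hψ0 s₀ le_rfl
  have hM1 : ψ s₁ ≤ K * (s₁ - s₀) := by linarith [hlip s₀ s₁ h₁.le]
  have hM2 : K * (s₁ - s₀) - 2 * (K * η) ≤ ψ s₁ := by
    nlinarith [hmono (s₁ - η) s₁ (by linarith), hmono s₀ (s₀ + η) (by linarith)]
  have hM3 : N * π * s₁ + e ≤ ψ s₁ := by linarith
  have hM4 : ψ s₁ ≤ N * π * s₁ + 2 * e := by linarith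
  refine ⟨ψ s₁, ψ, by linarith [le_max_left M₀ 0, mul_pos hπ h₀],
    by linarith [mul_pos hπ h₀], ?_, hψ0, hψ1, fun s => ?_, fun k s hs hk => ?_⟩
  · refine contDiff_infty_iff_deriv.2 ⟨fun s => (hψd s).differentiableAt, ?_⟩
    rw [hψd']
    exact contDiff_const.mul f.contDiff
  · constructor
    · rcases le_total s s₀ with h | h
      · exact (hψ0 s h).ge
      · exact hψs₀ ▸ hmono _ _ h
    · rcases le_total s s₁ with h | h
      · exact hmono _ _ h
      · exact (hψ1 s h).le
  rw [(hψd s).deriv] at hk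
  have hk0 : 0 ≤ (k : ℝ) * π := hk ▸ hfI s
  have hkK : (k : ℝ) * π ≤ K := hk ▸ hfK s
  have hk0' : (0 : ℝ) ≤ k := nonneg_of_mul_nonneg_left hk0 hπ
  have hk0'' : 0 ≤ k := by exact_mod_cast hk0'
  rcases lt_or_ge s (s₀ + η) with h | h
  · -- the bottom corner
    have h1 : 0 ≤ ψ s := hψs₀ ▸ hmono _ _ hs.1
    have h2 : ψ s ≤ K * η := by
      have := hlip _ _ hs.1
      rw [hψs₀, sub_zero] at this
      exact this.trans (by gcongr; linarith)
    have h3 : (k : ℝ) * π * s₀ ≤ k * π * s := by gcongr; exact hs.1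
    refine ⟨fun hv => ?_, fun hv => ?_⟩
    · rcases hk0''.eq_or_lt with hk1 | hk1
      · subst hk1
        simp at hv
        linarith
      · have hk2 : (1 : ℝ) ≤ k := by exact_mod_cast hk1
        have : 1 * (π * s₀) ≤ k * (π * s₀) := by gcongr
        linarith
    · have : 0 ≤ (k : ℝ) * π * s₀ := by positivity
      linarith
  · rcases le_or_gt s (s₁ - η) with h' | h'
    · rw [hf1 s ⟨h, h'⟩, mul_one] at hk
      exact absurd hk (hK k)
    -- the top corner
    have h1 : 0 ≤ ψ s₁ - ψ s := sub_nonneg.2 (hmono _ _ hs.2)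
    have h2 : ψ s₁ - ψ s ≤ K * η :=
      (hlip _ _ hs.2).trans (by gcongr; linarith)
    have h3 : (k : ℝ) * π * s ≤ k * π * s₁ := by gcongr; exact hs.2
    have h4 : (k : ℝ) * π * s₁ - K * η ≤ k * π * s := by
      have : (k : ℝ) * π * (s₁ - s) ≤ K * η :=
        mul_le_mul hkK (by linarith) (by linarith [hs.2]) hK0.le
      linarith
    refine ⟨fun hv => ?_, fun hv => ?_⟩
    · rcases le_or_gt k N with hkN | hkN
      · have hkN' : (k : ℝ) ≤ N := by exact_mod_cast hkN
        have : (k : ℝ) * (π * s₁) ≤ N * (π * s₁) := by gcongr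
        linarith
      · have hkN' : (N : ℝ) + 1 ≤ k := by exact_mod_cast hkN
        have : (N + 1 : ℝ) * (π * s₁) ≤ k * (π * s₁) := by gcongr
        nlinarith
    · rcases le_or_gt k 1 with hk1 | hk1
      · have hk2 : (k : ℝ) ≤ 1 := by exact_mod_cast hk1
        have : (k : ℝ) * (π * s₁) ≤ 1 * (π * s₁) := by gcongr
        linarith
      · have hk2 : (2 : ℝ) ≤ k := by exact_mod_cast hk1
        have : 2 * (π * s₁) ≤ k * (π * s₁) := by gcongr
        nlinarith

end Profile

section PlaneProjection

variable {V : Type*} [NormedAddCommGroup V] [InnerProductSpace ℝ V] {J : V →L[ℝ] V}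

/-- The orthogonal projection onto the plane spanned by a unit vector `u` and `J u`. -/
def planeProj (J : V →L[ℝ] V) (u : V) : V →L[ℝ] V :=
  (innerSL ℝ u).smulRight u + (innerSL ℝ (J u)).smulRight (J u)

theorem planeProj_apply (u z : V) :
    planeProj J u z = (inner ℝ u z : ℝ) • u + (inner ℝ (J u) z : ℝ) • J u := rfl

/-- The operator with eigenvalue `w₁` on the plane of `u` and `w₂` on its complement. -/
def planeOp (J : V →L[ℝ] V) (u : V) (w₁ w₂ : ℝ) : V →L[ℝ] V :=
  w₂ • ContinuousLinearMap.id ℝ V + (w₁ - w₂) • planeProj J u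

theorem planeOp_apply (u : V) (w₁ w₂ : ℝ) (z : V) :
    planeOp J u w₁ w₂ z = w₂ • z + (w₁ - w₂) • planeProj J u z := rfl

theorem exists_nonresonance {w : ℝ} (hw : ∀ k : ℤ, w ≠ k * π) :
    ∃ d, 0 < d ∧ ∀ k : ℤ, d ≤ |2 * π * k - 2 * w| := by
  have hπ := Real.pi_pos
  refine ⟨2 * π * |w / π - round (w / π)|, ?_, fun k => ?_⟩
  · have : w / π - (round (w / π) : ℤ) ≠ 0 := fun h => by
      apply hw (round (w / π) : ℤ)
      field_simp at h
      linarith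
    positivity
  · have h1 : |2 * π * k - 2 * w| = 2 * π * |w / π - k| := by
      have h2 : 2 * π * k - 2 * w = -(2 * π * (w / π - k)) := by field_simp; ring
      rw [h2, abs_neg, abs_mul, abs_of_pos (show (0 : ℝ) < 2 * π by positivity)]
    rw [h1]
    exact mul_le_mul_of_nonneg_left (round_le (w / π) k) (by positivity)

namespace IsOrthogonalComplexStructure

variable (hJ : IsOrthogonalComplexStructure J) {u : V} (hu : ‖u‖ = 1)

include hJ

theorem planeProj_comm (z : V) : planeProj J u (J z) = J (planeProj J u z) := by
  have h1 : inner ℝ u (J z) = -inner ℝ (J u) z := by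
    rw [real_inner_comm, hJ.inner_apply_left, real_inner_comm]
  simp only [planeProj_apply, map_add, map_smul, hJ.apply_apply, hJ.inner_apply_apply, h1]
  simp only [neg_smul, smul_neg]
  abel

theorem inner_planeProj_self (z : V) :
    inner ℝ (planeProj J u z) z = inner ℝ u z ^ 2 + inner ℝ (J u) z ^ 2 := by
  rw [planeProj_apply, inner_add_left, inner_smul_left, inner_smul_left]
  simp
  ring

theorem inner_planeProj_left (y z : V) :
    inner ℝ (planeProj J u y) z = inner ℝ y (planeProj J u z) := by
  simp only [planeProj_apply, inner_add_left, inner_add_right, inner_smul_left, inner_smul_right]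
  rw [real_inner_comm u y, real_inner_comm (J u) y]
  simp
  ring

theorem planeOp_comm (w₁ w₂ : ℝ) (z : V) : planeOp J u w₁ w₂ (J z) = J (planeOp J u w₁ w₂ z) := by
  simp [planeOp_apply, hJ.planeProj_comm]

theorem inner_planeOp_left (w₁ w₂ : ℝ) (y z : V) :
    inner ℝ (planeOp J u w₁ w₂ y) z = inner ℝ y (planeOp J u w₁ w₂ z) := by
  simp only [planeOp_apply, inner_add_left, inner_add_right, inner_smul_left, inner_smul_right,
    hJ.inner_planeProj_left]
  simp

include hu

theorem norm_sq_planeProj (z : V) :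
    ‖planeProj J u z‖ ^ 2 = inner ℝ u z ^ 2 + inner ℝ (J u) z ^ 2 := by
  have h1 : inner ℝ u (J u) = (0 : ℝ) := hJ.inner_self_apply u
  rw [← real_inner_self_eq_norm_sq, planeProj_apply]
  simp only [inner_add_left, inner_add_right, inner_smul_left, inner_smul_right, h1,
    real_inner_comm u (J u), real_inner_self_eq_norm_sq, hJ.norm_apply, hu]
  simp
  ring

theorem planeProj_idem (z : V) : planeProj J u (planeProj J u z) = planeProj J u z := by
  have h1 : inner ℝ u (J u) = (0 : ℝ) := hJ.inner_self_apply u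
  have h2 : inner ℝ (J u) u = (0 : ℝ) := by rw [real_inner_comm, h1]
  simp only [planeProj_apply, inner_add_right, inner_smul_right, h1, h2,
    real_inner_self_eq_norm_sq, hJ.norm_apply, hu]
  simp

theorem inner_planeProj_sub (y z : V) :
    inner ℝ (planeProj J u y) (z - planeProj J u z) = (0 : ℝ) := by
  rw [hJ.inner_planeProj_left, map_sub, hJ.planeProj_idem hu, sub_self, inner_zero_right]

theorem norm_sq_eq_add_planeProj (z : V) :
    ‖z‖ ^ 2 = ‖planeProj J u z‖ ^ 2 + ‖z - planeProj J u z‖ ^ 2 := by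
  have := norm_add_sq_eq_norm_sq_add_norm_sq_of_inner_eq_zero _ _
    (hJ.inner_planeProj_sub hu z z)
  simpa [sq] using this

theorem inner_planeProj_self_eq (z : V) : inner ℝ (planeProj J u z) z = ‖planeProj J u z‖ ^ 2 := by
  rw [hJ.inner_planeProj_self, hJ.norm_sq_planeProj hu]

theorem planeProj_self : planeProj J u u = u := by
  rw [planeProj_apply, real_inner_comm u (J u), hJ.inner_self_apply, real_inner_self_eq_norm_sq, hu]
  simp

theorem inner_planeOp_self (w₁ w₂ : ℝ) (z : V) :
    inner ℝ (planeOp J u w₁ w₂ z) z =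
      w₁ * ‖planeProj J u z‖ ^ 2 + w₂ * ‖z - planeProj J u z‖ ^ 2 := by
  simp only [planeOp_apply, inner_add_left, inner_smul_left, hJ.inner_planeProj_self_eq hu,
    real_inner_self_eq_norm_sq]
  rw [hJ.norm_sq_eq_add_planeProj hu z]
  simp
  ring

theorem inner_planeOp_self_basis (w₁ w₂ : ℝ) : inner ℝ (planeOp J u w₁ w₂ u) u = w₁ := by
  rw [hJ.inner_planeOp_self hu, hJ.planeProj_self hu]
  simp [hu]

/-- If neither `w₁` nor `w₂` lies in `πℤ`, then `planeOp J u w₁ w₂` is nonresonant. -/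
theorem exists_planeOp_nonresonance {w₁ w₂ : ℝ} (h₁ : ∀ k : ℤ, w₁ ≠ k * π)
    (h₂ : ∀ k : ℤ, w₂ ≠ k * π) :
    ∃ d, 0 < d ∧ ∀ (k : ℤ) (v : V),
      d * ‖v‖ ≤ ‖(2 * π * (k : ℝ)) • v - (2 : ℝ) • planeOp J u w₁ w₂ v‖ := by
  obtain ⟨d₁, hd₁, h₁'⟩ := exists_nonresonance h₁
  obtain ⟨d₂, hd₂, h₂'⟩ := exists_nonresonance h₂
  refine ⟨min d₁ d₂, lt_min hd₁ hd₂, fun k v => ?_⟩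
  set d := min d₁ d₂
  have hd : 0 < d := lt_min hd₁ hd₂
  refine le_of_sq_le_sq ?_ (norm_nonneg _)
  set p := planeProj J u v
  have h3 : (2 * π * (k : ℝ)) • v - (2 : ℝ) • planeOp J u w₁ w₂ v =
      (2 * π * k - 2 * w₁) • p + (2 * π * k - 2 * w₂) • (v - p) := by
    rw [planeOp_apply]
    module
  have h4 : inner ℝ ((2 * π * k - 2 * w₁) • p) ((2 * π * k - 2 * w₂) • (v - p)) = 0 := by
    rw [inner_smul_left, inner_smul_right, hJ.inner_planeProj_sub hu]
    simp
  have h5 := norm_add_sq_eq_norm_sq_add_norm_sq_of_inner_eq_zero _ _ h4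
  rw [h3, sq ‖_ + _‖, h5, mul_pow, hJ.norm_sq_eq_add_planeProj hu, norm_smul, norm_smul,
    Real.norm_eq_abs, Real.norm_eq_abs]
  have h6 : d ^ 2 ≤ |2 * π * k - 2 * w₁| ^ 2 := by gcongr; exact (min_le_left _ _).trans (h₁' k)
  have h7 : d ^ 2 ≤ |2 * π * k - 2 * w₂| ^ 2 := by gcongr; exact (min_le_right _ _).trans (h₂' k)
  nlinarith [mul_le_mul_of_nonneg_right h6 (sq_nonneg ‖p‖),
    mul_le_mul_of_nonneg_right h7 (sq_nonneg ‖v - p‖)]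

end IsOrthogonalComplexStructure

end PlaneProjection

section OuterProfile

/-- A smooth function vanishing on `(-∞, c]`, with slope in `(0, 1]` on `(c, ∞)`, equal to `1` on
`[c + l, ∞)`. -/
theorem exists_outer_profile (c : ℝ) {l : ℝ} (hl : 0 < l) :
    ∃ F : ℝ → ℝ, ContDiff ℝ ∞ F ∧ (∀ s ≤ c, F s = 0 ∧ deriv F s = 0) ∧
      (∀ s, c < s → 0 < deriv F s) ∧ (∀ s, deriv F s ≤ 1) ∧ (∀ s, c + l ≤ s → deriv F s = 1) ∧
      (∀ s, s - c - l ≤ F s) ∧ (∀ s, c ≤ s → F s ≤ s - c) ∧ ∀ s, 0 ≤ F s := by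
  set f : ℝ → ℝ := fun t => Real.smoothTransition ((t - c) / l) with hf
  have hfs : ContDiff ℝ ∞ f := by
    have h : ContDiff ℝ ∞ fun t : ℝ => (t - c) / l := (contDiff_id.sub contDiff_const).div_const _
    exact Real.smoothTransition.contDiff.comp h
  have hfc : Continuous f := hfs.continuous
  have hfi : ∀ a b : ℝ, IntervalIntegrable f volume a b := fun a b => hfc.intervalIntegrable a b
  set F : ℝ → ℝ := fun s => ∫ t in c..s, f t with hF
  have hFd : ∀ s, HasDerivAt F (f s) s := fun s =>
    intervalIntegral.integral_hasDerivAt_right (hfi _ _) (hfc.stronglyMeasurableAtFilter _ _)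
      hfc.continuousAt
  have hFd' : deriv F = f := funext fun s => (hFd s).deriv
  have hf0 : ∀ s ≤ c, f s = 0 := fun s hs =>
    Real.smoothTransition.zero_of_nonpos (div_nonpos_of_nonpos_of_nonneg (by linarith) hl.le)
  have hf1 : ∀ s, c + l ≤ s → f s = 1 := fun s hs =>
    Real.smoothTransition.one_of_one_le ((one_le_div hl).2 (by linarith))
  have hfn : ∀ s, 0 ≤ f s := fun s => Real.smoothTransition.nonneg _
  have hfl : ∀ s, f s ≤ 1 := fun s => Real.smoothTransition.le_one _
  have hsub : ∀ a b : ℝ, F b - F a = ∫ t in a..b, f t := fun a b =>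
    intervalIntegral.integral_interval_sub_left (hfi _ _) (hfi _ _)
  have hF0 : ∀ s ≤ c, F s = 0 := fun s hs => by
    simp only [hF]
    rw [intervalIntegral.integral_congr (g := fun _ => 0), intervalIntegral.integral_zero]
    intro t ht
    rw [uIcc_of_ge hs] at ht
    exact hf0 t ht.2
  have hmono : ∀ a b : ℝ, a ≤ b → F a ≤ F b := fun a b hab => by
    have := intervalIntegral.integral_nonneg (f := f) (μ := volume) hab fun t _ => hfn t
    linarith [hsub a b]
  have hlip : ∀ a b : ℝ, a ≤ b → F b - F a ≤ b - a := fun a b hab => by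
    have := intervalIntegral.integral_mono_on (f := f) (g := fun _ => (1 : ℝ))
      (μ := volume) hab (hfi a b) (by simp) fun t _ => hfl t
    rw [hsub]
    simpa using this
  have hFn : ∀ s, 0 ≤ F s := fun s => by
    rcases le_total s c with h | h
    · exact (hF0 s h).ge
    · exact hF0 c le_rfl ▸ hmono _ _ h
  refine ⟨F, contDiff_infty_iff_deriv.2 ⟨fun s => (hFd s).differentiableAt, hFd' ▸ hfs⟩,
    fun s hs => ⟨hF0 s hs, hFd' ▸ hf0 s hs⟩, fun s hs => ?_, fun s => hFd' ▸ hfl s,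
    fun s hs => hFd' ▸ hf1 s hs, fun s => ?_, fun s hs => ?_, hFn⟩
  · rw [hFd']
    exact Real.smoothTransition.pos_of_pos (div_pos (by linarith) hl)
  · rcases le_total s (c + l) with h | h
    · linarith [hFn s]
    · have h1 : F s - F (c + l) = s - (c + l) := by
        rw [hsub, intervalIntegral.integral_congr (g := fun _ => 1)]
        · simp
        intro t ht
        rw [uIcc_of_le h] at ht
        exact hf1 t ht.1
      linarith [hFn (c + l)]
  · have := hlip c s hs
    rw [hF0 c le_rfl] at this
    linarith

end OuterProfile

section HamiltonianGradient

variable {V : Type*} [NormedAddCommGroup V] [InnerProductSpace ℝ V] [FiniteDimensional ℝ V]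

theorem contDiff_inner_clm_self (W : V →L[ℝ] V) : ContDiff ℝ ∞ fun x => (inner ℝ (W x) x : ℝ) :=
  W.contDiff.inner ℝ contDiff_id

theorem hasFDerivAt_inner_clm_self {W : V →L[ℝ] V}
    (hW : ∀ y z, inner ℝ (W y) z = (inner ℝ y (W z) : ℝ)) (x : V) :
    HasFDerivAt (fun x => (inner ℝ (W x) x : ℝ)) (innerSL ℝ ((2 : ℝ) • W x)) x := by
  have := (W.hasFDerivAt (x := x)).inner ℝ (hasFDerivAt_id x)
  convert! this using 1
  ext v
  simp [hW v x, real_inner_comm v]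
  ring

/-- The gradient of `H₁ + F ∘ q` for a quadratic form `q x = ⟨W x, x⟩` is Lipschitz and at bounded
distance from the gradient of `q`. -/
theorem exists_gradient_add_comp_quadratic {W : V →L[ℝ] V}
    (hW : ∀ y z, inner ℝ (W y) z = (inner ℝ y (W z) : ℝ)) {w : ℝ} (hw : 0 < w)
    (hWw : ∀ z, w * ‖z‖ ^ 2 ≤ inner ℝ (W z) z) {H₁ : V → ℝ} (hH₁ : ContDiff ℝ ∞ H₁) {r : ℝ}
    (hr : ∀ x, r < ‖x‖ → fderiv ℝ H₁ x = 0) {F : ℝ → ℝ} (hF : ContDiff ℝ ∞ F) {c : ℝ}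
    (hF1 : ∀ s, c ≤ s → deriv F s = 1) :
    ∃ (g : V → V) (K B : ℝ), 0 ≤ K ∧
      (∀ x, HasFDerivAt (fun x => H₁ x + F (inner ℝ (W x) x)) (innerSL ℝ (g x)) x) ∧
      (∀ x y, ‖g x - g y‖ ≤ K * ‖x - y‖) ∧ (∀ x, ‖g x - (2 : ℝ) • W x‖ ≤ B) ∧
      ∀ x v, inner ℝ (g x) v =
        fderiv ℝ H₁ x v + deriv F (inner ℝ (W x) x) * (2 * inner ℝ (W x) v) := by
  obtain ⟨T, hT⟩ : ∃ T : (V →L[ℝ] ℝ) →L[ℝ] V, ∀ f v, inner ℝ (T f) v = f v :=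
    ⟨LinearMap.toContinuousLinearMap
      { toFun := (InnerProductSpace.toDual ℝ V).symm
        map_add' := map_add _
        map_smul' := fun a f => by simp },
      fun f v => InnerProductSpace.toDual_symm_apply⟩
  set H : V → ℝ := fun x => H₁ x + F (inner ℝ (W x) x) with hH
  have hHs : ContDiff ℝ ∞ H := hH₁.add (hF.comp (contDiff_inner_clm_self W))
  set G : V → ℝ := fun x => H x - inner ℝ (W x) x with hG
  have hGs : ContDiff ℝ ∞ G := hHs.sub (contDiff_inner_clm_self W)
  have hHd : ∀ x, HasFDerivAt H
      (fderiv ℝ H₁ x + deriv F (inner ℝ (W x) x) • innerSL ℝ ((2 : ℝ) • W x)) x := fun x =>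
    (hH₁.differentiable (by simp) x).hasFDerivAt.add
      ((hF.differentiable (by simp) _).hasDerivAt.comp_hasFDerivAt x
        (hasFDerivAt_inner_clm_self hW x))
  have hGd : ∀ x, fderiv ℝ G x = fderiv ℝ H x - innerSL ℝ ((2 : ℝ) • W x) := fun x =>
    ((hHd x).differentiableAt.hasFDerivAt.sub (hasFDerivAt_inner_clm_self hW x)).fderiv
  have hgs : ContDiff ℝ 1 (fun x => T (fderiv ℝ G x)) := by
    have h1 : ContDiff ℝ 1 (fderiv ℝ G) := (contDiff_infty_iff_fderiv.1 hGs).2.of_le (by simp)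
    exact T.contDiff.comp h1
  have hgc : HasCompactSupport fun x => T (fderiv ℝ G x) := by
    refine HasCompactSupport.intro (isCompact_closedBall 0 (max r √(c / w))) fun x hx => ?_
    rw [mem_closedBall_zero_iff, not_le, max_lt_iff] at hx
    have h1 : c ≤ inner ℝ (W x) x := by
      refine le_trans ?_ (hWw x)
      have := (Real.lt_sq_of_sqrt_lt hx.2).le
      rw [div_le_iff₀ hw] at this
      linarith
    rw [hGd, (hHd x).fderiv, hr x hx.1, hF1 _ h1]
    simp
  obtain ⟨K, hK⟩ := hgs.lipschitzWith_of_hasCompactSupport hgc (by simp)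
  obtain ⟨B, hB⟩ := hgc.exists_bound_of_continuous hgs.continuous
  have hg2 : ∀ x, T (fderiv ℝ H x) = T (fderiv ℝ G x) + (2 : ℝ) • W x := fun x => by
    refine ext_inner_right ℝ fun v => ?_
    rw [inner_add_left, hT, hT, hGd, sub_apply, innerSL_apply_apply, sub_add_cancel]
  refine ⟨fun x => T (fderiv ℝ H x), K + 2 * ‖W‖, B, by positivity, fun x => ?_, fun x y => ?_,
    fun x => ?_, fun x v => ?_⟩
  · have h : innerSL ℝ (T (fderiv ℝ H x)) = fderiv ℝ H x := by
      ext v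
      exact hT _ v
    rw [h]
    exact (hHd x).differentiableAt.hasFDerivAt
  · simp only [hg2]
    have h1 := hK.norm_sub_le x y
    have h2 : ‖(2 : ℝ) • W (x - y)‖ ≤ 2 * (‖W‖ * ‖x - y‖) := by
      rw [norm_smul, Real.norm_eq_abs, abs_two]
      gcongr
      exact W.le_opNorm _
    calc _ = ‖(T (fderiv ℝ G x) - T (fderiv ℝ G y)) + (2 : ℝ) • W (x - y)‖ := by
          rw [map_sub]; congr 1; module
      _ ≤ K * ‖x - y‖ + 2 * (‖W‖ * ‖x - y‖) := (norm_add_le _ _).trans (add_le_add h1 h2)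
      _ = _ := by ring
  · simp only [hg2, add_sub_cancel_right]
    exact hB x
  · rw [hT, (hHd x).fderiv]
    simp

end HamiltonianGradient

section OrbitDichotomy

variable {V : Type*} [NormedAddCommGroup V] [InnerProductSpace ℝ V] {J : V →L[ℝ] V}

theorem integral_comp_int_mul_of_periodic {f : ℝ → ℝ} (hf : Continuous f)
    (hp : Function.Periodic f 1) {k : ℤ} (hk : k ≠ 0) :
    ∫ t in (0 : ℝ)..1, f (k * t) = ∫ t in (0 : ℝ)..1, f t := by
  have hk' : (k : ℝ) ≠ 0 := Int.cast_ne_zero.2 hk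
  have h1 := hp.intervalIntegral_add_zsmul_eq k 0 fun a b => hf.intervalIntegrable a b
  simp only [zero_add, zsmul_eq_mul, mul_one] at h1
  rw [intervalIntegral.integral_comp_mul_left (fun t => f t) hk', mul_zero, mul_one, h1,
    smul_eq_mul, inv_mul_cancel_left₀ hk']

theorem IsOrthogonalComplexStructure.exists_int_of_rot_eq_self
    (hJ : IsOrthogonalComplexStructure J) {a : ℝ} {w : V} (hw : w ≠ 0) (h : rot J a w = w) :
    ∃ k : ℤ, a = 2 * π * k := by
  have h1 : Real.cos a = 1 := by
    have h2 := congrArg (fun v => inner ℝ v w) h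
    simp only [rot_apply, inner_add_left, inner_smul_left, real_inner_comm w (J w),
      real_inner_self_eq_norm_sq] at h2
    rw [hJ.inner_self_apply] at h2
    have h3 : ‖w‖ ^ 2 ≠ 0 := by simpa using hw
    simpa [h3] using h2
  obtain ⟨k, hk⟩ := (Real.cos_eq_one_iff a).1 h1
  exact ⟨k, by linarith⟩

variable [FiniteDimensional ℝ V]

/-- A Hamiltonian flow line of the shell Hamiltonian. -/
theorem IsSymplecticEmbedding.hasDerivAt_rot_orbit
    {A : Set V} {φ : V → V} (hφ : IsSymplecticEmbedding J A φ)
    (hJ : IsOrthogonalComplexStructure J)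
    {H : V → ℝ} (hH : Differentiable ℝ H) {ψ : ℝ → ℝ} (hψ : Differentiable ℝ ψ)
    (hHφ : ∀ w ∈ A, H (φ w) = ψ (‖w‖ ^ 2)) {g : V → V}
    (hg : ∀ w ∈ A, ∀ v, inner ℝ (g (φ w)) v = fderiv ℝ H (φ w) v) {w : V}
    (hw : ∀ y : V, ‖y‖ = ‖w‖ → y ∈ A) (a t : ℝ) (ha : a = 2 * deriv ψ (‖w‖ ^ 2)) :
    g (φ (rot J (a * t) w)) =
        -(a • J (fderiv ℝ φ (rot J (a * t) w) (J (rot J (a * t) w)))) ∧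
    HasDerivAt (fun t => φ (rot J (a * t) w)) (J (g (φ (rot J (a * t) w)))) t := by
  set y := rot J (a * t) w
  have hyn : ‖y‖ = ‖w‖ := hJ.norm_rot _ _
  have hy : y ∈ A := hw y hyn
  have hc : ∀ w ∈ A, (fderiv ℝ H (φ w)).comp (fderiv ℝ φ w) =
      fderiv ℝ (fun w : V => ψ (‖w‖ ^ 2)) w := by
    intro w hw
    have h1 := ((hH (φ w)).hasFDerivAt.comp w (hφ.hasFDerivAt hw)).fderiv
    rw [← h1]
    refine Filter.EventuallyEq.fderiv_eq ?_
    filter_upwards [hφ.isOpen.mem_nhds hw] with z hz using hHφ z hz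
  have h1 : g (φ y) = -(a • J (fderiv ℝ φ y (J y))) := by
    refine ext_inner_right ℝ fun v => ?_
    rw [hg y hy, hφ.fderiv_apply_of_comp_eq hJ hψ hc hy, hyn, ← ha, inner_neg_left,
      inner_smul_left, real_inner_comm]
    simp
  refine ⟨h1, ?_⟩
  rw [h1, map_neg, map_smul, hJ.apply_apply, smul_neg, neg_neg, ← map_smul]
  exact (hφ.hasFDerivAt hy).comp_hasDerivAt t (hJ.hasDerivAt_rot a t w)

theorem IsSymplecticEmbedding.orbit_dichotomy
    (hJ : IsOrthogonalComplexStructure J) (hV : 3 ≤ Module.finrank ℝ V)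
    {a b : ℝ} (ha : 0 ≤ a) {φ : V → V} (hφ : IsSymplecticEmbedding J (sqShell V a b) φ)
    {D : Set V} (hφD : MapsTo φ (sqShell V a b) D) {p q M : ℝ} (hp : a < p) (hq : q < b)
    {ψ : ℝ → ℝ} (hψ : Differentiable ℝ ψ) {H₁ : V → ℝ} (hH₁ : ContDiff ℝ ∞ H₁)
    (hHφ : ∀ w ∈ sqShell V a b, H₁ (φ w) = ψ (‖w‖ ^ 2))
    (hH0 : ∀ x, x ∉ φ '' closedSqShell V p q → fderiv ℝ H₁ x = 0 ∧ (H₁ x = 0 ∨ H₁ x = M))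
    (hHM : ∀ x, x ∉ D → H₁ x = M)
    {W : V →L[ℝ] V} (hW : ∀ y z, inner ℝ (W y) z = (inner ℝ y (W z) : ℝ))
    (hWJ : ∀ v, W (J v) = J (W v)) {F : ℝ → ℝ} {c : ℝ}
    (hF0 : ∀ s ≤ c, F s = 0 ∧ deriv F s = 0) (hDW : ∀ x ∈ D, inner ℝ (W x) x ≤ c)
    {g : V → V} {K : ℝ} (hK : 0 ≤ K) (hgK : ∀ x y, ‖g x - g y‖ ≤ K * ‖x - y‖)
    (hg : ∀ x v, inner ℝ (g x) v =
        fderiv ℝ H₁ x v + deriv F (inner ℝ (W x) x) * (2 * inner ℝ (W x) v))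
    {x : ℝ → V} (hx : ∀ t, HasDerivAt x (J (g (x t))) t) (hx1 : ∀ t, x (t + 1) = x t) {v : ℝ}
    (hv : ∫ t in (0 : ℝ)..1, (inner ℝ (g (x t)) (x t) / 2 -
      (H₁ (x t) + F (inner ℝ (W (x t)) (x t)))) = v) :
    (∃ (k : ℤ) (s : ℝ), s ∈ Icc p q ∧ deriv ψ s = k * π ∧ v = k * π * s - ψ s) ∨
      v = 0 ∨ v = -M ∨
      ∃ Y, c < Y ∧ (∀ t, inner ℝ (W (x t)) (x t) = Y) ∧
        (∀ t, HasDerivAt x ((2 * deriv F Y) • J (W (x t))) t) ∧ v = deriv F Y * Y - F Y - M := by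
  set A := sqShell V a b
  have hKA : closedSqShell V p q ⊆ A := closedSqShell_subset_sqShell hp hq
  by_cases hmeet : ∃ t₁, x t₁ ∈ φ '' closedSqShell V p q
  · left
    obtain ⟨t₁, w₁, hw₁, hxw⟩ := hmeet
    set α := 2 * deriv ψ (‖w₁‖ ^ 2)
    set w := rot J (-(α * t₁)) w₁
    have hwn : ‖w‖ = ‖w₁‖ := hJ.norm_rot _ _
    have hsph : ∀ y : V, ‖y‖ = ‖w‖ → y ∈ A := fun y hy => by
      have := hKA hw₁
      simp only [A, sqShell, mem_ofPred_eq, hy, hwn] at this ⊢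
      exact this
    have hgA : ∀ w ∈ A, ∀ v, inner ℝ (g (φ w)) v = fderiv ℝ H₁ (φ w) v := fun w hw v => by
      rw [hg, (hF0 _ (hDW _ (hφD hw))).2, zero_mul, add_zero]
    have horb := fun t => hφ.hasDerivAt_rot_orbit hJ (hH₁.differentiable (by simp)) hψ hHφ hgA hsph
      α t (by rw [hwn])
    have hlip : LipschitzWith (‖J‖₊ * ⟨K, hK⟩) fun y => J (g y) :=
      J.lipschitz.comp (LipschitzWith.of_dist_le_mul fun y z => by
        rw [dist_eq_norm, dist_eq_norm]; exact hgK y z)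
    have heq : x = fun t => φ (rot J (α * t) w) :=
      ODE_solution_unique_univ (v := fun _ y => J (g y)) (s := fun _ => univ)
        (t₀ := t₁) (fun _ => hlip.lipschitzOnWith) (fun t => ⟨hx t, mem_univ _⟩)
        (fun t => ⟨(horb t).2, mem_univ _⟩) (by
          have : rot J (α * t₁) w = w₁ := by
            simpa [w] using hJ.rot_neg_rot (-(α * t₁)) w₁
          rw [this, hxw])
    have hw0 : w ≠ 0 := fun h => by
      have h1 := hw₁.1
      rw [← hwn, h, norm_zero] at h1
      nlinarith
    have hper : rot J α w = w := by
      have h1 := hx1 0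
      rw [heq] at h1
      simp only [zero_add, mul_one, mul_zero, rot_zero] at h1
      exact hφ.injOn (hsph _ (hJ.norm_rot _ _)) (hsph _ rfl) h1
    obtain ⟨k, hk⟩ := hJ.exists_int_of_rot_eq_self hw0 hper
    have hkψ : deriv ψ (‖w₁‖ ^ 2) = k * π := by
      simp only [α] at hk
      linarith
    refine ⟨k, ‖w₁‖ ^ 2, hw₁, hkψ, ?_⟩
    set f : ℝ → ℝ := fun t => -inner ℝ (φ (rot J (2 * π * t) w))
      (J (fderiv ℝ φ (rot J (2 * π * t) w) (J (rot J (2 * π * t) w))))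
    have hfper : Function.Periodic f 1 := fun t => by
      have : rot J (2 * π * (t + 1)) w = rot J (2 * π * t) w := by
        rw [← rot_add_int_mul_two_pi (2 * π * t) 1 w]
        congr 2
        push_cast
        ring
      simp only [f, this]
    have hrot : Continuous fun t : ℝ => rot J (2 * π * t) w :=
      continuous_iff_continuousAt.2 fun t => (hJ.hasDerivAt_rot (2 * π) t w).continuousAt
    have hfc : Continuous f := continuous_iff_continuousAt.2 fun t => by
      have hA := hsph _ (hJ.norm_rot (2 * π * t) w)
      have h1 : ContinuousAt (fun t : ℝ => φ (rot J (2 * π * t) w)) t :=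
        ContinuousAt.comp (g := φ) (hφ.contDiffAt hA).continuousAt hrot.continuousAt
      have h2 : ContinuousAt (fun t : ℝ => fderiv ℝ φ (rot J (2 * π * t) w)) t :=
        ContinuousAt.comp (g := fderiv ℝ φ)
          (((hφ.contDiffAt hA).fderiv_right (m := 0) (by simp)).continuousAt) hrot.continuousAt
      have h3 : ContinuousAt (fun t : ℝ => J (rot J (2 * π * t) w)) t :=
        (J.continuous.comp hrot).continuousAt
      exact (h1.inner (J.continuous.continuousAt.comp (h2.clm_apply h3))).neg
    have hHopf : ∫ t in (0 : ℝ)..1, f t = ‖w₁‖ ^ 2 := by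
      rw [← hwn]
      exact hφ.integral_hopf_circle hJ hV hsph
    have hIntg : ∀ t : ℝ, inner ℝ (g (x t)) (x t) / 2 - (H₁ (x t) + F (inner ℝ (W (x t)) (x t))) =
        k * π * f (k * t) - ψ (‖w₁‖ ^ 2) := by
      intro t
      have hA : rot J (α * t) w ∈ A := hsph _ (hJ.norm_rot _ _)
      have hat : α * t = 2 * π * (k * t) := by rw [hk]; ring
      simp only [heq]
      rw [(hF0 _ (hDW _ (hφD hA))).1, hHφ _ hA, hJ.norm_rot, hwn, (horb t).1, inner_neg_left,
        inner_smul_left, real_inner_comm, hat, hk]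
      simp only [f, conj_trivial]
      ring
    rw [← hv]
    simp_rw [hIntg]
    have hfk : Continuous fun t : ℝ => k * π * f (k * t) := by fun_prop
    rw [intervalIntegral.integral_sub (hfk.intervalIntegrable _ _) (by simp), intervalIntegral.integral_const_mul]
    rcases eq_or_ne k 0 with hk0 | hk0
    · simp [hk0]
    · rw [integral_comp_int_mul_of_periodic hfc hfper hk0, hHopf]
      simp
  · right
    push Not at hmeet
    have hgx : ∀ t, g (x t) = (2 * deriv F (inner ℝ (W (x t)) (x t))) • W (x t) := fun t => by
      refine ext_inner_right ℝ fun v => ?_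
      rw [hg, (hH0 _ (hmeet t)).1, inner_smul_left]
      simp
      ring
    have hxd : ∀ t, HasDerivAt x ((2 * deriv F (inner ℝ (W (x t)) (x t))) • J (W (x t))) t :=
      fun t => by simpa only [hgx, map_smul] using hx t
    have hqd : ∀ t, HasDerivAt (fun t => (inner ℝ (W (x t)) (x t) : ℝ)) 0 t := fun t => by
      have := (hasFDerivAt_inner_clm_self hW (x t)).comp_hasDerivAt t (hxd t)
      convert! this using 1
      simp [hJ.inner_self_apply]
    have hconst : ∀ t, inner ℝ (W (x t)) (x t) = (inner ℝ (W (x 0)) (x 0) : ℝ) := fun t =>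
      is_const_of_deriv_eq_zero (fun t => (hqd t).differentiableAt) (fun t => (hqd t).deriv) t 0
    set Y : ℝ := inner ℝ (W (x 0)) (x 0)
    have hIntg : ∀ t : ℝ, inner ℝ (g (x t)) (x t) / 2 - (H₁ (x t) + F (inner ℝ (W (x t)) (x t))) =
        deriv F Y * Y - F Y - H₁ (x t) := by
      intro t
      rw [hgx, inner_smul_left, hconst]
      simp
      ring
    rw [← hv]
    simp_rw [hIntg]
    rcases le_or_gt Y c with hY | hY
    · have hx0 : ∀ t, x t = x 0 := fun t =>
        is_const_of_deriv_eq_zero (fun t => (hxd t).differentiableAt)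
          (fun t => by rw [(hxd t).deriv, hconst, (hF0 _ hY).2]; simp) t 0
      simp_rw [hx0, hF0 _ hY]
      rcases (hH0 _ (hmeet 0)).2 with h | h
      · left; simp [h]
      · right; left; simp [h]
    · right; right
      have hM : ∀ t, H₁ (x t) = M := fun t => hHM _ fun h => by
        have := hDW _ h
        rw [hconst] at this
        linarith
      refine ⟨Y, hY, hconst, fun t => ?_, ?_⟩
      · have := hxd t
        rwa [hconst] at this
      · simp [hM]

end OrbitDichotomy

section LinkingGeometry

variable {V : Type*} [NormedAddCommGroup V] [InnerProductSpace ℝ V]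
  {J : V →L[ℝ] V} {m : ℕ}

theorem norm_trigLoop_le_sum (hJ : IsOrthogonalComplexStructure J) (c : TrigLoopSpace V m)
    (t : ℝ) : ‖trigLoop J c t‖ ≤ ∑ k : Freq m, ‖c k‖ :=
  (norm_sum_le _ _).trans_eq (Finset.sum_congr rfl fun _ _ => hJ.norm_rot _ _)

/-- Loops with finitely many modes are controlled by the number of modes. -/
theorem norm_trigLoop_le_of_support (hJ : IsOrthogonalComplexStructure J)
    (c : TrigLoopSpace V m) {S : Finset ℤ} (hS : ∀ k : Freq m, (k : ℤ) ∉ S → c k = 0) (t : ℝ) :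
    ‖trigLoop J c t‖ ≤ S.card * ‖c‖ := by
  refine (norm_trigLoop_le_sum hJ c t).trans ?_
  have h1 : ∀ k : Freq m, ‖c k‖ ≤ if (k : ℤ) ∈ S then ‖c‖ else 0 := by
    intro k
    split_ifs with hk
    · exact PiLp.norm_apply_le c k
    · rw [hS k hk, norm_zero]
  refine (Finset.sum_le_sum fun k _ => h1 k).trans ?_
  rw [Finset.sum_coe_sort (Finset.Icc (-(m : ℤ)) m) fun k => if k ∈ S then ‖c‖ else 0,
    Finset.sum_ite_mem, Finset.sum_const, nsmul_eq_mul]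
  gcongr
  exact Finset.inter_subset_right

variable [FiniteDimensional ℝ V]

open scoped Classical in
/-- The projection of trigonometric loops onto the modes in `S`. -/
def modeProj (S : Set ℤ) : TrigLoopSpace V m →L[ℝ] TrigLoopSpace V m :=
  LinearMap.toContinuousLinearMap
    { toFun := fun c => WithLp.toLp 2 fun k => if (k : ℤ) ∈ S then c k else 0
      map_add' := fun c d => by
        ext k
        by_cases hk : (k : ℤ) ∈ S <;> simp [hk]
      map_smul' := fun s c => by
        ext k
        by_cases hk : (k : ℤ) ∈ S <;> simp [hk] }

open scoped Classical in
theorem modeProj_apply (S : Set ℤ) (c : TrigLoopSpace V m) (k : Freq m) :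
    modeProj S c k = if (k : ℤ) ∈ S then c k else 0 := rfl

theorem modeProj_apply_of_mem {S : Set ℤ} (c : TrigLoopSpace V m) {k : Freq m}
    (hk : (k : ℤ) ∈ S) : modeProj S c k = c k := by rw [modeProj_apply, if_pos hk]

theorem modeProj_apply_of_notMem {S : Set ℤ} (c : TrigLoopSpace V m) {k : Freq m}
    (hk : (k : ℤ) ∉ S) : modeProj S c k = 0 := by rw [modeProj_apply, if_neg hk]

theorem modeProj_modeProj (S : Set ℤ) (c : TrigLoopSpace V m) :
    modeProj S (modeProj S c) = modeProj S c := by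
  ext k
  by_cases hk : (k : ℤ) ∈ S
  · rw [modeProj_apply_of_mem _ hk]
  · rw [modeProj_apply_of_notMem _ hk, modeProj_apply_of_notMem _ hk]

theorem apply_eq_zero_of_modeProj_eq_self {S : Set ℤ} {c : TrigLoopSpace V m}
    (h : modeProj S c = c) {k : Freq m} (hk : (k : ℤ) ∉ S) : c k = 0 := by
  rw [← h, modeProj_apply_of_notMem _ hk]

theorem loopAction_le_sum (hJ : IsOrthogonalComplexStructure J) {H : V → ℝ} (hH : Continuous H)
    {W : V →L[ℝ] V} (hWJ : ∀ v, W (J v) = J (W v)) {b : ℝ}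
    (hb : ∀ z, inner ℝ (W z) z - b ≤ H z) (c : TrigLoopSpace V m) :
    loopAction J H c
      ≤ ∑ k : Freq m, (π * ((k : ℤ) : ℝ) * ‖c k‖ ^ 2 - inner ℝ (W (c k)) (c k)) + b := by
  have hx := continuous_trigLoop (J := J) c
  have h2 : Continuous fun t => inner ℝ (W (trigLoop J c t)) (trigLoop J c t) := by fun_prop
  have h1 : ∫ t in (0 : ℝ)..1, (inner ℝ (W (trigLoop J c t)) (trigLoop J c t) - b)
      ≤ ∫ t in (0 : ℝ)..1, H (trigLoop J c t) :=
    intervalIntegral.integral_mono zero_le_one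
      ((h2.sub continuous_const).intervalIntegrable _ _)
      ((hH.comp hx).intervalIntegrable _ _) fun t => hb _
  rw [intervalIntegral.integral_sub (h2.intervalIntegrable _ _)
    (continuous_const.intervalIntegrable _ _), integral_inner_trigLoop hJ hWJ] at h1
  simp only [intervalIntegral.integral_const, sub_zero, one_smul] at h1
  rw [loopAction, Finset.sum_sub_distrib, Finset.mul_sum]
  simp only [← mul_assoc]
  linarith

theorem sum_le_loopAction (hJ : IsOrthogonalComplexStructure J) {H : V → ℝ} (hH : Continuous H)
    {W : V →L[ℝ] V} (hWJ : ∀ v, W (J v) = J (W v)) {b : ℝ}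
    (hb : ∀ z, H z ≤ inner ℝ (W z) z + b) (c : TrigLoopSpace V m) :
    ∑ k : Freq m, (π * ((k : ℤ) : ℝ) * ‖c k‖ ^ 2 - inner ℝ (W (c k)) (c k)) - b
      ≤ loopAction J H c := by
  have hx := continuous_trigLoop (J := J) c
  have h2 : Continuous fun t => inner ℝ (W (trigLoop J c t)) (trigLoop J c t) := by fun_prop
  have h1 : ∫ t in (0 : ℝ)..1, H (trigLoop J c t)
      ≤ ∫ t in (0 : ℝ)..1, (inner ℝ (W (trigLoop J c t)) (trigLoop J c t) + b) :=
    intervalIntegral.integral_mono zero_le_one ((hH.comp hx).intervalIntegrable _ _)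
      ((h2.add continuous_const).intervalIntegrable _ _) fun t => hb _
  rw [intervalIntegral.integral_add (h2.intervalIntegrable _ _)
    (continuous_const.intervalIntegrable _ _), integral_inner_trigLoop hJ hWJ] at h1
  simp only [intervalIntegral.integral_const, sub_zero, one_smul] at h1
  rw [loopAction, Finset.sum_sub_distrib, Finset.mul_sum]
  simp only [← mul_assoc]
  linarith

/-- A Hamiltonian vanishing near the origin has positive action on small spheres of positive
modes, uniformly in the number of modes. -/
theorem exists_pi_mul_sq_le_loopAction (hJ : IsOrthogonalComplexStructure J) {H : V → ℝ}
    (hH : Continuous H) {C β : ℝ} (hC : 0 ≤ C) (hβ : 0 < β) (hHC : ∀ z, H z ≤ C * ‖z‖ ^ 2)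
    (hH0 : ∀ z, ‖z‖ < β → H z ≤ 0) :
    ∃ ϱ : ℝ, 0 < ϱ ∧ ∀ (m : ℕ) (c : TrigLoopSpace V m), (∀ k : Freq m, (k : ℤ) < 1 → c k = 0) →
      ‖c‖ = ϱ → π * ϱ ^ 2 ≤ loopAction J H c := by
  obtain ⟨N, hN⟩ := exists_nat_gt (4 * C / π)
  have hN' : 4 * C < π * N := by
    rw [div_lt_iff₀ pi_pos] at hN
    linarith
  have hN0 : (0 : ℝ) < N := lt_of_le_of_lt (by positivity) hN
  refine ⟨β / (2 * N), by positivity, fun m c hc hcϱ => ?_⟩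
  set l : TrigLoopSpace V m := modeProj {k | k ≤ N} c with hl
  set h : TrigLoopSpace V m := modeProj {k | (N : ℤ) < k} c with hh
  have hlk : ∀ k : Freq m, l k = if (k : ℤ) ≤ N then c k else 0 := fun k => by
    by_cases hk : (k : ℤ) ≤ N
    · rw [if_pos hk]; exact modeProj_apply_of_mem c hk
    · rw [if_neg hk]; exact modeProj_apply_of_notMem c hk
  have hhk : ∀ k : Freq m, h k = if (k : ℤ) ≤ N then 0 else c k := fun k => by
    by_cases hk : (k : ℤ) ≤ N
    · rw [if_pos hk]; exact modeProj_apply_of_notMem c (not_lt.2 hk)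
    · rw [if_neg hk]; exact modeProj_apply_of_mem c (not_le.1 hk)
  have hsum : c = l + h := by
    ext k
    rw [PiLp.add_apply, hlk, hhk]
    split_ifs <;> simp
  have hln : ‖l‖ ≤ β / (2 * N) := by
    rw [← hcϱ]
    refine le_of_sq_le_sq ?_ (norm_nonneg _)
    rw [PiLp.norm_sq_eq_of_L2, PiLp.norm_sq_eq_of_L2]
    refine Finset.sum_le_sum fun k _ => ?_
    rw [hlk]
    split_ifs
    · rfl
    · simp
  have hlt : ∀ t, ‖trigLoop J l t‖ ≤ β / 2 := by
    intro t
    refine (norm_trigLoop_le_of_support hJ l (S := Finset.Icc 1 (N : ℤ)) ?_ t).trans ?_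
    · intro k hk
      rw [hlk]
      split_ifs with hkN
      · refine hc k ?_
        by_contra h1
        exact hk (Finset.mem_Icc.2 ⟨not_lt.1 h1, hkN⟩)
      · rfl
    · simp only [Int.card_Icc, add_sub_cancel_right, Int.toNat_natCast]
      calc (N : ℝ) * ‖l‖ ≤ N * (β / (2 * N)) := by gcongr
        _ = β / 2 := by field_simp
  have hpt : ∀ t, H (trigLoop J c t) ≤ 4 * C * ‖trigLoop J h t‖ ^ 2 := by
    intro t
    rcases lt_or_ge ‖trigLoop J c t‖ β with h1 | h1
    · exact (hH0 _ h1).trans (by positivity)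
    · refine (hHC _).trans ?_
      have h2 : ‖trigLoop J c t‖ ≤ ‖trigLoop J l t‖ + ‖trigLoop J h t‖ := by
        rw [hsum, trigLoop_add]
        exact norm_add_le _ _
      have h3 : ‖trigLoop J c t‖ ≤ 2 * ‖trigLoop J h t‖ := by
        have := hlt t
        linarith
      calc C * ‖trigLoop J c t‖ ^ 2 ≤ C * (2 * ‖trigLoop J h t‖) ^ 2 := by gcongr
        _ = 4 * C * ‖trigLoop J h t‖ ^ 2 := by ring
  have hx := continuous_trigLoop (J := J) c
  have hxh := continuous_trigLoop (J := J) h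
  have hIntg : ∫ t in (0 : ℝ)..1, H (trigLoop J c t) ≤ 4 * C * ‖h‖ ^ 2 := by
    rw [← integral_norm_sq_trigLoop hJ h, ← intervalIntegral.integral_const_mul]
    exact intervalIntegral.integral_mono zero_le_one ((hH.comp hx).intervalIntegrable _ _)
      ((continuous_const.mul (hxh.norm.pow 2)).intervalIntegrable _ _) hpt
  have hfin : π * ‖c‖ ^ 2 + 4 * C * ‖h‖ ^ 2 ≤ π * ∑ k : Freq m, ((k : ℤ) : ℝ) * ‖c k‖ ^ 2 := by
    rw [PiLp.norm_sq_eq_of_L2, PiLp.norm_sq_eq_of_L2, Finset.mul_sum, Finset.mul_sum,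
      Finset.mul_sum, ← Finset.sum_add_distrib]
    refine Finset.sum_le_sum fun k _ => ?_
    rw [hhk]
    rcases lt_or_ge (k : ℤ) 1 with hk | hk
    · simp [hc k hk]
    split_ifs with hkN
    · have : (1 : ℝ) ≤ ((k : ℤ) : ℝ) := by exact_mod_cast hk
      simp only [norm_zero, ne_eq, OfNat.ofNat_ne_zero, not_false_eq_true, zero_pow, mul_zero,
        add_zero]
      have h2 : ‖c k‖ ^ 2 ≤ ((k : ℤ) : ℝ) * ‖c k‖ ^ 2 := le_mul_of_one_le_left (by positivity) this
      gcongr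
    · have h1 : (N : ℝ) + 1 ≤ ((k : ℤ) : ℝ) := by exact_mod_cast not_le.1 hkN
      have h2 : π + 4 * C ≤ π * ((k : ℤ) : ℝ) := by nlinarith [pi_pos]
      nlinarith [sq_nonneg ‖c k‖]
  rw [loopAction]
  rw [hcϱ] at hfin
  linarith

/-- On a large sphere of loops with modes at most `1`, either the lower modes are large or the loop
spends most of its time away from the origin. -/
theorem loopAction_le_of_norm_eq (hJ : IsOrthogonalComplexStructure J) {H : V → ℝ}
    (hH : Continuous H) {w b M T L : ℝ}
    (hb : ∀ z, w * ‖z‖ ^ 2 - b ≤ H z) (hbT : ∀ z, T ≤ ‖z‖ → w * ‖z‖ ^ 2 - b + M ≤ H z)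
    (hL : (T + √(M / π)) ^ 2 + M / π ≤ L ^ 2) (hm : 1 ≤ m) {c : TrigLoopSpace V m}
    (hc : ∀ k : Freq m, 1 < (k : ℤ) → c k = 0) (hcL : ‖c‖ = L) :
    loopAction J H c ≤ (π - w) * L ^ 2 + b - M := by
  have h1m : (1 : ℤ) ∈ Finset.Icc (-(m : ℤ)) m := Finset.mem_Icc.2 ⟨by omega, by exact_mod_cast hm⟩
  set o : Freq m := ⟨1, h1m⟩ with ho
  set y : TrigLoopSpace V m := modeProj {k | k < 1} c with hy
  have hx := continuous_trigLoop (J := J) c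
  have hxy := continuous_trigLoop (J := J) y
  have hyk : ∀ k : Freq m, (k : ℤ) ≠ 1 → y k = c k := fun k hk => by
    rcases lt_or_gt_of_ne hk with h | h
    · exact modeProj_apply_of_mem c h
    · rw [hc k h]; exact modeProj_apply_of_notMem c (not_lt.2 h.le)
  have hyo : y o = 0 := modeProj_apply_of_notMem c (lt_irrefl (1 : ℤ))
  have hko : ∀ k : Freq m, k ≠ o → (k : ℤ) ≠ 1 := fun k hk h => hk (Subtype.ext h)
  have hnorm : ‖c‖ ^ 2 = ‖y‖ ^ 2 + ‖c o‖ ^ 2 := by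
    rw [PiLp.norm_sq_eq_of_L2, PiLp.norm_sq_eq_of_L2, ← Finset.sum_erase_add _ _ (Finset.mem_univ o),
      ← Finset.sum_erase_add _ (fun k => ‖y k‖ ^ 2) (Finset.mem_univ o), hyo, norm_zero]
    rw [Finset.sum_congr rfl fun k hk => by rw [← hyk k (hko k (Finset.ne_of_mem_erase hk))]]
    ring
  have hquad : π * ∑ k : Freq m, ((k : ℤ) : ℝ) * ‖c k‖ ^ 2 ≤ π * ‖c o‖ ^ 2 := by
    refine mul_le_mul_of_nonneg_left ?_ pi_pos.le
    rw [← Finset.sum_erase_add _ _ (Finset.mem_univ o)]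
    have h1 : ∑ k ∈ Finset.univ.erase o, ((k : ℤ) : ℝ) * ‖c k‖ ^ 2 ≤ 0 := by
      refine Finset.sum_nonpos fun k hk => ?_
      have hk1 := hko k (Finset.ne_of_mem_erase hk)
      rcases lt_or_gt_of_ne hk1 with h | h
      · refine mul_nonpos_of_nonpos_of_nonneg ?_ (sq_nonneg _)
        exact_mod_cast Int.lt_add_one_iff.1 h
      · simp [hc k h]
    simp only [ho, Int.cast_one, one_mul] at h1 ⊢
    linarith
  have hxsum : ∀ t, trigLoop J c t = rot J (2 * π * t) (c o) + trigLoop J y t := by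
    intro t
    rw [trigLoop, trigLoop, ← Finset.add_sum_erase _ _ (Finset.mem_univ o),
      ← Finset.add_sum_erase _ (fun k : Freq m => rot J (2 * π * ((k : ℤ) : ℝ) * t) (y k))
        (Finset.mem_univ o), hyo, map_zero, zero_add]
    rw [Finset.sum_congr rfl fun k hk => by rw [← hyk k (hko k (Finset.ne_of_mem_erase hk))]]
    simp [ho]
  have hn := integral_norm_sq_trigLoop hJ c
  have hny := integral_norm_sq_trigLoop hJ y
  have hi := (hH.comp hx).intervalIntegrable (μ := volume) 0 1
  rw [hcL] at hnorm hn
  rw [loopAction, sub_mul]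
  have hpi : π * L ^ 2 = π * ‖y‖ ^ 2 + π * ‖c o‖ ^ 2 := by rw [hnorm, mul_add]
  have c3 : Continuous fun t => w * ‖trigLoop J c t‖ ^ 2 - b := by fun_prop
  have c4 : Continuous fun t => w * ‖trigLoop J c t‖ ^ 2 := by fun_prop
  rcases le_or_gt M (π * ‖y‖ ^ 2) with hcase | hcase
  · have h1 : ∫ t in (0 : ℝ)..1, (w * ‖trigLoop J c t‖ ^ 2 - b)
        ≤ ∫ t in (0 : ℝ)..1, H (trigLoop J c t) :=
      intervalIntegral.integral_mono zero_le_one (c3.intervalIntegrable _ _) hi fun t => hb _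
    rw [intervalIntegral.integral_sub (c4.intervalIntegrable _ _)
      (continuous_const.intervalIntegrable _ _), intervalIntegral.integral_const_mul, hn] at h1
    simp only [intervalIntegral.integral_const, sub_zero, one_smul] at h1
    linarith
  · have hM0 : 0 < M := lt_of_le_of_lt (by positivity) hcase
    have hs0 : 0 < √(M / π) := Real.sqrt_pos.2 (by positivity)
    have hss : √(M / π) ^ 2 = M / π := Real.sq_sqrt (by positivity)
    have hy2 : ‖y‖ ^ 2 < M / π := by rwa [lt_div_iff₀ pi_pos, mul_comm]
    have ha : T + √(M / π) ≤ ‖c o‖ := le_of_sq_le_sq (by linarith) (norm_nonneg _)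
    have hpt : ∀ t, w * ‖trigLoop J c t‖ ^ 2 - b + M - π * ‖trigLoop J y t‖ ^ 2
        ≤ H (trigLoop J c t) := by
      intro t
      rcases le_or_gt T ‖trigLoop J c t‖ with h1 | h1
      · have := hbT _ h1
        have h2 : 0 ≤ π * ‖trigLoop J y t‖ ^ 2 := by positivity
        linarith
      · have h2 : ‖c o‖ ≤ ‖trigLoop J c t‖ + ‖trigLoop J y t‖ := by
          rw [← hJ.norm_rot (2 * π * t) (c o), ← sub_eq_iff_eq_add.2 (hxsum t)]
          exact norm_sub_le _ _
        have h3 : √(M / π) ≤ ‖trigLoop J y t‖ := by linarith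
        have h4 : M / π ≤ ‖trigLoop J y t‖ ^ 2 := by
          rw [← hss]
          gcongr
        rw [div_le_iff₀ pi_pos] at h4
        linarith [hb (trigLoop J c t)]
    have c1 : Continuous fun t => w * ‖trigLoop J c t‖ ^ 2 - b + M := by fun_prop
    have c2 : Continuous fun t => π * ‖trigLoop J y t‖ ^ 2 := by fun_prop
    have h1 : ∫ t in (0 : ℝ)..1,
          (w * ‖trigLoop J c t‖ ^ 2 - b + M - π * ‖trigLoop J y t‖ ^ 2)
        ≤ ∫ t in (0 : ℝ)..1, H (trigLoop J c t) :=
      intervalIntegral.integral_mono zero_le_one ((c1.sub c2).intervalIntegrable _ _) hi hpt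
    rw [intervalIntegral.integral_sub (c1.intervalIntegrable _ _) (c2.intervalIntegrable _ _),
      intervalIntegral.integral_add (c3.intervalIntegrable _ _)
        (continuous_const.intervalIntegrable _ _),
      intervalIntegral.integral_sub (c4.intervalIntegrable _ _)
        (continuous_const.intervalIntegrable _ _),
      intervalIntegral.integral_const_mul, intervalIntegral.integral_const_mul, hn, hny] at h1
    simp only [intervalIntegral.integral_const, sub_zero, one_smul] at h1
    linarith

end LinkingGeometry

section LinkingOrbits

/-- The trigonometric loop with the single mode `1` and coefficient `u`. -/
def firstMode {V : Type*} [NormedAddCommGroup V] (m : ℕ) (u : V) : TrigLoopSpace V m :=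
  WithLp.toLp 2 fun k => if (k : ℤ) = 1 then u else 0

theorem firstMode_apply {V : Type*} [NormedAddCommGroup V] {m : ℕ} (u : V) (k : Freq m) :
    firstMode m u k = if (k : ℤ) = 1 then u else 0 := rfl

variable {V : Type*} [NormedAddCommGroup V] [InnerProductSpace ℝ V] [FiniteDimensional ℝ V]
  {J : V →L[ℝ] V} {m : ℕ}

theorem firstMode_ne_zero (hm : 1 ≤ m) {u : V} (hu : u ≠ 0) : firstMode m u ≠ 0 := by
  intro h
  have h1 : (1 : ℤ) ∈ Finset.Icc (-(m : ℤ)) m :=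
    Finset.mem_Icc.2 ⟨by omega, by exact_mod_cast hm⟩
  have h2 := congrArg (fun c : TrigLoopSpace V m => c ⟨1, h1⟩) h
  exact hu (by simpa [firstMode_apply] using h2)

theorem modeProj_firstMode {S : Set ℤ} (hS : (1 : ℤ) ∈ S) (u : V) :
    modeProj S (firstMode m u) = firstMode m u := by
  ext k
  by_cases hk : (k : ℤ) ∈ S
  · rw [modeProj_apply_of_mem _ hk]
  · rw [modeProj_apply_of_notMem _ hk, firstMode_apply, if_neg]
    rintro h
    exact hk (h ▸ hS)

theorem apply_of_modeProj_eq_smul_firstMode {S : Set ℤ} {c : TrigLoopSpace V m} {s : ℝ} {u : V}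
    (h : modeProj S c = s • firstMode m u) {k : Freq m} (hk : (k : ℤ) ∈ S) :
    c k = if (k : ℤ) = 1 then s • u else 0 := by
  rw [← modeProj_apply_of_mem c hk, h, PiLp.smul_apply, firstMode_apply]
  split_ifs <;> simp

variable {H : V → ℝ} {g : V → V} {K : ℝ}

theorem exists_almost_critical_of_small_sphere (hJ : IsOrthogonalComplexStructure J) (hK : 0 ≤ K)
    (hH : ∀ x, HasFDerivAt H (innerSL ℝ (g x)) x) (hg : ∀ x y, ‖g x - g y‖ ≤ K * ‖x - y‖)
    {W : V →L[ℝ] V} (hWJ : ∀ v, W (J v) = J (W v)) (hW0 : ∀ z, 0 ≤ inner ℝ (W z) z) {u : V}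
    (hu : u ≠ 0) (hWu : π * ‖u‖ ^ 2 ≤ inner ℝ (W u) u) {b : ℝ}
    (hb : ∀ z, inner ℝ (W z) z - b ≤ H z) (hH0 : ∀ z, 0 ≤ H z) {C β : ℝ} (hC : 0 ≤ C)
    (hβ : 0 < β) (hHC : ∀ z, H z ≤ C * ‖z‖ ^ 2) (hHβ : ∀ z, ‖z‖ < β → H z ≤ 0) :
    ∃ α : ℝ, 0 < α ∧ ∀ m : ℕ, 1 ≤ m → ∃ c : TrigLoopSpace V m, α ≤ loopAction J H c ∧
      loopAction J H c ≤ b ∧ ‖loopActionGrad J g c‖ ≤ 1 / (m : ℝ) := by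
  have hHc : Continuous H := continuous_iff_continuousAt.2 fun x => (hH x).continuousAt
  obtain ⟨ϱ, hϱ, hS⟩ := exists_pi_mul_sq_le_loopAction hJ hHc hC hβ hHC hHβ
  have hα : 0 < π * ϱ ^ 2 := by positivity
  refine ⟨π * ϱ ^ 2, hα, fun m hm => ?_⟩
  refine exists_almost_critical_of_linking (Φ := loopAction J H) (g := loopActionGrad J g)
    (hasFDerivAt_loopAction hJ hK hH hg) (norm_loopActionGrad_sub_le hJ hK hg)
    (modeProj {k | 1 ≤ k}) (modeProj_modeProj _) (e := firstMode m u)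
    (modeProj_firstMode (le_refl (1 : ℤ)) u) (firstMode_ne_zero hm hu) hϱ ?_ ?_ ?_
    (by positivity)
  · intro c hc hcn
    exact hS m c (fun k hk => apply_eq_zero_of_modeProj_eq_self hc (not_le.2 hk)) hcn
  · intro c s hs hc
    refine (loopAction_le_sum hJ hHc hWJ hb c).trans ?_
    refine add_le_of_nonpos_left (Finset.sum_nonpos fun k _ => ?_)
    rcases lt_or_ge (k : ℤ) 1 with hk | hk
    · have h1 : ((k : ℤ) : ℝ) ≤ 0 := by exact_mod_cast Int.lt_add_one_iff.1 hk
      have h2 := hW0 (c k)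
      have h3 : π * ((k : ℤ) : ℝ) * ‖c k‖ ^ 2 ≤ 0 :=
        mul_nonpos_of_nonpos_of_nonneg (mul_nonpos_of_nonneg_of_nonpos pi_pos.le h1)
          (sq_nonneg _)
      linarith
    · rw [apply_of_modeProj_eq_smul_firstMode hc hk]
      split_ifs with hk1
      · rw [hk1, map_smul, real_inner_smul_left, real_inner_smul_right, norm_smul, mul_pow,
          Real.norm_eq_abs, sq_abs]
        have := mul_le_mul_of_nonneg_left hWu (sq_nonneg s)
        push_cast
        linarith
      · simp
  · intro c hc
    refine lt_of_le_of_lt ?_ hα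
    have h := loopAction_le_sum hJ hHc (W := 0) (b := 0) (by simp) (by simpa using hH0) c
    refine h.trans ?_
    rw [add_zero]
    refine Finset.sum_nonpos fun k _ => ?_
    rcases lt_or_ge (k : ℤ) 1 with hk | hk
    · have h1 : ((k : ℤ) : ℝ) ≤ 0 := by exact_mod_cast Int.lt_add_one_iff.1 hk
      have h3 : π * ((k : ℤ) : ℝ) * ‖c k‖ ^ 2 ≤ 0 :=
        mul_nonpos_of_nonpos_of_nonneg (mul_nonpos_of_nonneg_of_nonpos pi_pos.le h1)
          (sq_nonneg _)
      simpa using h3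
    · have h4 := modeProj_apply_of_mem (S := {k | 1 ≤ k}) c hk
      rw [hc] at h4
      simp [← h4]

theorem exists_almost_critical_of_large_sphere (hJ : IsOrthogonalComplexStructure J) (hK : 0 ≤ K)
    (hH : ∀ x, HasFDerivAt H (innerSL ℝ (g x)) x) (hg : ∀ x y, ‖g x - g y‖ ≤ K * ‖x - y‖)
    {w b M T L : ℝ} (hL0 : 0 < L) (hb : ∀ z, w * ‖z‖ ^ 2 - b ≤ H z)
    (hbT : ∀ z, T ≤ ‖z‖ → w * ‖z‖ ^ 2 - b + M ≤ H z)
    (hL : (T + √(M / π)) ^ 2 + M / π ≤ L ^ 2)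
    {W : V →L[ℝ] V} (hWJ : ∀ v, W (J v) = J (W v)) (hW2 : ∀ z, inner ℝ (W z) z ≤ 2 * π * ‖z‖ ^ 2)
    {u : V} (hu : u ≠ 0) (hWu : inner ℝ (W u) u ≤ π * ‖u‖ ^ 2) {b₁ : ℝ}
    (hb₁ : ∀ z, H z ≤ inner ℝ (W z) z + b₁) {b₂ : ℝ} (hb₂ : ∀ z, H z ≤ 2 * π * ‖z‖ ^ 2 + b₂)
    (hlt : (π - w) * L ^ 2 + b - M < -b₂) {m : ℕ} (hm : 1 ≤ m) :
    ∃ c : TrigLoopSpace V m, -b₁ ≤ loopAction J H c ∧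
      loopAction J H c ≤ (π - w) * L ^ 2 + b - M ∧ ‖loopActionGrad J g c‖ ≤ 1 / (m : ℝ) := by
  have hHc : Continuous H := continuous_iff_continuousAt.2 fun x => (hH x).continuousAt
  obtain ⟨c, h1, h2, h3⟩ := exists_almost_critical_of_linking (Φ := fun c => -loopAction J H c)
    (g := fun c : TrigLoopSpace V m => -loopActionGrad J g c)
    (fun c => by
      rw [map_neg]
      exact (hasFDerivAt_loopAction hJ hK hH hg c).fun_neg)
    (fun c d => by
      rw [neg_sub_neg, ← norm_neg, neg_sub]
      exact norm_loopActionGrad_sub_le hJ hK hg c d)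
    (modeProj {k | k ≤ 1}) (modeProj_modeProj _) (e := firstMode m u)
    (modeProj_firstMode (le_refl (1 : ℤ)) u) (firstMode_ne_zero hm hu)
    (α := -((π - w) * L ^ 2 + b - M)) (β := b₁) hL0
    (fun c hc hcn => neg_le_neg (loopAction_le_of_norm_eq hJ hHc hb hbT hL hm
      (fun k hk => apply_eq_zero_of_modeProj_eq_self hc (not_le.2 hk)) hcn))
    (fun c s hs hc => by
      have h := sum_le_loopAction hJ hHc hWJ hb₁ c
      have h0 : 0 ≤ ∑ k : Freq m, (π * ((k : ℤ) : ℝ) * ‖c k‖ ^ 2 - inner ℝ (W (c k)) (c k)) := by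
        refine Finset.sum_nonneg fun k _ => ?_
        rcases le_or_gt (k : ℤ) 1 with hk | hk
        · rw [apply_of_modeProj_eq_smul_firstMode hc hk]
          split_ifs with hk1
          · rw [hk1, map_smul, real_inner_smul_left, real_inner_smul_right, norm_smul, mul_pow,
              Real.norm_eq_abs, sq_abs]
            have := mul_le_mul_of_nonneg_left hWu (sq_nonneg s)
            push_cast
            linarith
          · simp
        · have h1 : (2 : ℝ) ≤ ((k : ℤ) : ℝ) := by exact_mod_cast hk
          have h2 := hW2 (c k)
          nlinarith [mul_nonneg (mul_nonneg pi_pos.le (sub_nonneg.2 h1)) (sq_nonneg ‖c k‖)]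
      linarith)
    (fun c hc => by
      have h := sum_le_loopAction hJ hHc (W := (2 * π) • ContinuousLinearMap.id ℝ V) (b := b₂)
        (by simp) (by simpa [real_inner_smul_left] using hb₂) c
      have h0 : 0 ≤ ∑ k : Freq m, (π * ((k : ℤ) : ℝ) * ‖c k‖ ^ 2 -
          inner ℝ (((2 * π) • ContinuousLinearMap.id ℝ V) (c k)) (c k)) := by
        refine Finset.sum_nonneg fun k _ => ?_
        rcases le_or_gt (k : ℤ) 1 with hk | hk
        · have h4 := modeProj_apply_of_mem (S := {k | k ≤ 1}) c hk
          rw [hc] at h4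
          simp [← h4]
        · have h1 : (2 : ℝ) ≤ ((k : ℤ) : ℝ) := by exact_mod_cast hk
          simp only [_root_.smul_apply, ContinuousLinearMap.id_apply,
            real_inner_smul_left, real_inner_self_eq_norm_sq]
          nlinarith [mul_nonneg (mul_nonneg pi_pos.le (sub_nonneg.2 h1)) (sq_nonneg ‖c k‖)]
      linarith)
    (δ := 1 / (m : ℝ)) (by positivity)
  exact ⟨c, by linarith, by linarith, by simpa using h3⟩

end LinkingOrbits

section ShellHamiltonian

variable {V : Type*} [NormedAddCommGroup V] [InnerProductSpace ℝ V]

theorem IsOrthogonalComplexStructure.eq_rot_of_hasDerivAt {J : V →L[ℝ] V}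
    (hJ : IsOrthogonalComplexStructure J) {x : ℝ → V} {θ : ℝ}
    (hx : ∀ t, HasDerivAt x (θ • J (x t)) t) (t : ℝ) : x t = rot J (θ * t) (x 0) := by
  have hd : ∀ s, HasDerivAt (fun s => ‖x s - rot J (θ * s) (x 0)‖ ^ 2) 0 s := fun s => by
    have h := ((hx s).fun_sub (hJ.hasDerivAt_rot θ s (x 0))).norm_sq
    rwa [← smul_sub, ← map_sub, real_inner_smul_right, hJ.inner_self_apply, mul_zero,
      mul_zero] at h
  have h1 := is_const_of_deriv_eq_zero (fun s => (hd s).differentiableAt)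
    (fun s => (hd s).deriv) t 0
  simpa [sub_eq_zero] using h1

/-- A Hamiltonian which is a function of the radius on the image of a symplectic shell, vanishes on
the hole `Z` and equals `M` outside of the domain `D`. -/
structure IsShellHamiltonian (J : V →L[ℝ] V) (a b p q M : ℝ) (φ : V → V) (D Z : Set V) (ψ : ℝ → ℝ)
    (H : V → ℝ) : Prop where
  nonneg : 0 ≤ a
  lt_inner : a < p
  outer_lt : q < b
  isSymplecticEmbedding : IsSymplecticEmbedding J (sqShell V a b) φ
  mapsTo : MapsTo φ (sqShell V a b) D
  isBounded : IsBounded D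
  differentiable_profile : Differentiable ℝ ψ
  contDiff : ContDiff ℝ ∞ H
  apply_image : ∀ w ∈ sqShell V a b, H (φ w) = ψ (‖w‖ ^ 2)
  locally_const : ∀ x, x ∉ φ '' closedSqShell V p q → fderiv ℝ H x = 0 ∧ (H x = 0 ∨ H x = M)
  eq_of_notMem : ∀ x, x ∉ D → H x = M
  eq_zero_of_mem : ∀ x ∈ Z, H x = 0
  mem_Icc : ∀ x, H x ∈ Icc 0 M

namespace IsShellHamiltonian

variable [FiniteDimensional ℝ V] {J : V →L[ℝ] V} {a b p q M : ℝ} {φ : V → V} {D Z : Set V}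
  {ψ : ℝ → ℝ} {H : V → ℝ}

/-- The values of almost critical sequences of the action functional of a shell Hamiltonian with
quadratic growth at infinity. -/
theorem exists_action_value (h : IsShellHamiltonian J a b p q M φ D Z ψ H)
    (hJ : IsOrthogonalComplexStructure J) (hV : 3 ≤ Module.finrank ℝ V)
    {W : V →L[ℝ] V} (hW : ∀ y z, inner ℝ (W y) z = (inner ℝ y (W z) : ℝ))
    (hWJ : ∀ v, W (J v) = J (W v)) {w : ℝ} (hw : 0 < w)
    (hWw : ∀ z, w * ‖z‖ ^ 2 ≤ inner ℝ (W z) z) {d : ℝ} (hd : 0 < d)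
    (hnr : ∀ (k : ℤ) (v : V), d * ‖v‖ ≤ ‖(2 * π * (k : ℝ)) • v - (2 : ℝ) • W v‖)
    {F : ℝ → ℝ} (hF : ContDiff ℝ ∞ F) {c c' : ℝ} (hF0 : ∀ s ≤ c, F s = 0 ∧ deriv F s = 0)
    (hF1 : ∀ s, c' ≤ s → deriv F s = 1) (hDW : ∀ x ∈ D, inner ℝ (W x) x ≤ c) :
    ∃ (g : V → V) (K : ℝ), 0 ≤ K ∧
      (∀ x, HasFDerivAt (fun x => H x + F (inner ℝ (W x) x)) (innerSL ℝ (g x)) x) ∧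
      (∀ x y, ‖g x - g y‖ ≤ K * ‖x - y‖) ∧
      ∀ α β : ℝ, (∀ m : ℕ, 1 ≤ m → ∃ l : TrigLoopSpace V m,
        α ≤ loopAction J (fun x => H x + F (inner ℝ (W x) x)) l ∧
        loopAction J (fun x => H x + F (inner ℝ (W x) x)) l ≤ β ∧
        ‖loopActionGrad J g l‖ ≤ 1 / (m : ℝ)) →
      ∃ v ∈ Icc α β, (∃ (k : ℤ) (s : ℝ), s ∈ Icc p q ∧ deriv ψ s = k * π ∧ v = k * π * s - ψ s) ∨
        v = 0 ∨ v = -M ∨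
        ∃ Y, c < Y ∧ v = deriv F Y * Y - F Y - M ∧ ∃ x : ℝ → V, (∀ t, x (t + 1) = x t) ∧
          (∀ t, inner ℝ (W (x t)) (x t) = Y) ∧
          ∀ t, HasDerivAt x ((2 * deriv F Y) • J (W (x t))) t := by
  obtain ⟨r, hr⟩ := h.isBounded.exists_norm_le
  have hDr : ∀ x, r < ‖x‖ → fderiv ℝ H x = 0 := fun x hx => by
    refine (h.locally_const x ?_).1
    rintro ⟨y, hy, rfl⟩
    exact absurd (hr _ (h.mapsTo (closedSqShell_subset_sqShell h.lt_inner h.outer_lt hy)))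
      (not_le.2 hx)
  obtain ⟨g, K, B, hK, hg, hgK, hB, hgi⟩ :=
    exists_gradient_add_comp_quadratic hW hw hWw h.contDiff hDr hF hF1
  refine ⟨g, K, hK, hg, hgK, fun α β hc => ?_⟩
  have hHc : Continuous fun x => H x + F (inner ℝ (W x) x) :=
    continuous_iff_continuousAt.2 fun x => (hg x).continuousAt
  obtain ⟨x, hx, hx1, hv⟩ :=
    exists_periodic_orbit_of_almost_critical hJ hK hHc hgK hWJ hB hd hnr hc
  refine ⟨_, hv, ?_⟩
  rcases h.isSymplecticEmbedding.orbit_dichotomy hJ hV h.nonneg h.mapsTo h.lt_inner h.outer_lt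
    h.differentiable_profile h.contDiff h.apply_image h.locally_const h.eq_of_notMem hW hWJ hF0 hDW
    hK hgK hgi hx hx1 rfl with h1 | h1 | h1 | ⟨Y, hY, hxY, hxd, hYv⟩
  · exact Or.inl h1
  · exact Or.inr (Or.inl h1)
  · exact Or.inr (Or.inr (Or.inl h1))
  · exact Or.inr (Or.inr (Or.inr ⟨Y, hY, hYv, x, hx1, hxY, hxd⟩))

/-- A shell Hamiltonian has a one-periodic orbit of small positive action if the hole contains a
neighbourhood of the origin. -/
theorem exists_small_action_value (h : IsShellHamiltonian J a b p q M φ D Z ψ H)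
    (hJ : IsOrthogonalComplexStructure J) (hV : 3 ≤ Module.finrank ℝ V)
    {W : V →L[ℝ] V} (hW : ∀ y z, inner ℝ (W y) z = (inner ℝ y (W z) : ℝ))
    (hWJ : ∀ v, W (J v) = J (W v)) {w : ℝ} (hw : 0 < w)
    (hWw : ∀ z, w * ‖z‖ ^ 2 ≤ inner ℝ (W z) z) {d : ℝ} (hd : 0 < d)
    (hnr : ∀ (k : ℤ) (v : V), d * ‖v‖ ≤ ‖(2 * π * (k : ℝ)) • v - (2 : ℝ) • W v‖)
    {u : V} (hu : u ≠ 0) (hWu : π * ‖u‖ ^ 2 ≤ inner ℝ (W u) u) {B : ℝ} (hB : 0 ≤ B)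
    (hDW : ∀ x ∈ D, inner ℝ (W x) x ≤ B) (hBM : B + 1 ≤ M) {β : ℝ} (hβ : 0 < β)
    (hβZ : ball (0 : V) β ⊆ Z) (hZD : Z ⊆ D) :
    ∃ (k : ℤ) (s : ℝ), s ∈ Icc p q ∧ deriv ψ s = k * π ∧ 0 < k * π * s - ψ s ∧
      k * π * s - ψ s ≤ B := by
  obtain ⟨F, hF, hF0, -, hFle, hF1, hFge, hFc, hFn⟩ := exists_outer_profile (M - 1) one_pos
  have hDW' : ∀ x ∈ D, inner ℝ (W x) x ≤ M - 1 := fun x hx => (hDW x hx).trans (by linarith)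
  have hM : 1 ≤ M := by linarith
  have hW0 : ∀ z, 0 ≤ inner ℝ (W z) z := fun z => le_trans (by positivity) (hWw z)
  obtain ⟨g, K, hK, hg, hgK, hcrit⟩ := h.exists_action_value hJ hV hW hWJ hw hWw hd hnr hF hF0 hF1
    hDW'
  have hFq : ∀ z, F (inner ℝ (W z) z) ≤ ‖W‖ * ‖z‖ ^ 2 := fun z => by
    rcases le_total (inner ℝ (W z) z) (M - 1) with h1 | h1
    · rw [(hF0 _ h1).1]
      positivity
    · calc F (inner ℝ (W z) z) ≤ inner ℝ (W z) z - (M - 1) := hFc _ h1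
        _ ≤ inner ℝ (W z) z := by linarith
        _ ≤ ‖W z‖ * ‖z‖ := real_inner_le_norm _ _
        _ ≤ ‖W‖ * ‖z‖ * ‖z‖ := by gcongr; exact W.le_opNorm z
        _ = ‖W‖ * ‖z‖ ^ 2 := by ring
  obtain ⟨α, hα, hcr⟩ := exists_almost_critical_of_small_sphere hJ hK hg hgK hWJ hW0 hu hWu (b := B)
    (fun z => by
      by_cases hz : z ∈ D
      · have h1 := hDW z hz
        have h2 := (h.mem_Icc z).1
        have h3 := hFn (inner ℝ (W z) z)
        linarith
      · rw [h.eq_of_notMem z hz]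
        have h3 := hFge (inner ℝ (W z) z)
        linarith)
    (fun z => add_nonneg (h.mem_Icc z).1 (hFn _)) (C := M / β ^ 2 + ‖W‖) (by positivity) hβ
    (fun z => by
      rw [add_mul]
      refine add_le_add ?_ (hFq z)
      rcases lt_or_ge ‖z‖ β with h1 | h1
      · rw [h.eq_zero_of_mem z (hβZ (mem_ball_zero_iff.2 h1))]
        positivity
      · refine (h.mem_Icc z).2.trans ?_
        rw [div_mul_eq_mul_div, le_div_iff₀ (by positivity)]
        gcongr)
    (fun z hz => by
      have h1 := hβZ (mem_ball_zero_iff.2 hz)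
      rw [h.eq_zero_of_mem z h1, (hF0 _ (hDW' z (hZD h1))).1, add_zero])
  obtain ⟨v, ⟨hv1, hv2⟩, hv⟩ := hcrit α B hcr
  rcases hv with ⟨k, s, hs, hk, rfl⟩ | rfl | rfl | ⟨Y, hY, rfl, -⟩
  · exact ⟨k, s, hs, hk, by linarith, hv2⟩
  · linarith
  · linarith
  · have h1 := hFge Y
    have h2 := mul_le_mul_of_nonneg_right (hFle Y) (by linarith : 0 ≤ Y)
    linarith

/-- A shell Hamiltonian has a one-periodic orbit whose action is controlled from above by the size
of the domain and from below by the size of the hole. -/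
theorem exists_large_action_value (h : IsShellHamiltonian J a b p q M φ D Z ψ H)
    (hJ : IsOrthogonalComplexStructure J) (hV : 3 ≤ Module.finrank ℝ V) {T : ℝ} (hT : 0 < T)
    (hDT : ∀ x ∈ D, ‖x‖ ≤ T) (hDT' : ∀ x, ‖x‖ = T → x ∉ D) (hZD : Z ⊆ D)
    {W : V →L[ℝ] V} (hWJ : ∀ v, W (J v) = J (W v))
    (hW1 : ∀ z, π * ‖z‖ ^ 2 ≤ inner ℝ (W z) z) (hW2 : ∀ z, inner ℝ (W z) z ≤ 2 * π * ‖z‖ ^ 2)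
    {u : V} (hu : u ≠ 0) (hWu : inner ℝ (W u) u ≤ π * ‖u‖ ^ 2) {A₁ A₂ A₃ : ℝ} (hA₁ : 0 < A₁)
    (hA₁T : A₁ ≤ π * T ^ 2) (hZ₁ : ∀ z, z ∉ Z → A₁ ≤ inner ℝ (W z) z)
    (hZ₂ : ∀ z, z ∉ Z → A₂ ≤ 2 * π * ‖z‖ ^ 2) (hTA : π * T ^ 2 < A₃) (hA : A₃ < A₂)
    (hA₂T : A₂ ≤ 2 * π * T ^ 2) (hAM : A₂ ≤ M) :
    ∃ (k : ℤ) (s : ℝ), s ∈ Icc p q ∧ deriv ψ s = k * π ∧ A₁ ≤ k * π * s - ψ s + M ∧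
      k * π * s - ψ s + M ≤ A₃ := by
  have hπ := Real.pi_pos
  have hM : 0 < M := by linarith [mul_pos hπ (pow_pos hT 2)]
  set L := √((T + √(M / π)) ^ 2 + M / π) with hL
  have hL2 : L ^ 2 = (T + √(M / π)) ^ 2 + M / π := Real.sq_sqrt (by positivity)
  have hL0 : 0 < L := Real.sqrt_pos.2 (by positivity)
  set ν := min (π / 2) ((A₃ - π * T ^ 2) / L ^ 2) with hν
  have hν0 : 0 < ν := lt_min (by positivity) (div_pos (by linarith) (by positivity))
  have hνπ : ν < π := (min_le_left _ _).trans_lt (by linarith)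
  have hνL : ν * L ^ 2 ≤ A₃ - π * T ^ 2 :=
    (le_div_iff₀ (by positivity)).1 (min_le_right _ _)
  set w := π - ν with hw
  have hw0 : 0 < w := by linarith
  obtain ⟨F, hF, hF0, hFpos, hFle, hF1, hFge, hFc, hFn⟩ :=
    exists_outer_profile (w * T ^ 2) (l := ν * T ^ 2) (by positivity)
  set I : V →L[ℝ] V := w • ContinuousLinearMap.id ℝ V with hI
  have hIz : ∀ z, I z = w • z := fun z => rfl
  have hIq : ∀ z, inner ℝ (I z) z = w * ‖z‖ ^ 2 := fun z => by
    rw [hIz, real_inner_smul_left, real_inner_self_eq_norm_sq]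
  obtain ⟨d, hd, hdn⟩ := exists_nonresonance (w := w) fun k hk => by
    have h1 : 0 < (k : ℝ) * π := by rw [← hk]; exact hw0
    have h2 : (k : ℝ) * π < 1 * π := by rw [← hk]; linarith
    have h3 : (0 : ℝ) < k := pos_of_mul_pos_left h1 hπ.le
    have h4 : (k : ℝ) < 1 := lt_of_mul_lt_mul_right h2 hπ.le
    have h5 : (0 : ℤ) < k := by exact_mod_cast h3
    have h6 : k < (1 : ℤ) := by exact_mod_cast h4
    omega
  have hDI : ∀ x ∈ D, inner ℝ (I x) x ≤ w * T ^ 2 := fun x hx => by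
    rw [hIq]
    have := hDT x hx
    gcongr
  obtain ⟨g, K, hK, hg, hgK, hcrit⟩ := h.exists_action_value hJ hV (W := I)
    (fun y z => by rw [hIz, hIz, real_inner_smul_left, real_inner_smul_right])
    (fun v => by rw [hIz, hIz, map_smul]) hw0 (fun z => (hIq z).ge) hd
    (fun k v => by
      rw [hIz, smul_smul, ← sub_smul, norm_smul, Real.norm_eq_abs]
      exact mul_le_mul_of_nonneg_right (hdn k) (norm_nonneg v)) hF hF0 hF1 hDI
  have hout : ∀ z, T ≤ ‖z‖ → z ∉ D := fun z hz hzD =>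
    hDT' z (le_antisymm (hDT z hzD) hz) hzD
  have hFin : ∀ z, ‖z‖ ≤ T → F (inner ℝ (I z) z) = 0 := fun z hz => (hF0 _ (by
    rw [hIq]
    gcongr)).1
  have hFout : ∀ z, T ≤ ‖z‖ → F (inner ℝ (I z) z) ≤ π * ‖z‖ ^ 2 - π * T ^ 2 := fun z hz => by
    have h0 : T ^ 2 ≤ ‖z‖ ^ 2 := by gcongr
    have h1 := hFc (inner ℝ (I z) z) (by rw [hIq]; gcongr)
    rw [hIq] at h1 ⊢
    have h2 : w * (‖z‖ ^ 2 - T ^ 2) ≤ π * (‖z‖ ^ 2 - T ^ 2) :=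
      mul_le_mul_of_nonneg_right (by linarith) (by linarith)
    linarith
  have hcr := fun (m : ℕ) (hm : 1 ≤ m) => exists_almost_critical_of_large_sphere hJ hK hg hgK
    (w := w) (b := π * T ^ 2) (M := M) (T := T) hL0
    (fun z => by
      have h1 := (h.mem_Icc z).1
      have h2 := hFge (inner ℝ (I z) z)
      rw [hIq] at h2 ⊢
      linarith [sub_mul π ν (T ^ 2)])
    (fun z hz => by
      rw [h.eq_of_notMem z (hout z hz)]
      have h2 := hFge (inner ℝ (I z) z)
      rw [hIq] at h2 ⊢
      linarith [sub_mul π ν (T ^ 2)])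
    hL2.ge hWJ hW2 hu hWu (b₁ := M - A₁)
    (fun z => by
      by_cases hz : z ∈ Z
      · rw [h.eq_zero_of_mem z hz, hFin z (hDT z (hZD hz))]
        have h1 := hW1 z
        have h2 : 0 ≤ π * ‖z‖ ^ 2 := by positivity
        linarith
      · have h1 := (h.mem_Icc z).2
        rcases le_total ‖z‖ T with h2 | h2
        · rw [hFin z h2]
          linarith [hZ₁ z hz]
        · linarith [hFout z h2, hW1 z])
    (b₂ := M - A₂)
    (fun z => by
      by_cases hz : z ∈ Z
      · rw [h.eq_zero_of_mem z hz, hFin z (hDT z (hZD hz))]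
        have h2 : 0 ≤ 2 * π * ‖z‖ ^ 2 := by positivity
        linarith
      · have h1 := (h.mem_Icc z).2
        rcases le_total ‖z‖ T with h2 | h2
        · rw [hFin z h2]
          linarith [hZ₂ z hz]
        · have h3 : π * T ^ 2 ≤ π * ‖z‖ ^ 2 := by gcongr
          linarith [hFout z h2])
    (by rw [hw, sub_sub_cancel]; linarith) hm
  obtain ⟨v, ⟨hv1, hv2⟩, hv⟩ := hcrit _ _ hcr
  rw [hw, sub_sub_cancel] at hv2
  rcases hv with ⟨k, s, hs, hk, rfl⟩ | rfl | rfl | ⟨Y, hY, -, x, hx1, hxY, hxd⟩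
  · exact ⟨k, s, hs, hk, by linarith, by linarith⟩
  · linarith
  · linarith
  · exfalso
    have hx0 : x 0 ≠ 0 := fun h0 => by
      have h1 := hxY 0
      rw [h0, map_zero, inner_zero_left] at h1
      have h2 : 0 < w * T ^ 2 := by positivity
      linarith
    have hdF := hFpos Y hY
    set θ := 2 * deriv F Y * w with hθ
    have hxθ : ∀ t, HasDerivAt x (θ • J (x t)) t := fun t => by
      have := hxd t
      rwa [hIz, map_smul, smul_smul] at this
    have h1 : rot J θ (x 0) = x 0 := by
      have := hJ.eq_rot_of_hasDerivAt hxθ 1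
      rw [mul_one] at this
      rw [← this]
      simpa using hx1 0
    obtain ⟨k, hk⟩ := hJ.exists_int_of_rot_eq_self hx0 h1
    have h2 : 0 < θ := by positivity
    have h3 : θ < 2 * π := by
      have := hFle Y
      nlinarith
    have h4 : (0 : ℝ) < k := by
      rw [hk] at h2
      exact pos_of_mul_pos_right h2 (by positivity)
    have h5 : (k : ℝ) < 1 := by
      rw [hk] at h3
      exact lt_of_mul_lt_mul_left (by linarith) (by positivity : 0 ≤ 2 * π)
    have h6 : (0 : ℤ) < k := by exact_mod_cast h4
    have h7 : k < (1 : ℤ) := by exact_mod_cast h5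
    omega

end IsShellHamiltonian

end ShellHamiltonian

section EllipsoidalShellObstruction

variable {V : Type*} [NormedAddCommGroup V] [InnerProductSpace ℝ V] {J : V →L[ℝ] V}

/-- A quadratic form squeezed between two quadratic forms of ratio `R ^ 2`, each attaining the
extremal value on one complex line only. -/
structure IsEllipsoidalForm (J : V →L[ℝ] V) (R : ℝ) (u₁ u₂ : V) (Q : V → ℝ) : Prop where
  continuous : Continuous Q
  map_smul : ∀ (s : ℝ) x, Q (s • x) = s ^ 2 * Q x
  norm_left : ‖u₁‖ = 1
  norm_right : ‖u₂‖ = 1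
  lower_le : ∀ z, ‖planeProj J u₁ z‖ ^ 2 + ‖z - planeProj J u₁ z‖ ^ 2 / R ^ 2 ≤ Q z
  le_upper : ∀ z, Q z ≤ ‖planeProj J u₂ z‖ ^ 2 / R ^ 2 + ‖z - planeProj J u₂ z‖ ^ 2

namespace IsEllipsoidalForm

variable {R : ℝ} {u₁ u₂ : V} {Q : V → ℝ}

theorem norm_sq_le (h : IsEllipsoidalForm J R u₁ u₂ Q) (hJ : IsOrthogonalComplexStructure J)
    (hR : 1 < R) (z : V) : ‖z‖ ^ 2 ≤ R ^ 2 * Q z := by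
  have h1 := h.lower_le z
  have h2 : 0 < R := by linarith
  have h3 : 1 ≤ R ^ 2 := one_le_pow₀ hR.le
  rw [hJ.norm_sq_eq_add_planeProj h.norm_left z]
  calc _ ≤ R ^ 2 * ‖planeProj J u₁ z‖ ^ 2 + ‖z - planeProj J u₁ z‖ ^ 2 := by
        gcongr
        exact le_mul_of_one_le_left (sq_nonneg _) h3
    _ = R ^ 2 * (‖planeProj J u₁ z‖ ^ 2 + ‖z - planeProj J u₁ z‖ ^ 2 / R ^ 2) := by
        field_simp
    _ ≤ _ := by gcongr

theorem le_norm_sq (h : IsEllipsoidalForm J R u₁ u₂ Q) (hJ : IsOrthogonalComplexStructure J)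
    (hR : 1 < R) (z : V) : Q z ≤ ‖z‖ ^ 2 := by
  have h3 : 1 ≤ R ^ 2 := one_le_pow₀ hR.le
  refine (h.le_upper z).trans ?_
  rw [hJ.norm_sq_eq_add_planeProj h.norm_right z]
  gcongr
  exact div_le_self (sq_nonneg _) h3

theorem isBounded_lt (h : IsEllipsoidalForm J R u₁ u₂ Q) (hJ : IsOrthogonalComplexStructure J)
    (hR : 1 < R) (τ : ℝ) : IsBounded {z | Q z < τ} := by
  refine isBounded_iff_forall_norm_le.2 ⟨√(R ^ 2 * τ), fun z hz => Real.le_sqrt_of_sq_le ?_⟩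
  refine (h.norm_sq_le hJ hR z).trans ?_
  have : Q z < τ := hz
  gcongr

theorem isPreconnected_le (h : IsEllipsoidalForm J R u₁ u₂ Q) {σ : ℝ} (hσ : 0 ≤ σ) :
    IsPreconnected {z | Q z ≤ σ} := by
  have h0 : Q 0 = 0 := by simpa using h.map_smul 0 0
  have hs : StarConvex ℝ 0 {z | Q z ≤ σ} := by
    refine starConvex_zero_iff.2 fun x hx s hs0 hs1 => ?_
    have hx' : Q x ≤ σ := hx
    change Q (s • x) ≤ σ
    rw [h.map_smul]
    calc s ^ 2 * Q x ≤ s ^ 2 * σ := by gcongr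
      _ ≤ σ := mul_le_of_le_one_left hσ (pow_le_one₀ hs0 hs1)
  exact (hs.isPathConnected (by change Q 0 ≤ σ; rw [h0]; exact hσ)).isConnected.isPreconnected

variable [FiniteDimensional ℝ V]

theorem isPreconnected_compl_lt (h : IsEllipsoidalForm J R u₁ u₂ Q)
    (hJ : IsOrthogonalComplexStructure J) (hR : 1 < R) (hV : 2 ≤ Module.finrank ℝ V) {τ : ℝ}
    (hτ : 0 < τ) : IsPreconnected {z | Q z < τ}ᶜ := by
  have h1 : {z | Q z < τ}ᶜ = {z | τ ≤ Q z} := by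
    ext z
    simp
  rw [h1]
  refine isPreconnected_setOf_le_of_homogeneous hV h.continuous (fun x hx => ?_) h.map_smul hτ
  have h2 := h.norm_sq_le hJ hR x
  have h3 : 0 < ‖x‖ ^ 2 := by positivity
  exact pos_of_mul_pos_right (h3.trans_le h2) (sq_nonneg R)

variable [MeasurableSpace V] [BorelSpace V]

/-- A shell Hamiltonian together with the arithmetic of its actions. -/
theorem exists_shellHamiltonian (h : IsEllipsoidalForm J R u₁ u₂ Q)
    (hJ : IsOrthogonalComplexStructure J) (hR : 1 < R) (hV : 3 ≤ Module.finrank ℝ V) {σ τ : ℝ}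
    (hσ : 0 < σ) (hστ : σ < τ) {a b : ℝ} (ha : 0 ≤ a) {φ : V → V}
    (hφ : IsSymplecticEmbedding J (sqShell V a b) φ)
    (hφD : ∀ w ∈ sqShell V a b, σ < Q (φ w) ∧ Q (φ w) < τ) {p q e M₀ : ℝ} (hp : a < p)
    (hpq : p < q) (hq : q < b) (he : 0 < e)
    (hvol : volume.real {z | Q z < τ} - volume.real {z | Q z ≤ σ}
      < volume.real (ball (0 : V) √p)) :
    volume.real {z | Q z ≤ σ} ≤ volume.real (closedBall (0 : V) √q) ∧
    ∃ (M : ℝ) (H : V → ℝ) (ψ : ℝ → ℝ), M₀ ≤ M ∧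
      IsShellHamiltonian J a b p q M φ {z | Q z < τ} {z | Q z ≤ σ} ψ H ∧
      ∀ (k : ℤ) (s : ℝ), s ∈ Icc p q → deriv ψ s = k * π →
        (0 < k * π * s - ψ s → π * p - 3 * e ≤ k * π * s - ψ s) ∧
        (k * π * s - ψ s + M ≤ 2 * π * p - 3 * e → k * π * s - ψ s + M ≤ π * q + e) := by
  obtain ⟨M, ψ, hM₀, hM, hψ, hψ0, hψM, hψI, hval⟩ :=
    exists_profile (M₀ := M₀) (ha.trans_lt hp) hpq he
  have hb := h.isBounded_lt hJ hR τ
  have hφD' : MapsTo φ (sqShell V a b) {z | Q z < τ} := fun w hw => (hφD w hw).2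
  obtain ⟨hZ, H, hH, hHφ, hH0, hHM, hHZ, hHI⟩ := hφ.exists_shell_hamiltonian_of_hole hJ hV ha
    (D := {z | Q z < τ}) (Z := {z | Q z ≤ σ}) (isOpen_lt h.continuous continuous_const) hb
    (h.isPreconnected_compl_lt hJ hR (by omega) (hσ.trans hστ)) hφD'
    (fun z hz => lt_of_le_of_lt hz hστ) (isClosed_le h.continuous continuous_const)
    (h.isPreconnected_le hσ.le) (fun w hw => not_le.2 (hφD w hw).1) hp hpq.le hq hM hvol hψ hψ0 hψM
    hψI
  exact ⟨hZ, M, H, ψ, hM₀, ⟨ha, hp, hq, hφ, hφD', hb, hψ.differentiable (by simp), hH, hHφ, hH0,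
    hHM, hHZ, hHI⟩, hval⟩

end IsEllipsoidalForm

end EllipsoidalShellObstruction

section EllipsoidalShellNonembedding

variable {V : Type*} [NormedAddCommGroup V] [InnerProductSpace ℝ V] {J : V →L[ℝ] V}

namespace IsEllipsoidalForm

variable {R : ℝ} {u₁ u₂ : V} {Q : V → ℝ}

theorem inner_planeOp_left_le (h : IsEllipsoidalForm J R u₁ u₂ Q)
    (hJ : IsOrthogonalComplexStructure J) {c : ℝ} (hc : 0 ≤ c) (z : V) :
    inner ℝ (planeOp J u₁ c (c / R ^ 2) z) z ≤ c * Q z := by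
  rw [hJ.inner_planeOp_self h.norm_left]
  calc _ = c * (‖planeProj J u₁ z‖ ^ 2 + ‖z - planeProj J u₁ z‖ ^ 2 / R ^ 2) := by ring
    _ ≤ c * Q z := by gcongr; exact h.lower_le z

theorem le_inner_planeOp_right (h : IsEllipsoidalForm J R u₁ u₂ Q)
    (hJ : IsOrthogonalComplexStructure J) (hR : 1 < R) {c : ℝ} (hc : 0 ≤ c) (z : V) :
    c * R ^ 2 * Q z ≤ inner ℝ (planeOp J u₂ c (c * R ^ 2) z) z := by
  rw [hJ.inner_planeOp_self h.norm_right]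
  have hR0 : R ≠ 0 := by positivity
  calc c * R ^ 2 * Q z
      ≤ c * R ^ 2 * (‖planeProj J u₂ z‖ ^ 2 / R ^ 2 + ‖z - planeProj J u₂ z‖ ^ 2) := by
        gcongr; exact h.le_upper z
    _ = _ := by field_simp

theorem exists_planeOp_left_nonresonance (h : IsEllipsoidalForm J R u₁ u₂ Q)
    (hJ : IsOrthogonalComplexStructure J) {κ : ℝ} (hκ0 : 1 / 2 < κ) (hκ1 : κ < 1)
    (hκR : 1 < κ * R ^ 2) :
    ∃ d, 0 < d ∧ ∀ (k : ℤ) (v : V),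
      d * ‖v‖ ≤ ‖(2 * π * (k : ℝ)) • v - (2 : ℝ) • planeOp J u₁ (π / κ) (π / κ / R ^ 2) v‖ := by
  have hκ : 0 < κ := by linarith
  have hR : R ≠ 0 := by
    rintro rfl
    norm_num at hκR
  refine hJ.exists_planeOp_nonresonance h.norm_left (fun k hk => ?_) (fun k hk => ?_)
  · have h1 : (k : ℝ) * κ = 1 := by
      field_simp at hk
      nlinarith [pi_pos]
    have h2 : 1 < k := by
      have : (1 : ℝ) < k := by nlinarith
      exact_mod_cast this
    have h3 : (2 : ℝ) ≤ k := by exact_mod_cast h2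
    nlinarith
  · have h1 : (k : ℝ) * (κ * R ^ 2) = 1 := by
      field_simp at hk
      linarith
    have h2 : 0 < k := by
      have : (0 : ℝ) < k := by
        by_contra! hk0
        nlinarith
      exact_mod_cast this
    have h3 : (1 : ℝ) ≤ k := by exact_mod_cast h2
    nlinarith

variable [FiniteDimensional ℝ V] [MeasurableSpace V] [BorelSpace V]

/-- If the volume of the hole is at most that of a ball, so is its inner radius. -/
theorem le_of_volume_le (h : IsEllipsoidalForm J R u₁ u₂ Q) (hJ : IsOrthogonalComplexStructure J)
    (hR : 1 < R) (hV : 1 ≤ Module.finrank ℝ V) {σ q : ℝ} (hσ : 0 < σ) (hq : 0 < q)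
    (hvol : volume.real {z | Q z ≤ σ} ≤ volume.real (closedBall (0 : V) √q)) : σ ≤ q := by
  by_contra! hlt
  have hsub : closedBall (0 : V) √σ ⊆ {z | Q z ≤ σ} := by
    intro z hz
    rw [mem_closedBall_zero_iff] at hz
    change Q z ≤ σ
    refine (h.le_norm_sq hJ hR z).trans ?_
    calc ‖z‖ ^ 2 ≤ √σ ^ 2 := by gcongr
      _ = σ := sq_sqrt hσ.le
  have hfin : volume {z | Q z ≤ σ} ≠ ⊤ :=
    (((h.isBounded_lt hJ hR (σ + 1)).subset fun z (hz : Q z ≤ σ) =>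
      show Q z < σ + 1 by linarith).measure_lt_top).ne
  have h1 := (measureReal_mono hsub hfin).trans hvol
  have : Nontrivial V := Module.nontrivial_of_finrank_pos (R := ℝ) (by omega)
  rw [Measure.real, Measure.real, Measure.addHaar_closedBall _ _ (sqrt_nonneg _),
    Measure.addHaar_closedBall _ _ (sqrt_nonneg _), ENNReal.toReal_mul, ENNReal.toReal_mul,
    ENNReal.toReal_ofReal (by positivity), ENNReal.toReal_ofReal (by positivity)] at h1
  have h2 : 0 < (volume (ball (0 : V) 1)).toReal :=
    ENNReal.toReal_pos (measure_ball_pos _ _ one_pos).ne' measure_ball_lt_top.ne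
  have h3 : √q ^ Module.finrank ℝ V < √σ ^ Module.finrank ℝ V :=
    pow_lt_pow_left₀ (sqrt_lt_sqrt hq.le hlt) (sqrt_nonneg _) (by omega)
  nlinarith

/-- Among the spheres of squared radius close to `r ^ 2`, the volume bound persists. -/
theorem _root_.exists_volume_ball_sqrt_lt {δ r a c : ℝ} (hr : 0 < r) (ha : a < r ^ 2)
    (hc : c < r ^ 2) (hδ : δ < volume.real (ball (0 : V) r)) :
    ∃ p, a < p ∧ c < p ∧ p < r ^ 2 ∧ δ < volume.real (ball (0 : V) √p) := by
  have hcont : ContinuousWithinAt (fun p : ℝ => √p ^ Module.finrank ℝ V *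
      volume.real (ball (0 : V) 1)) (Iio (r ^ 2)) (r ^ 2) := by
    have : Continuous fun p : ℝ => √p ^ Module.finrank ℝ V * volume.real (ball (0 : V) 1) := by
      fun_prop
    exact this.continuousWithinAt
  have hball : ∀ s : ℝ, 0 < s →
      volume.real (ball (0 : V) s) = s ^ Module.finrank ℝ V * volume.real (ball (0 : V) 1) := by
    intro s hs
    rw [Measure.real, Measure.addHaar_ball_of_pos _ _ hs, ENNReal.toReal_mul,
      ENNReal.toReal_ofReal (by positivity), Measure.real]
  rw [hball r hr] at hδ
  have h1 : ∀ᶠ p in 𝓝[<] (r ^ 2), δ < √p ^ Module.finrank ℝ V * volume.real (ball (0 : V) 1) := by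
    refine hcont.eventually (lt_mem_nhds ?_)
    simpa [sqrt_sq hr.le] using hδ
  have h2 : ∀ x : ℝ, x < r ^ 2 → ∀ᶠ p in 𝓝[<] (r ^ 2), x < p := fun x hx =>
    nhdsWithin_le_nhds (lt_mem_nhds hx)
  have h3 : (0 : ℝ) < r ^ 2 := by positivity
  obtain ⟨p, hp, hpa, hpc, hp0, hpr⟩ :=
    (h1.and ((h2 a ha).and ((h2 c hc).and ((h2 0 h3).and self_mem_nhdsWithin)))).exists
  exact ⟨p, hpa, hpc, hpr, by rwa [hball _ (sqrt_pos.2 hp0)]⟩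

variable {ρ τ a b r : ℝ} {φ : V → V}

theorem sq_lt_sq_of_embedding (h : IsEllipsoidalForm J R u₁ u₂ Q)
    (hJ : IsOrthogonalComplexStructure J) (hR : 1 < R) (hV : 3 ≤ Module.finrank ℝ V) (hρ : 0 < ρ)
    (hστ : ρ ^ 2 / R ^ 2 < τ) (hτ : τ < ρ ^ 2) (ha : 0 ≤ a)
    (hφ : IsSymplecticEmbedding J (sqShell V a b) φ)
    (hφD : ∀ w ∈ sqShell V a b, ρ ^ 2 / R ^ 2 < Q (φ w) ∧ Q (φ w) < τ) (hr : 0 < r)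
    (har : a < r ^ 2) (hrb : r ^ 2 < b)
    (hvol : volume.real {z | Q z < τ} - volume.real {z | Q z ≤ ρ ^ 2 / R ^ 2}
      < volume.real (ball (0 : V) r)) : r ^ 2 < ρ ^ 2 := by
  by_contra! hρr
  have hR0 : 0 < R := by linarith
  have hR2 : 1 < R ^ 2 := one_lt_pow₀ hR (by norm_num)
  have hσ : 0 < ρ ^ 2 / R ^ 2 := by positivity
  have hτρ : τ / ρ ^ 2 < 1 := by rwa [div_lt_one (by positivity)]
  have hRinv : 1 / R ^ 2 < 1 := by rwa [div_lt_one (by positivity)]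
  obtain ⟨κ, hκ, hκ1⟩ := exists_between
    (max_lt (max_lt (by norm_num : (1 / 2 : ℝ) < 1) hRinv) hτρ)
  obtain ⟨⟨hκ0, hκR⟩, hκτ⟩ : (1 / 2 < κ ∧ 1 / R ^ 2 < κ) ∧ τ / ρ ^ 2 < κ := by
    simpa only [max_lt_iff] using hκ
  have hκp : 0 < κ := by linarith
  rw [div_lt_iff₀ (by positivity)] at hκR hκτ
  set B := π / κ * τ with hB
  have hBr : B < π * r ^ 2 := by
    calc B = π * (τ / κ) := by rw [hB]; ring
      _ < π * ρ ^ 2 := by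
        gcongr
        rw [div_lt_iff₀ hκp]
        linarith
      _ ≤ π * r ^ 2 := by gcongr
  set e := (π * r ^ 2 - B) / 6 with he
  have he0 : 0 < e := by rw [he]; linarith
  obtain ⟨p, hap, hcp, hpr, hpvol⟩ := exists_volume_ball_sqrt_lt (c := (B + 3 * e) / π) hr har
    (by rw [div_lt_iff₀ pi_pos]; linarith) hvol
  rw [div_lt_iff₀ pi_pos] at hcp
  obtain ⟨q, hrq, hqb⟩ := exists_between hrb
  obtain ⟨-, M, H, ψ, hM, hH, hval⟩ := h.exists_shellHamiltonian hJ hR hV hσ hστ ha hφ hφD hap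
    (hpr.trans hrq) hqb he0 (M₀ := B + 1) hpvol
  obtain ⟨d, hd, hnr⟩ := h.exists_planeOp_left_nonresonance hJ hκ0 hκ1 hκR
  have hτ0 : 0 < τ := hσ.trans hστ
  obtain ⟨k, s, hs, hsk, hpos, hle⟩ := hH.exists_small_action_value hJ hV
    (W := planeOp J u₁ (π / κ) (π / κ / R ^ 2)) (hJ.inner_planeOp_left _ _) (hJ.planeOp_comm _ _)
    (w := π / κ / R ^ 2) (by positivity) (fun z => by
      rw [hJ.inner_planeOp_self h.norm_left, hJ.norm_sq_eq_add_planeProj h.norm_left z, mul_add]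
      have hle : π / κ / R ^ 2 ≤ π / κ := div_le_self (by positivity) hR2.le
      exact add_le_add_left (mul_le_mul_of_nonneg_right hle (sq_nonneg _)) _)
    hd hnr (u := u₁) (by
      intro hu
      simpa [hu] using h.norm_left)
    (by
      rw [hJ.inner_planeOp_self_basis h.norm_left, h.norm_left, one_pow, mul_one]
      exact le_div_self pi_pos.le hκp hκ1.le)
    (B := B) (by positivity)
    (fun x hx => (h.inner_planeOp_left_le hJ (by positivity) x).trans (by
      have : Q x < τ := hx
      rw [hB]
      gcongr))
    hM (β := ρ / R) (by positivity)
    (fun z hz => by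
      rw [mem_ball_zero_iff] at hz
      change Q z ≤ ρ ^ 2 / R ^ 2
      rw [← div_pow]
      refine (h.le_norm_sq hJ hR z).trans ?_
      gcongr)
    (fun z hz => lt_of_le_of_lt hz hστ)
  have := (hval k s hs hsk).1 hpos
  linarith

theorem le_sq_of_embedding (h : IsEllipsoidalForm J R u₁ u₂ Q)
    (hJ : IsOrthogonalComplexStructure J) (hR : 1 < R) (hV : 3 ≤ Module.finrank ℝ V) {σ : ℝ}
    (hσ : 0 < σ) (hστ : σ < τ) (ha : 0 ≤ a)
    (hφ : IsSymplecticEmbedding J (sqShell V a b) φ)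
    (hφD : ∀ w ∈ sqShell V a b, σ < Q (φ w) ∧ Q (φ w) < τ) (hr : 0 < r)
    (har : a < r ^ 2) (hrb : r ^ 2 < b)
    (hvol : volume.real {z | Q z < τ} - volume.real {z | Q z ≤ σ}
      < volume.real (ball (0 : V) r)) : σ ≤ r ^ 2 := by
  refine le_of_forall_gt_imp_ge_of_dense fun q hq => ?_
  obtain ⟨p, hap, -, hpr, hpvol⟩ := exists_volume_ball_sqrt_lt hr har har hvol
  obtain ⟨q', hq'r, hq'⟩ := exists_between (lt_min hq hrb)
  have hZ := (h.exists_shellHamiltonian hJ hR hV hσ hστ ha hφ hφD hap (hpr.trans hq'r)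
    (hq'.trans_le (min_le_right _ _)) one_pos (M₀ := 0) hpvol).1
  exact (h.le_of_volume_le hJ hR (by omega) hσ ((ha.trans_lt har).trans hq'r) hZ).trans
    (hq'.le.trans (min_le_left _ _))

set_option maxHeartbeats 800000 in
/-- A symplectic embedding of a spherical shell into an ellipsoidal shell whose volume is smaller
than that of the ball cannot exist. -/
theorem false_of_embedding (h : IsEllipsoidalForm J R u₁ u₂ Q)
    (hJ : IsOrthogonalComplexStructure J) (hR : 1 < R) (hR4 : R ^ 4 < 2)
    (hV : 3 ≤ Module.finrank ℝ V) (hρ : 0 < ρ)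
    (hστ : ρ ^ 2 / R ^ 2 < τ) (hτ : τ < ρ ^ 2) (ha : 0 ≤ a)
    (hφ : IsSymplecticEmbedding J (sqShell V a b) φ)
    (hφD : ∀ w ∈ sqShell V a b, ρ ^ 2 / R ^ 2 < Q (φ w) ∧ Q (φ w) < τ) (hr : 0 < r)
    (har : a < r ^ 2) (hrb : r ^ 2 < b)
    (hvol : volume.real {z | Q z < τ} - volume.real {z | Q z ≤ ρ ^ 2 / R ^ 2}
      < volume.real (ball (0 : V) r)) : False := by
  have hrρ := h.sq_lt_sq_of_embedding hJ hR hV hρ hστ hτ ha hφ hφD hr har hrb hvol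
  have hR0 : 0 < R := by linarith
  have hR2 : 1 < R ^ 2 := one_lt_pow₀ hR (by norm_num)
  have hR22 : R ^ 2 ≤ 2 := by nlinarith
  have hσ : 0 < ρ ^ 2 / R ^ 2 := by positivity
  have hσr := h.le_sq_of_embedding hJ hR hV hσ hστ ha hφ hφD hr har hrb hvol
  set T := ρ * R with hT
  have hTσ : T ^ 2 < 2 * (ρ ^ 2 / R ^ 2) := by
    rw [hT, mul_div_assoc', lt_div_iff₀ (by positivity)]
    have : 0 < ρ ^ 2 := by positivity
    nlinarith
  have hρT : ρ ^ 2 ≤ T ^ 2 := by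
    rw [hT, mul_pow]
    exact le_mul_of_one_le_right (sq_nonneg _) hR2.le
  have hDT : ∀ x : V, Q x < τ → ‖x‖ ^ 2 < T ^ 2 := fun x hx => by
    calc ‖x‖ ^ 2 ≤ R ^ 2 * Q x := h.norm_sq_le hJ hR x
      _ < R ^ 2 * ρ ^ 2 := by gcongr; exact hx.trans hτ
      _ = T ^ 2 := by rw [hT]; ring
  set e := min ((2 * π * r ^ 2 - π * T ^ 2) / 6) ((π * ρ ^ 2 - π * r ^ 2) / 4) with he
  have he1 : e ≤ (2 * π * r ^ 2 - π * T ^ 2) / 6 := min_le_left _ _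
  have he2 : e ≤ (π * ρ ^ 2 - π * r ^ 2) / 4 := min_le_right _ _
  have hpT : π * T ^ 2 < 2 * π * r ^ 2 := by nlinarith [pi_pos]
  have hpρ : π * r ^ 2 < π * ρ ^ 2 := by gcongr
  have he0 : 0 < e := lt_min (by linarith) (by linarith)
  obtain ⟨p, hap, hcp, hpr, hpvol⟩ := exists_volume_ball_sqrt_lt
    (c := (π * T ^ 2 + 3 * e) / (2 * π)) hr har
    (by rw [div_lt_iff₀ (by positivity)]; linarith) hvol
  rw [div_lt_iff₀ (by positivity)] at hcp
  obtain ⟨q, hrq, hq⟩ := exists_between (lt_min hrb (by linarith : r ^ 2 < (r ^ 2 + ρ ^ 2) / 2))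
  have hqρ : q < (r ^ 2 + ρ ^ 2) / 2 := hq.trans_le (min_le_right _ _)
  have hqe : π * q + e < π * ρ ^ 2 := by nlinarith [pi_pos]
  obtain ⟨A₃, hA₃, hA₃'⟩ := exists_between
    (lt_min (by nlinarith [pi_pos] : π * T ^ 2 < 2 * π * (ρ ^ 2 / R ^ 2))
      (by linarith : π * T ^ 2 < 2 * π * p - 3 * e))
  obtain ⟨-, M, H, ψ, hM, hH, hval⟩ := h.exists_shellHamiltonian hJ hR hV hσ hστ ha hφ hφD hap
    (hpr.trans hrq) (hq.trans_le (min_le_left _ _)) he0 (M₀ := 2 * π * (ρ ^ 2 / R ^ 2)) hpvol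
  have hT0 : 0 < T := by positivity
  obtain ⟨k, s, hs, hsk, h1, h2⟩ := hH.exists_large_action_value hJ hV hT0
    (fun x hx => (pow_lt_pow_iff_left₀ (norm_nonneg x) hT0.le two_ne_zero).1 (hDT x hx) |>.le)
    (fun x hx hxD => by
      have := hDT x hxD
      rw [hx] at this
      exact this.false)
    (fun z hz => lt_of_le_of_lt hz hστ)
    (W := planeOp J u₂ π (π * R ^ 2)) (hJ.planeOp_comm _ _)
    (fun z => by
      rw [hJ.inner_planeOp_self h.norm_right, hJ.norm_sq_eq_add_planeProj h.norm_right z, mul_add]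
      have hle : π ≤ π * R ^ 2 := le_mul_of_one_le_right pi_pos.le hR2.le
      exact add_le_add_right (mul_le_mul_of_nonneg_right hle (sq_nonneg _)) _)
    (fun z => by
      rw [hJ.inner_planeOp_self h.norm_right, hJ.norm_sq_eq_add_planeProj h.norm_right z, mul_add]
      have hle₁ : π ≤ 2 * π := by linarith [pi_pos]
      have hle₂ : π * R ^ 2 ≤ 2 * π := by
        rw [mul_comm]
        exact mul_le_mul_of_nonneg_right hR22 pi_pos.le
      exact add_le_add (mul_le_mul_of_nonneg_right hle₁ (sq_nonneg _))
        (mul_le_mul_of_nonneg_right hle₂ (sq_nonneg _)))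
    (u := u₂) (by
      intro hu
      simpa [hu] using h.norm_right)
    (by rw [hJ.inner_planeOp_self_basis h.norm_right, h.norm_right, one_pow, mul_one])
    (A₁ := π * ρ ^ 2) (A₂ := 2 * π * (ρ ^ 2 / R ^ 2)) (A₃ := A₃) (by positivity) (by gcongr)
    (fun z hz => by
      have hz' : ρ ^ 2 / R ^ 2 < Q z := not_le.1 hz
      refine le_trans ?_ (h.le_inner_planeOp_right hJ hR pi_pos.le z)
      rw [div_lt_iff₀ (by positivity)] at hz'
      nlinarith [pi_pos])
    (fun z hz => by
      have hz' : ρ ^ 2 / R ^ 2 < Q z := not_le.1 hz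
      have := h.le_norm_sq hJ hR z
      gcongr
      linarith)
    hA₃ (hA₃'.trans_le (min_le_left _ _))
    (by
      have : ρ ^ 2 / R ^ 2 ≤ ρ ^ 2 := div_le_self (sq_nonneg _) hR2.le
      gcongr
      linarith)
    hM
  have := (hval k s hs hsk).2 (h2.trans (hA₃'.le.trans (min_le_right _ _)))
  linarith

end IsEllipsoidalForm

end EllipsoidalShellNonembedding

section EllipsoidalShellVolume

open scoped Pointwise

variable {V : Type*} [NormedAddCommGroup V] [InnerProductSpace ℝ V]

/-- An open neighbourhood of a sphere contains a shell. -/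
theorem exists_sqShell_subset [FiniteDimensional ℝ V] {N : Set V} (hN : IsOpen N) {r : ℝ}
    (hr : 0 < r) (hsub : sphere (0 : V) r ⊆ N) :
    ∃ a b, 0 ≤ a ∧ a < r ^ 2 ∧ r ^ 2 < b ∧ sqShell V a b ⊆ N := by
  obtain ⟨δ, hδ, hδN⟩ := (isCompact_sphere (0 : V) r).exists_thickening_subset_open hN hsub
  obtain ⟨d, hd0, hd⟩ := exists_between (lt_min hδ hr)
  obtain ⟨hdδ, hdr⟩ := lt_min_iff.1 hd
  refine ⟨(r - d) ^ 2, (r + d) ^ 2, sq_nonneg _, by gcongr; linarith, by gcongr; linarith,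
    fun x hx => hδN ?_⟩
  have h1 : r - d < ‖x‖ := lt_of_pow_lt_pow_left₀ 2 (norm_nonneg x) hx.1
  have h2 : ‖x‖ < r + d := lt_of_pow_lt_pow_left₀ 2 (by linarith) hx.2
  have hx0 : 0 < ‖x‖ := by linarith
  refine mem_thickening_iff.2 ⟨(r / ‖x‖) • x, ?_, ?_⟩
  · rw [mem_sphere_zero_iff_norm, norm_smul, norm_div, norm_norm, norm_eq_abs, abs_of_pos hr,
      div_mul_cancel₀ _ hx0.ne']
  · have h3 : x - (r / ‖x‖) • x = ((‖x‖ - r) / ‖x‖) • x := by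
      rw [sub_div, div_self hx0.ne', sub_smul, one_smul]
    rw [dist_eq_norm, h3, norm_smul, norm_div, norm_norm, norm_eq_abs,
      div_mul_cancel₀ _ hx0.ne', abs_lt]
    constructor <;> linarith

variable {J : V →L[ℝ] V}

namespace IsEllipsoidalForm

variable {R : ℝ} {u₁ u₂ : V} {Q : V → ℝ}

variable [FiniteDimensional ℝ V] [MeasurableSpace V] [BorelSpace V]

/-- The volume of an ellipsoidal shell is at most `R ^ d - 1` times that of a ball. -/
theorem volume_sub_le (h : IsEllipsoidalForm J R u₁ u₂ Q) (hJ : IsOrthogonalComplexStructure J)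
    (hR : 1 < R) {ρ τ : ℝ} (hρ : 0 < ρ) (hτ : τ ≤ ρ ^ 2) :
    volume.real {z | Q z < τ} - volume.real {z | Q z ≤ ρ ^ 2 / R ^ 2} ≤
      (R ^ Module.finrank ℝ V - 1) *
        (ρ ^ Module.finrank ℝ V * volume.real (ball (0 : V) 1)) := by
  have hR0 : 0 < R := by linarith
  have hfin : ∀ c, volume {z | Q z ≤ c} ≠ ⊤ := fun c =>
    (((h.isBounded_lt hJ hR (c + 1)).subset fun z (hz : Q z ≤ c) =>
      show Q z < c + 1 by linarith).measure_lt_top).ne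
  have hout : volume.real {z | Q z < τ} ≤
      R ^ Module.finrank ℝ V * volume.real {z | Q z ≤ ρ ^ 2 / R ^ 2} := by
    rw [← abs_of_pos (pow_pos hR0 (Module.finrank ℝ V)), ← smul_eq_mul, smul_eq_mul]
    have hsm : volume.real (R • {z | Q z ≤ ρ ^ 2 / R ^ 2}) =
        |R ^ Module.finrank ℝ V| * volume.real {z | Q z ≤ ρ ^ 2 / R ^ 2} := by
      rw [Measure.real, Measure.addHaar_smul, ENNReal.toReal_mul,
        ENNReal.toReal_ofReal (abs_nonneg _), Measure.real]
    rw [← hsm]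
    refine measureReal_mono (fun z hz => ?_) ?_
    · have hz' : Q z < τ := hz
      rw [Set.mem_smul_set_iff_inv_smul_mem₀ hR0.ne']
      change Q (R⁻¹ • z) ≤ _
      rw [h.map_smul, inv_pow, le_div_iff₀ (by positivity)]
      field_simp
      linarith
    · rw [Measure.addHaar_smul]
      exact ENNReal.mul_ne_top ENNReal.ofReal_ne_top (hfin _)
  have hin : volume.real {z | Q z ≤ ρ ^ 2 / R ^ 2} ≤
      ρ ^ Module.finrank ℝ V * volume.real (ball (0 : V) 1) := by
    have hcb : volume.real (closedBall (0 : V) ρ) =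
        ρ ^ Module.finrank ℝ V * volume.real (ball (0 : V) 1) := by
      rw [Measure.real, Measure.addHaar_closedBall _ _ hρ.le, ENNReal.toReal_mul,
        ENNReal.toReal_ofReal (by positivity), Measure.real]
    rw [← hcb]
    refine measureReal_mono (fun z hz => ?_) measure_closedBall_lt_top.ne
    have hz' : Q z ≤ ρ ^ 2 / R ^ 2 := hz
    rw [mem_closedBall_zero_iff]
    refine le_of_sq_le_sq ?_ hρ.le
    refine (h.norm_sq_le hJ hR z).trans ?_
    rw [le_div_iff₀ (by positivity)] at hz'
    linarith
  have hRd : 0 ≤ R ^ Module.finrank ℝ V - 1 := sub_nonneg.2 (one_le_pow₀ hR.le)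
  have := mul_le_mul_of_nonneg_left hin hRd
  linarith

/-- A sphere that embeds symplectically into an ellipsoidal shell satisfies the volume bound. -/
theorem pow_le_of_embedding (h : IsEllipsoidalForm J R u₁ u₂ Q)
    (hJ : IsOrthogonalComplexStructure J) (hR : 1 < R) (hR4 : R ^ 4 < 2)
    (hV : 3 ≤ Module.finrank ℝ V) {ρ r : ℝ} (hρ : 0 < ρ) (hr : 0 < r) {N : Set V} {φ : V → V}
    (hφ : IsSymplecticEmbedding J N φ) (hN : sphere (0 : V) r ⊆ N)
    (hφN : ∀ w ∈ N, ρ ^ 2 / R ^ 2 < Q (φ w) ∧ Q (φ w) < ρ ^ 2) :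
    r ^ Module.finrank ℝ V ≤ (R ^ Module.finrank ℝ V - 1) * ρ ^ Module.finrank ℝ V := by
  have : Nontrivial V := Module.nontrivial_of_finrank_pos (R := ℝ) (by omega)
  have hcont : ContinuousOn (fun w => Q (φ w)) N := h.continuous.comp_continuousOn
    hφ.contDiffOn.continuousOn
  obtain ⟨w₀, hw₀, hmax⟩ := (isCompact_sphere (0 : V) r).exists_isMaxOn
    (NormedSpace.sphere_nonempty.2 hr.le) (hcont.mono hN)
  obtain ⟨τ, hτ₀, hτ⟩ := exists_between (hφN w₀ (hN hw₀)).2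
  obtain ⟨a, b, ha, har, hrb, hsub⟩ := exists_sqShell_subset
    (hcont.isOpen_inter_preimage hφ.isOpen (isOpen_Iio (a := τ))) hr
    (fun w hw => ⟨hN hw, (hmax hw).trans_lt hτ₀⟩)
  by_contra! hlt
  have hball : volume.real (ball (0 : V) r) =
      r ^ Module.finrank ℝ V * volume.real (ball (0 : V) 1) := by
    rw [Measure.real, Measure.addHaar_ball_of_pos _ _ hr, ENNReal.toReal_mul,
      ENNReal.toReal_ofReal (by positivity), Measure.real]
  have hpos : 0 < volume.real (ball (0 : V) 1) :=
    ENNReal.toReal_pos (measure_ball_pos _ _ one_pos).ne' measure_ball_lt_top.ne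
  refine h.false_of_embedding hJ hR hR4 hV hρ ((hφN w₀ (hN hw₀)).1.trans hτ₀) hτ ha
    (hφ.mono (isOpen_sqShell a b) fun w hw => (hsub hw).1)
    (fun w hw => ⟨(hφN w (hsub hw).1).1, (hsub hw).2⟩) hr har hrb ?_
  refine (h.volume_sub_le hJ hR hρ hτ.le).trans_lt ?_
  rw [hball, ← mul_assoc]
  gcongr

end IsEllipsoidalForm

end EllipsoidalShellVolume

section StandardSymplecticSpace

variable {n : ℕ}

/-- The index of the coordinate `x_i`. -/
def xIndex (i : Fin n) : Fin (2 * n) := ⟨2 * i.1, by have := i.isLt; omega⟩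

/-- The index of the coordinate `y_i`. -/
def yIndex (i : Fin n) : Fin (2 * n) := ⟨2 * i.1 + 1, by have := i.isLt; omega⟩

theorem sum_xIndex_add_yIndex (f : Fin (2 * n) → ℝ) :
    ∑ j, f j = ∑ i : Fin n, (f (xIndex i) + f (yIndex i)) := by
  rw [← Equiv.sum_comp (finProdFinEquiv.trans (finCongr (mul_comm n 2))) f, Fintype.sum_prod_type]
  refine Finset.sum_congr rfl fun i _ => ?_
  rw [Fin.sum_univ_two]
  congr 2 <;> ext <;> simp [xIndex, yIndex, add_comm]

theorem R2n_ext {v w : R2n n} (hx : ∀ i, v (xIndex i) = w (xIndex i))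
    (hy : ∀ i, v (yIndex i) = w (yIndex i)) : v = w := by
  ext j
  have hj := j.isLt
  rcases Nat.even_or_odd' j.1 with ⟨k, hk | hk⟩
  · have : j = xIndex ⟨k, by omega⟩ := Fin.ext hk
    rw [this, hx]
  · have : j = yIndex ⟨k, by omega⟩ := Fin.ext hk
    rw [this, hy]

theorem R2n_inner_eq (v w : R2n n) :
    inner ℝ v w =
      ∑ i : Fin n, (v (xIndex i) * w (xIndex i) + v (yIndex i) * w (yIndex i)) := by
  rw [PiLp.inner_apply, sum_xIndex_add_yIndex]
  simp [mul_comm]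

theorem R2n_norm_sq_eq (v : R2n n) :
    ‖v‖ ^ 2 = ∑ i : Fin n, (v (xIndex i) ^ 2 + v (yIndex i) ^ 2) := by
  rw [← real_inner_self_eq_norm_sq, R2n_inner_eq]
  simp [sq]

/-- The standard complex structure of `ℝ^{2n}` as a map. -/
def stdComplexStructureFun (v : R2n n) : R2n n := WithLp.toLp 2 fun j =>
  if j.1 % 2 = 0 then -v ⟨(j.1 + 1) % (2 * n), Nat.mod_lt _ (by have := j.isLt; omega)⟩
  else v ⟨j.1 - 1, by have := j.isLt; omega⟩

theorem stdComplexStructureFun_xIndex (v : R2n n) (i : Fin n) :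
    stdComplexStructureFun v (xIndex i) = -v (yIndex i) := by
  have h1 : (2 * i.1 + 1) % (2 * n) = 2 * i.1 + 1 :=
    Nat.mod_eq_of_lt (by have := i.isLt; omega)
  simp [stdComplexStructureFun, xIndex, yIndex, h1]

theorem stdComplexStructureFun_yIndex (v : R2n n) (i : Fin n) :
    stdComplexStructureFun v (yIndex i) = v (xIndex i) := by
  simp [stdComplexStructureFun, xIndex, yIndex, Nat.add_mod]

/-- The standard complex structure of `ℝ^{2n}`. -/
def stdComplexStructure (n : ℕ) : R2n n →L[ℝ] R2n n :=
  LinearMap.toContinuousLinearMap (IsLinearMap.mk' stdComplexStructureFun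
    { map_add := fun v w => R2n_ext
        (fun i => by simp [stdComplexStructureFun_xIndex, add_comm])
        (fun i => by simp [stdComplexStructureFun_yIndex])
      map_smul := fun c v => R2n_ext
        (fun i => by simp [stdComplexStructureFun_xIndex])
        (fun i => by simp [stdComplexStructureFun_yIndex]) })

@[simp] theorem stdComplexStructure_xIndex (v : R2n n) (i : Fin n) :
    stdComplexStructure n v (xIndex i) = -v (yIndex i) := stdComplexStructureFun_xIndex v i

@[simp] theorem stdComplexStructure_yIndex (v : R2n n) (i : Fin n) :
    stdComplexStructure n v (yIndex i) = v (xIndex i) := stdComplexStructureFun_yIndex v i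

theorem isOrthogonalComplexStructure_std (n : ℕ) :
    IsOrthogonalComplexStructure (stdComplexStructure n) where
  apply_apply v := R2n_ext (by simp) (by simp)
  inner_apply_apply v w := by
    rw [R2n_inner_eq, R2n_inner_eq]
    simp [add_comm]

theorem sympForm_eq_inner (v w : R2n n) :
    sympForm n v w = inner ℝ (stdComplexStructure n v) w := by
  rw [R2n_inner_eq, sympForm]
  refine Finset.sum_congr rfl fun i _ => ?_
  rw [stdComplexStructure_xIndex, stdComplexStructure_yIndex, xIndex, yIndex]
  ring

theorem IsSympEmbOn.isSymplecticEmbedding {N U : Set (R2n n)} {φ : R2n n → R2n n}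
    (h : IsSympEmbOn n N U φ) : IsSymplecticEmbedding (stdComplexStructure n) N φ :=
  ⟨h.1, h.2.1, h.2.2.1, fun w hw u v => by
    rw [← sympForm_eq_inner, ← sympForm_eq_inner]
    exact h.2.2.2.2 w hw u v⟩

theorem ellQ_eq (a : Fin n → ℝ) (z : R2n n) :
    ellQ n a z = ∑ i : Fin n, (z (xIndex i) ^ 2 + z (yIndex i) ^ 2) / a i ^ 2 := rfl

theorem ellQ_mul (c : ℝ) (a : Fin n → ℝ) (z : R2n n) :
    ellQ n (fun i => c * a i) z = ellQ n a z / c ^ 2 := by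
  rw [ellQ_eq, ellQ_eq, Finset.sum_div]
  refine Finset.sum_congr rfl fun i _ => ?_
  rw [mul_pow, div_div, mul_comm (a i ^ 2)]

theorem ellQ_smul (a : Fin n → ℝ) (s : ℝ) (z : R2n n) :
    ellQ n a (s • z) = s ^ 2 * ellQ n a z := by
  rw [ellQ_eq, ellQ_eq, Finset.mul_sum]
  refine Finset.sum_congr rfl fun i _ => ?_
  simp only [PiLp.smul_apply, smul_eq_mul]
  ring

theorem continuous_ellQ (a : Fin n → ℝ) : Continuous (ellQ n a) := by
  change Continuous fun z : R2n n =>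
    ∑ i : Fin n, (z (xIndex i) ^ 2 + z (yIndex i) ^ 2) / a i ^ 2
  fun_prop

theorem norm_sq_planeProj_single (i : Fin n) (z : R2n n) :
    ‖planeProj (stdComplexStructure n) (EuclideanSpace.single (xIndex i) 1) z‖ ^ 2 =
      z (xIndex i) ^ 2 + z (yIndex i) ^ 2 := by
  have hu : ‖(EuclideanSpace.single (xIndex i) 1 : R2n n)‖ = 1 := by simp
  have hJ := isOrthogonalComplexStructure_std n
  have h1 : inner ℝ (stdComplexStructure n (EuclideanSpace.single (xIndex i) 1)) z =
      z (yIndex i) := by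
    have := hJ.inner_apply_apply (stdComplexStructure n (EuclideanSpace.single (xIndex i) 1)) z
    rw [← this, hJ.apply_apply, inner_neg_left, EuclideanSpace.inner_single_left]
    simp
  rw [← hJ.inner_planeProj_self_eq hu, planeProj_apply, inner_add_left, inner_smul_left,
    inner_smul_left, h1, EuclideanSpace.inner_single_left]
  simp [sq]

theorem isEllipsoidalForm_ellQ {a : Fin n → ℝ} {R : ℝ} {i₁ i₂ : Fin n} (h₁ : a i₁ = 1)
    (h₂ : a i₂ = R) (ha1 : ∀ i, 1 ≤ a i) (haR : ∀ i, a i ≤ R) :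
    IsEllipsoidalForm (stdComplexStructure n) R (EuclideanSpace.single (xIndex i₁) 1)
      (EuclideanSpace.single (xIndex i₂) 1) (ellQ n a) := by
  have hJ := isOrthogonalComplexStructure_std n
  have hR : 0 < R := one_pos.trans_le ((ha1 i₁).trans (haR i₁))
  have hu : ∀ i : Fin n, ‖(EuclideanSpace.single (xIndex i) 1 : R2n n)‖ = 1 := by simp
  have hsub : ∀ (i : Fin n) (z : R2n n),
      ‖z - planeProj (stdComplexStructure n) (EuclideanSpace.single (xIndex i) 1) z‖ ^ 2 =
        ∑ j ∈ Finset.univ.erase i, (z (xIndex j) ^ 2 + z (yIndex j) ^ 2) := by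
    intro i z
    have h3 := hJ.norm_sq_eq_add_planeProj (hu i) z
    rw [norm_sq_planeProj_single, R2n_norm_sq_eq,
      ← Finset.add_sum_erase _ _ (Finset.mem_univ i)] at h3
    linarith
  refine ⟨continuous_ellQ a, ellQ_smul a, hu _, hu _, fun z => ?_, fun z => ?_⟩
  · rw [norm_sq_planeProj_single, hsub, ellQ_eq, ← Finset.add_sum_erase _ _ (Finset.mem_univ i₁),
      h₁, one_pow, div_one, Finset.sum_div]
    gcongr with j
    · have := ha1 j
      positivity
    · exact zero_le_one.trans (ha1 j)
    · exact haR j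
  · rw [norm_sq_planeProj_single, hsub, ellQ_eq, ← Finset.add_sum_erase _ _ (Finset.mem_univ i₂),
      h₂]
    gcongr with j
    exact div_le_self (by positivity) (one_le_pow₀ (ha1 j))

/-- Outside the closure of an ellipsoid the defining form is large. -/
theorem lt_ellQ_of_notMem_closure {a : Fin n → ℝ} {c : ℝ} (hc : 0 < c) {z : R2n n}
    (hz : z ∉ closure (ellipsoid n fun i => c * a i)) : c ^ 2 < ellQ n a z := by
  by_contra! hle
  refine hz ?_
  have h1 : Tendsto (fun s : ℝ => s • z) (𝓝[<] 1) (𝓝 z) := by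
    have : Continuous fun s : ℝ => s • z := by fun_prop
    simpa using (this.tendsto 1).mono_left nhdsWithin_le_nhds
  refine mem_closure_of_tendsto h1 ?_
  have h2 : Ioo (0 : ℝ) 1 ∈ 𝓝[<] (1 : ℝ) := Ioo_mem_nhdsLT one_pos
  filter_upwards [h2] with s hs
  change ellQ n _ _ < 1
  rw [ellQ_mul, ellQ_smul, div_lt_one (by positivity)]
  have hs2 : s ^ 2 < 1 := pow_lt_one₀ hs.1.le hs.2 two_ne_zero
  calc s ^ 2 * ellQ n a z ≤ s ^ 2 * c ^ 2 := by gcongr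
    _ < c ^ 2 := mul_lt_of_lt_one_left (by positivity) hs2

theorem closure_ellipsoid_subset (a : Fin n → ℝ) {c : ℝ} (hc : 0 < c) :
    closure (ellipsoid n fun i => c * a i) ⊆ {z | ellQ n a z ≤ c ^ 2} := by
  refine closure_minimal (fun z hz => ?_) (isClosed_le (continuous_ellQ a) continuous_const)
  have h1 : ellQ n (fun i => c * a i) z < 1 := hz
  rw [ellQ_mul, div_lt_one (by positivity)] at h1
  exact h1.le

theorem isOpen_ellShell (a : Fin n → ℝ) (ε : ℝ) : IsOpen (ellShell n a ε) :=
  (isOpen_lt (continuous_ellQ _) continuous_const).sdiff isClosed_closure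

/-- Inclusions are symplectic embeddings. -/
theorem sympEmbNbhd_of_subset {A U : Set (R2n n)} (hU : IsOpen U) (h : A ⊆ U) :
    SympEmbNbhd n A U :=
  ⟨U, id, h, hU, contDiff_id.contDiffOn, injOn_id U, mapsTo_id U, fun p _ v w => by
    rw [fderiv_id]
    rfl⟩

end StandardSymplecticSpace

theorem pow_le_of_sympEmbNbhd_ellShell {n : ℕ} (hn : 2 ≤ n) {a : Fin n → ℝ} {R r : ℝ}
    {i₁ i₂ : Fin n} (h₁ : a i₁ = 1) (h₂ : a i₂ = R) (ha1 : ∀ i, 1 ≤ a i) (haR : ∀ i, a i ≤ R)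
    (hR1 : 1 < R) (hR2 : R ^ (2 * n) < 2) (hr : 0 < r)
    (hemb : SympEmbNbhd n (sphere (0 : R2n n) r) (ellShell n a ((R - 1) / (R + 1)))) :
    r ^ (2 * n) ≤ (R ^ (2 * n) - 1) * (2 * R / (R + 1)) ^ (2 * n) := by
  obtain ⟨N, φ, hN, hφ⟩ := hemb
  have hR4 : R ^ 4 < 2 := (pow_le_pow_right₀ hR1.le (by omega)).trans_lt hR2
  have hR0 : 0 < R + 1 := by linarith
  have hout : 1 + (R - 1) / (R + 1) = 2 * R / (R + 1) := by field_simp; ring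
  have hin : 1 - (R - 1) / (R + 1) = 2 * R / (R + 1) / R := by field_simp; ring
  have hfr : Module.finrank ℝ (R2n n) = 2 * n := by simp
  have := (isEllipsoidalForm_ellQ h₁ h₂ ha1 haR).pow_le_of_embedding
    (isOrthogonalComplexStructure_std n) hR1 hR4 (by omega) (ρ := 2 * R / (R + 1)) (by positivity)
    hr hφ.isSymplecticEmbedding hN fun w hw => by
      obtain ⟨h1, h2⟩ := hφ.2.2.2.1 hw
      rw [hin] at h2
      refine ⟨?_, ?_⟩
      · rw [← div_pow]
        exact lt_ellQ_of_notMem_closure (by positivity) h2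
      · rw [hout] at h1
        change ellQ n _ _ < 1 at h1
        rwa [ellQ_mul, div_lt_one (by positivity)] at h1
  rwa [hfr] at this

theorem sphere_subset_ellShell {n : ℕ} {a : Fin n → ℝ} {R ε : ℝ}
    {i₁ i₂ : Fin n} (h₁ : a i₁ = 1) (h₂ : a i₂ = R) (ha1 : ∀ i, 1 ≤ a i) (haR : ∀ i, a i ≤ R)
    (hR1 : 1 < R) (hε : (R - 1) / (R + 1) < ε) (hε1 : ε < 1) :
    sphere (0 : R2n n) (2 * R / (R + 1)) ⊆ ellShell n a ε := by
  have hQ := isEllipsoidalForm_ellQ h₁ h₂ ha1 haR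
  have hJ := isOrthogonalComplexStructure_std n
  have hR0 : 0 < R + 1 := by linarith
  have hout : 1 + (R - 1) / (R + 1) = 2 * R / (R + 1) := by field_simp; ring
  have hin : (1 - (R - 1) / (R + 1)) * R = 2 * R / (R + 1) := by field_simp; ring
  have hρ : 0 < 2 * R / (R + 1) := by positivity
  intro z hz
  rw [mem_sphere_zero_iff_norm] at hz
  refine ⟨?_, fun hzc => ?_⟩
  · change ellQ n _ _ < 1
    have h3 : 0 < 1 + ε := by linarith
    rw [ellQ_mul, div_lt_one (by positivity)]
    refine (hQ.le_norm_sq hJ hR1 z).trans_lt ?_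
    rw [hz]
    gcongr
    linarith
  · have h4 : ellQ n a z ≤ (1 - ε) ^ 2 := closure_ellipsoid_subset a (by linarith) hzc
    have h5 := hQ.norm_sq_le hJ hR1 z
    rw [hz] at h5
    have h6 : (2 * R / (R + 1)) ^ 2 ≤ ((1 - ε) * R) ^ 2 := by
      rw [mul_pow, mul_comm ((1 - ε) ^ 2)]
      exact h5.trans (by gcongr)
    have h7 : 2 * R / (R + 1) ≤ (1 - ε) * R :=
      le_of_sq_le_sq h6 (mul_nonneg (by linarith) (by linarith))
    rw [← hin] at h7
    have h8 := le_of_mul_le_mul_right h7 (by linarith)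
    linarith

/-- `s(U_(ε₀)) ≤ (R^(2n) - 1)^(1/n) · 4πR²/(R+1)²`, and `s(U_(ε₀)) < s(U_ε)` for every
`ε ∈ (ε₀, 1)`, where `ε₀ = (R-1)/(R+1)`. -/
theorem spherical_capacity_jump_on_ellipsoidal_shells
    (n : ℕ) (hn : 2 ≤ n) (a : Fin n → ℝ) (R : ℝ)
    (hmono : Monotone a) (hfirst : a ⟨0, by omega⟩ = 1) (hlast : a ⟨n - 1, by omega⟩ = R)
    (hR1 : 1 < R) (hR2 : R < (2 : ℝ) ^ ((1 : ℝ) / (2 * (n : ℝ)))) :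
    sphericalCap n (ellShell n a ((R - 1) / (R + 1))) ≤
        ENNReal.ofReal (((R ^ (2 * n) - 1) ^ ((1 : ℝ) / (n : ℝ))) *
          (4 * π * R ^ 2 / (R + 1) ^ 2)) ∧
      ∀ ε ∈ Ioo ((R - 1) / (R + 1)) (1 : ℝ),
        sphericalCap n (ellShell n a ((R - 1) / (R + 1))) <
          sphericalCap n (ellShell n a ε) := by
  have ha1 : ∀ i, 1 ≤ a i := fun i => by
    rw [← hfirst]
    exact hmono (Fin.mk_le_of_le_val (Nat.zero_le _))
  have haR : ∀ i, a i ≤ R := fun i => by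
    rw [← hlast]
    exact hmono (Fin.le_def.2 (by have := i.isLt; change i.1 ≤ n - 1; omega))
  have hR0 : 0 < R := by linarith
  have hn0 : (n : ℝ) ≠ 0 := by
    have : n ≠ 0 := by omega
    exact_mod_cast this
  have hRn : R ^ (2 * n) < 2 := by
    have h1 : R ^ (2 * n) < ((2 : ℝ) ^ ((1 : ℝ) / (2 * (n : ℝ)))) ^ (2 * n) :=
      pow_lt_pow_left₀ hR2 hR0.le (by omega)
    rwa [← rpow_natCast, ← rpow_natCast, ← rpow_mul zero_le_two, Nat.cast_mul, Nat.cast_two,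
      one_div_mul_cancel (by simpa using hn0), rpow_one, ← Nat.cast_two, ← Nat.cast_mul,
      rpow_natCast, Nat.cast_two] at h1
  have hX0 : 0 < R ^ (2 * n) - 1 := sub_pos.2 (one_lt_pow₀ hR1 (by omega))
  set X := (R ^ (2 * n) - 1) ^ ((1 : ℝ) / (n : ℝ)) with hX
  have hXp : 0 < X := rpow_pos_of_pos hX0 _
  have hXn : X ^ n = R ^ (2 * n) - 1 := by
    rw [hX, ← rpow_natCast, ← rpow_mul hX0.le, one_div_mul_cancel hn0, rpow_one]
  have hX1 : X < 1 := rpow_lt_one hX0.le (by linarith) (by positivity)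
  have hρ : 4 * π * R ^ 2 / (R + 1) ^ 2 = π * (2 * R / (R + 1)) ^ 2 := by
    rw [div_pow]
    ring
  have hle : sphericalCap n (ellShell n a ((R - 1) / (R + 1))) ≤
      ENNReal.ofReal (X * (4 * π * R ^ 2 / (R + 1) ^ 2)) := by
    refine sSup_le ?_
    rintro c ⟨r, hr, rfl, hemb⟩
    refine ENNReal.ofReal_le_ofReal ?_
    have h1 := pow_le_of_sympEmbNbhd_ellShell hn hfirst hlast ha1 haR hR1 hRn hr hemb
    rw [pow_mul, ← hXn, pow_mul (2 * R / (R + 1)), ← mul_pow] at h1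
    have h2 := (pow_le_pow_iff_left₀ (by positivity) (by positivity) (by omega)).1 h1
    rw [hρ, mul_left_comm]
    gcongr
  refine ⟨hle, fun ε hε => hle.trans_lt ?_⟩
  have h3 : ENNReal.ofReal (π * (2 * R / (R + 1)) ^ 2) ≤ sphericalCap n (ellShell n a ε) :=
    le_sSup ⟨2 * R / (R + 1), by positivity, rfl, sympEmbNbhd_of_subset (isOpen_ellShell a ε)
      (sphere_subset_ellShell hfirst hlast ha1 haR hR1 hε.1 hε.2)⟩
  refine lt_of_lt_of_le ?_ h3
  rw [hρ, ENNReal.ofReal_lt_ofReal_iff (by positivity)]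
  exact mul_lt_of_lt_one_left (by positivity) hX1
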